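/- Let D ≥ 3 be an odd integer. There is a constant C(D) such that for every nonzero binary form F(X, Y) ∈ ℤ[X, Y] of degree D with no repeated factor and all real U, V ≥ 1, the number μ(U, V) of pairs of integers (x, y) with |x| ≤ U, |y| ≤ V for which F(x, y) is a nonzero perfect square satisfies μ(U, V) ≤ C(D) · (UV)^{2/3} (log(2‖F‖))², where ‖F‖ is the maximum of the absolute values of the coefficients of F. -/

import Mathlib

section
open MvPolynomial

/-- The maximum of the absolute values of the coefficients of an integral polynomial. -/
def polyNorm (F : MvPolynomial (Fin 2) ℤ) : ℕ :=
  F.support.sup fun d => (F.coeff d).natAbs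
end

section
open Polynomial
namespace SqSieve

/-- iterated twisted derivative -/
noncomputable def stIt {F : Type*} [Field F] (f : F[X]) (e : F) : ℕ → F[X] →ₗ[F] F[X]
  | 0 => LinearMap.id
  | k + 1 => (LinearMap.mulLeft F f).comp ((derivative : F[X] →ₗ[F] F[X]).comp (stIt f e k)) +
      (LinearMap.mulLeft F (C (e - k) * derivative f)).comp (stIt f e k)

lemma stIt_succ {F : Type*} [Field F] (f : F[X]) (e : F) (k : ℕ) (r : F[X]) :
    stIt f e (k + 1) r = f * derivative (stIt f e k r)
      + C (e - k) * derivative f * stIt f e k r := by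
  simp [stIt, mul_assoc]

lemma stIt_degree {F : Type*} [Field F] (f : F[X]) (e : F) (d m : ℕ) (hd : f.natDegree ≤ d)
    (r : F[X]) (hr : r.degree < m) (k : ℕ) : (stIt f e k r).degree < (m + k * d : ℕ) := by
  induction k with
  | zero => simpa [stIt] using hr
  | succ k ih =>
    rw [stIt_succ]
    by_cases h0 : stIt f e k r = 0
    · rw [h0, derivative_zero, mul_zero, mul_zero, add_zero, degree_zero]
      exact WithBot.bot_lt_coe _
    have hlt : (stIt f e k r).natDegree < m + k * d := by
      rwa [← Polynomial.natDegree_lt_iff_degree_lt h0] at ih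
    have e1 : (m + (k + 1) * d : ℕ) = m + k * d + d := by ring
    rw [e1]
    have hpos : 0 < m + k * d + d := by omega
    have key : ∀ q : F[X], q.natDegree < m + k * d + d → q.degree < (m + k * d + d : ℕ) := by
      intro q hq
      exact lt_of_le_of_lt Polynomial.degree_le_natDegree (by exact_mod_cast hq)
    apply key
    refine lt_of_le_of_lt (natDegree_add_le _ _) ?_
    apply max_lt
    · refine lt_of_le_of_lt natDegree_mul_le ?_
      have := natDegree_derivative_le (stIt f e k r)
      omega
    · refine lt_of_le_of_lt natDegree_mul_le ?_
      have h2 := natDegree_C_mul_le (e - k) (derivative f)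
      have := natDegree_derivative_le f
      omega

lemma stIt_deriv {F : Type*} [Field F] (f : F[X]) (E : ℕ) (r W : F[X])
    (hW : derivative W = 0) (k : ℕ) (hk : k ≤ E) :
    derivative^[k] (f ^ E * r * W) = f ^ (E - k) * stIt f (E : F) k r * W := by
  induction k with
  | zero => simp [stIt]
  | succ k ih =>
    rw [Function.iterate_succ_apply', ih (by omega), stIt_succ]
    obtain ⟨n, hn⟩ : ∃ n, E - k = n + 1 := ⟨E - k - 1, by omega⟩
    have h2 : E - (k + 1) = n := by omega
    have h3 : (E : F) - k = (n : F) + 1 := by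
      have : E = n + 1 + k := by omega
      rw [this]; push_cast; ring
    rw [hn, h2, h3]
    simp only [derivative_mul, hW, derivative_pow, map_add, map_natCast, map_one]
    simp only [Nat.add_sub_cancel, mul_zero, add_zero]
    push_cast
    ring

lemma even_odd_mult {F : Type*} [Field F] (f q r s : F[X]) (c : F) (hc : c ≠ 0)
    (hq : Irreducible q) (h1 : q ∣ f) (h2 : ¬ q ^ 2 ∣ f) (h : r ^ 2 * f = C c * s ^ 2) :
    r = 0 ∧ s = 0 := by
  have hp : Prime q := hq.prime
  have hf0 : f ≠ 0 := by rintro rfl; simp at h2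
  have hcC : (C c : F[X]) ≠ 0 := by simpa using hc
  have key : s = 0 := by
    by_contra hs
    have hr : r ≠ 0 := by
      rintro rfl
      simp [hs, hc] at h
      
    have hm := congrArg (emultiplicity q) h
    rw [emultiplicity_mul hp, emultiplicity_mul hp, emultiplicity_pow hp, emultiplicity_pow hp] at hm
    have fr : FiniteMultiplicity q r := FiniteMultiplicity.of_not_isUnit hq.not_isUnit hr
    have fs : FiniteMultiplicity q s := FiniteMultiplicity.of_not_isUnit hq.not_isUnit hs
    have ff : emultiplicity q f = 1 := by
      have := (emultiplicity_eq_coe (a := q) (b := f) (n := 1)).2 ⟨by simpa using h1, by simpa using h2⟩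
      simpa using this
    have fc : emultiplicity q (C c) = 0 := by
      rw [emultiplicity_eq_zero]
      intro hd
      exact hq.not_isUnit (isUnit_of_dvd_unit hd (by simpa using hc))
    rw [ff, fc, fr.emultiplicity_eq_multiplicity, fs.emultiplicity_eq_multiplicity] at hm
    norm_cast at hm
    omega
  subst key
  simp [hf0] at h
  exact ⟨h, rfl⟩

end SqSieve
end

section
open Polynomial
namespace SqSieve

lemma stepanov_kernel {F : Type*} [Field F] (f : F[X]) (a e1 e2 c : F) (d l m J : ℕ)
    (hd : f.natDegree ≤ d) (hlt : l * (m + l * d + J) < 2 * (m * J)) :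
    ∃ r s : ℕ → F[X], (∀ j, (r j).degree < m) ∧ (∀ j, (s j).degree < m) ∧
      (∃ j < J, r j ≠ 0 ∨ s j ≠ 0) ∧
      ∀ k < l, ∑ j ∈ Finset.range J, (stIt f e1 k (r j) + C a * stIt f e2 k (s j)) * (X - C c) ^ j = 0 := by
  classical
  let N := m + l * d + J
  let S : Fin l → ((Fin J → degreeLT F m) × (Fin J → degreeLT F m)) →ₗ[F] F[X] := fun k =>
    { toFun := fun v => ∑ j : Fin J, (stIt f e1 k (v.1 j : F[X]) + C a * stIt f e2 k (v.2 j : F[X])) * (X - C c) ^ (j : ℕ)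
      map_add' := by
        intro v w
        rw [← Finset.sum_add_distrib]
        refine Finset.sum_congr rfl fun j _ => ?_
        simp only [Prod.fst_add, Prod.snd_add, Pi.add_apply, Submodule.coe_add, map_add]
        ring
      map_smul' := by
        intro t v
        simp only [Prod.smul_fst, Prod.smul_snd, Pi.smul_apply, Submodule.coe_smul, LinearMap.map_smul, RingHom.id_apply,
          Finset.smul_sum]
        refine Finset.sum_congr rfl fun j _ => ?_
        simp only [smul_eq_C_mul]
        ring }
  let Φ : ((Fin J → degreeLT F m) × (Fin J → degreeLT F m)) →ₗ[F] (Fin l × Fin N → F) :=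
    LinearMap.pi fun ki => (lcoeff F (ki.2 : ℕ)).comp (S ki.1)
  have hfin : Module.finrank F (degreeLT F m) = m := by
    rw [(degreeLTEquiv F m).finrank_eq]; simp
  have : Module.Finite F (degreeLT F m) := Module.Finite.equiv (degreeLTEquiv F m).symm
  have hker : LinearMap.ker Φ ≠ ⊥ := by
    apply LinearMap.ker_ne_bot_of_finrank_lt
    rw [Module.finrank_prod, Module.finrank_fintype_fun_eq_card, Module.finrank_pi_fintype]
    simp only [hfin, Fintype.card_prod, Fintype.card_fin, Finset.sum_const, Finset.card_univ, smul_eq_mul]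
    calc l * N < 2 * (m * J) := hlt
      _ = J * m + J * m := by ring
  obtain ⟨v, hv, hv0⟩ := Submodule.exists_mem_ne_zero_of_ne_bot hker
  have hdeg : ∀ (x : degreeLT F m), (x : F[X]).degree < m := fun x => mem_degreeLT.1 x.2
  refine ⟨fun j => if h : j < J then (v.1 ⟨j, h⟩ : F[X]) else 0,
    fun j => if h : j < J then (v.2 ⟨j, h⟩ : F[X]) else 0, ?_, ?_, ?_, ?_⟩
  · intro j
    dsimp only
    split_ifs
    · exact hdeg _
    · rw [degree_zero]; exact WithBot.bot_lt_coe _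
  · intro j
    dsimp only
    split_ifs
    · exact hdeg _
    · rw [degree_zero]; exact WithBot.bot_lt_coe _
  · by_contra hcon
    push Not at hcon
    apply hv0
    apply Prod.ext
    · funext j
      have := (hcon j j.2).1
      simpa using this
    · funext j
      have := (hcon j j.2).2
      simpa using this
  · intro k hk
    have hS : S ⟨k, hk⟩ v = 0 := by
      ext i
      by_cases hi : i < N
      · have := congrFun (LinearMap.mem_ker.1 hv) (⟨k, hk⟩, ⟨i, hi⟩)
        simpa [Φ] using this
      · rw [coeff_zero]
        apply coeff_eq_zero_of_degree_lt
        refine lt_of_lt_of_le ?_ (by exact_mod_cast (not_lt.1 hi) : ((N : ℕ) : WithBot ℕ) ≤ i)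
        rw [← mem_degreeLT]
        change ∑ j : Fin J, (stIt f e1 k (v.1 j : F[X]) + C a * stIt f e2 k (v.2 j : F[X])) * (X - C c) ^ (j : ℕ) ∈ _
        refine Submodule.sum_mem _ fun j _ => ?_
        rw [mem_degreeLT]
        have h1 := stIt_degree f e1 d m hd _ (hdeg (v.1 j)) k
        have h2 := stIt_degree f e2 d m hd _ (hdeg (v.2 j)) k
        have h3 : (stIt f e1 k (v.1 j : F[X]) + C a * stIt f e2 k (v.2 j : F[X])).degree < (m + k * d : ℕ) := by
          rw [← mem_degreeLT] at h1 h2 ⊢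
          rw [← smul_eq_C_mul]
          exact Submodule.add_mem _ h1 (Submodule.smul_mem _ _ h2)
        have h4 : ((X - C c : F[X]) ^ (j : ℕ)).degree ≤ (j : ℕ) := by
          simp [degree_X_sub_C]
        by_cases h0 : (stIt f e1 k (v.1 j : F[X]) + C a * stIt f e2 k (v.2 j : F[X])) = 0
        · rw [h0, zero_mul, degree_zero]; exact WithBot.bot_lt_coe _
        · rw [← natDegree_lt_iff_degree_lt h0] at h3
          refine lt_of_le_of_lt degree_le_natDegree ?_
          have h5 : ((X - C c : F[X]) ^ (j : ℕ)).natDegree ≤ j := natDegree_le_of_degree_le h4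
          have h6 := natDegree_mul_le (p := (stIt f e1 k (v.1 j : F[X]) + C a * stIt f e2 k (v.2 j : F[X]))) (q := (X - C c : F[X]) ^ (j : ℕ))
          have h7 : k * d ≤ l * d := Nat.mul_le_mul_right _ hk.le
          have h8 := j.2
          have : ((stIt f e1 k (v.1 j : F[X]) + C a * stIt f e2 k (v.2 j : F[X])) * (X - C c : F[X]) ^ (j : ℕ)).natDegree < N := by
            simp only [N]; omega
          exact_mod_cast this
    rw [Finset.sum_range]
    simpa [S] using hS

lemma indep_aux {R : Type*} [CommRing R] [IsDomain R] (w : R) (hw : w ≠ 0) (J : ℕ) :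
    ∀ A : ℕ → R, (∀ j, w ∣ A j → A j = 0) → ∑ j ∈ Finset.range J, A j * w ^ j = 0 →
      ∀ j < J, A j = 0 := by
  induction J with
  | zero => intro A _ _ j hj; omega
  | succ J ih =>
    intro A hA hs
    rw [Finset.sum_range_succ'] at hs
    have e : ∑ k ∈ Finset.range J, A (k + 1) * w ^ (k + 1) = w * ∑ k ∈ Finset.range J, A (k + 1) * w ^ k := by
      rw [Finset.mul_sum]; exact Finset.sum_congr rfl fun _ _ => by ring
    rw [e, pow_zero, mul_one] at hs
    have h0 : A 0 = 0 := hA 0 ⟨-∑ k ∈ Finset.range J, A (k + 1) * w ^ k, by linear_combination hs⟩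
    rw [h0, add_zero] at hs
    have h1 := (mul_eq_zero.1 hs).resolve_left hw
    intro j hj
    rcases j with _ | j
    · exact h0
    · exact ih (fun j => A (j + 1)) (fun j => hA (j + 1)) h1 j (by omega)

lemma dvd_case (p : ℕ) [Fact p.Prime] (f r s q : (ZMod p)[X]) (c : ZMod p) (h m d : ℕ)
    (hp : p = 2 * h + 1) (hd : f.natDegree ≤ d) (hm : 2 * m + d ≤ p) (hc : f.eval c ≠ 0)
    (hr : r.degree < m) (hs : s.degree < m)
    (hq : Irreducible q) (h1 : q ∣ f) (h2 : ¬ q ^ 2 ∣ f)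
    (hw : (X - C c) ^ p ∣ r + f ^ h * s) : r = 0 ∧ s = 0 := by
  apply even_odd_mult f q r s (f.eval c) hc hq h1 h2
  have a1 : (X - C c) ^ p ∣ r ^ 2 * f - s ^ 2 * f ^ p := by
    obtain ⟨t, ht⟩ := hw
    refine ⟨t * (r - f ^ h * s) * f, ?_⟩
    have : f ^ p = f ^ h * f ^ h * f := by
      rw [← pow_add, ← pow_succ]; congr 1; omega
    rw [this]
    linear_combination (r - f ^ h * s) * f * ht
  have a2 : (X - C c) ^ p ∣ f ^ p - C (f.eval c) := by
    have : f ^ p - C (f.eval c) = (f - C (f.eval c)) ^ p := by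
      rw [sub_pow_char, ← C_pow, ZMod.pow_card]
    rw [this]
    exact pow_dvd_pow_of_dvd (X_sub_C_dvd_sub_C_eval) p
  have a3 : (X - C c) ^ p ∣ r ^ 2 * f - C (f.eval c) * s ^ 2 := by
    have := dvd_add a1 (a2.mul_left (s ^ 2))
    convert this using 1; ring
  have hm0 : 0 < m ∨ (r = 0 ∧ s = 0) := by
    rcases Nat.eq_zero_or_pos m with h | h
    · right; subst h
      constructor
      · by_contra h0
        rw [← natDegree_lt_iff_degree_lt h0] at hr; omega
      · by_contra h0
        rw [← natDegree_lt_iff_degree_lt h0] at hs; omega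
    · exact Or.inl h
  rcases hm0 with hm0 | ⟨rfl, rfl⟩
  swap
  · simp
  have nr : r.natDegree ≤ m - 1 := by
    by_cases h0 : r = 0
    · simp [h0]
    · rw [← natDegree_lt_iff_degree_lt h0] at hr; omega
  have ns : s.natDegree ≤ m - 1 := by
    by_cases h0 : s = 0
    · simp [h0]
    · rw [← natDegree_lt_iff_degree_lt h0] at hs; omega
  have := Polynomial.eq_zero_of_dvd_of_natDegree_lt a3 (by
    rw [natDegree_pow, natDegree_X_sub_C]
    refine lt_of_le_of_lt (natDegree_sub_le _ _) ?_
    apply max_lt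
    · refine lt_of_le_of_lt natDegree_mul_le ?_
      have := natDegree_pow_le (p := r) (n := 2)
      omega
    · refine lt_of_le_of_lt (natDegree_C_mul_le _ _) ?_
      have := natDegree_pow_le (p := s) (n := 2)
      omega)
  exact sub_eq_zero.1 this

end SqSieve
end

section
open Polynomial
namespace SqSieve

lemma card_mul_le_natDegree {F : Type*} [Field F] [DecidableEq F] (R : F[X]) (hR : R ≠ 0) (S : Finset F) (l : ℕ)
    (h : ∀ x ∈ S, l ≤ R.rootMultiplicity x) : S.card * l ≤ R.natDegree := by
  have h1 : l • S.val ≤ R.roots := by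
    rw [Multiset.le_iff_count]
    intro x
    rw [Multiset.count_nsmul, count_roots]
    by_cases hx : x ∈ S
    · rw [Multiset.count_eq_one_of_mem S.nodup hx]; simpa using h x hx
    · rw [Multiset.count_eq_zero_of_notMem hx]; simp
  have h2 := Multiset.card_le_card h1
  rw [Multiset.card_nsmul] at h2
  have h3 := R.card_roots'
  calc S.card * l = l * S.val.card := by rw [mul_comm]; rfl
    _ ≤ _ := by simpa using h2
    _ ≤ _ := h3

lemma iterate_derivative_sum' {F : Type*} [Field F] (k : ℕ) (s : Finset ℕ) (g : ℕ → F[X]) :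
    derivative^[k] (∑ j ∈ s, g j) = ∑ j ∈ s, derivative^[k] (g j) := by
  exact Polynomial.iterate_derivative_sum k s g

lemma stepanov_count (p : ℕ) [Fact p.Prime] (f q : (ZMod p)[X]) (c a : ZMod p) (h l m J d : ℕ)
    (hp : p = 2 * h + 1) (hd : f.natDegree ≤ d) (hm : 2 * m + d ≤ p) (hc : f.eval c ≠ 0)
    (hq : Irreducible q) (h1 : q ∣ f) (h2 : ¬ q ^ 2 ∣ f) (hl : l ≤ p) (hl0 : 0 < l)
    (hlt : l * (m + l * d + J) < 2 * (m * J)) (ha : a ≠ 0) :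
    (Finset.univ.filter fun x : ZMod p => f.eval x ^ h = a).card * l ≤ (l + h) * d + m + p * (J - 1) := by
  classical
  obtain ⟨r, s, hr, hs, ⟨j0, hj0, hne⟩, hker⟩ := stepanov_kernel f a (l : ZMod p) ((l + h : ℕ) : ZMod p) c d l m J hd hlt
  set w : (ZMod p)[X] := (X - C c) ^ p with hw
  have hw0 : w ≠ 0 := pow_ne_zero _ (X_sub_C_ne_zero c)
  have hdw : derivative w = 0 := by
    rw [hw, derivative_pow]; simp
  have hdwj : ∀ j, derivative (w ^ j) = 0 := by
    intro j; rw [derivative_pow, hdw]; simp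
  have hf0 : f ≠ 0 := by rintro rfl; simp at hc
  set R : (ZMod p)[X] := ∑ j ∈ Finset.range J, (f ^ l * r j * w ^ j + f ^ (l + h) * s j * w ^ j) with hRdef
  have hR : R ≠ 0 := by
    intro h0
    have e : R = f ^ l * ∑ j ∈ Finset.range J, (r j + f ^ h * s j) * w ^ j := by
      rw [hRdef, Finset.mul_sum]
      refine Finset.sum_congr rfl fun j _ => ?_
      rw [pow_add]; ring
    rw [e] at h0
    have h0' := (mul_eq_zero.1 h0).resolve_left (pow_ne_zero _ hf0)
    have key := indep_aux w hw0 J (fun j => r j + f ^ h * s j) (fun j hj => by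
      obtain ⟨e1, e2⟩ := dvd_case p f (r j) (s j) q c h m d hp hd hm hc (hr j) (hs j) hq h1 h2 hj
      simp [e1, e2]) h0' j0 hj0
    obtain ⟨e1, e2⟩ := dvd_case p f (r j0) (s j0) q c h m d hp hd hm hc (hr j0) (hs j0) hq h1 h2 (by
      rw [key]; exact dvd_zero _)
    rcases hne with hne | hne
    · exact hne e1
    · exact hne e2
  refine le_trans (card_mul_le_natDegree R hR _ l ?_) ?_
  · intro x hx
    have hx' : f.eval x ^ h = a := by simpa using hx
    have hwx : w.eval x = x - c := by
      rw [hw, eval_pow, ZMod.pow_card]; simp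
    obtain ⟨n, rfl⟩ : ∃ n, l = n + 1 := ⟨l - 1, by omega⟩
    apply Polynomial.lt_rootMultiplicity_of_isRoot_iterate_derivative_of_mem_nonZeroDivisors' hR
    · intro k hk
      have hk' : k < n + 1 := by omega
      have e : derivative^[k] R = ∑ j ∈ Finset.range J, (f ^ (n + 1 - k) * stIt f ((n + 1 : ℕ) : ZMod p) k (r j) * w ^ j
          + f ^ (n + 1 + h - k) * stIt f ((n + 1 + h : ℕ) : ZMod p) k (s j) * w ^ j) := by
        rw [hRdef, iterate_derivative_sum']
        refine Finset.sum_congr rfl fun j _ => ?_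
        rw [iterate_map_add, stIt_deriv f (n + 1) (r j) _ (hdwj j) k (by omega),
          stIt_deriv f (n + 1 + h) (s j) _ (hdwj j) k (by omega)]
      have hz := congrArg (eval x) (hker k hk')
      rw [IsRoot, e, eval_finsetSum]
      rw [eval_finsetSum, eval_zero] at hz
      calc _ = f.eval x ^ (n + 1 - k) * ∑ j ∈ Finset.range J, eval x ((stIt f ((n + 1 : ℕ) : ZMod p) k (r j) + C a * stIt f ((n + 1 + h : ℕ) : ZMod p) k (s j)) * (X - C c) ^ j) := by
            rw [Finset.mul_sum]
            refine Finset.sum_congr rfl fun j _ => ?_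
            have e3 : n + 1 + h - k = (n + 1 - k) + h := by omega
            simp only [eval_add, eval_mul, eval_pow, hwx, eval_sub, eval_X, eval_C, e3, pow_add, hx']
            ring
        _ = 0 := by rw [hz, mul_zero]
    · intro k hk hk0
      rw [mem_nonZeroDivisors_iff_ne_zero]
      intro h0
      rw [ZMod.natCast_eq_zero_iff] at h0
      have := Nat.le_of_dvd (by omega) h0
      omega
  · have hnat : ∀ g : (ZMod p)[X], g.degree < m → g.natDegree ≤ m := by
      intro g hg
      exact natDegree_le_of_degree_le hg.le
    have hfd : ∀ k, (f ^ k).natDegree ≤ k * d := fun k =>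
      natDegree_pow_le.trans (Nat.mul_le_mul_left _ hd)
    have hwd : ∀ j < J, (w ^ j).natDegree ≤ p * (J - 1) := by
      intro j hj
      rw [hw, ← pow_mul, natDegree_pow, natDegree_X_sub_C, mul_one]
      exact Nat.mul_le_mul_left _ (by omega)
    apply natDegree_sum_le_of_forall_le
    intro j hj
    have hj' := Finset.mem_range.1 hj
    refine (natDegree_add_le _ _).trans (max_le ?_ ?_)
    · refine natDegree_mul_le.trans ?_
      have := natDegree_mul_le (p := f ^ l) (q := r j)
      have := hfd l; have := hwd j hj'; have := hnat _ (hr j)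
      nlinarith
    · refine natDegree_mul_le.trans ?_
      have := natDegree_mul_le (p := f ^ (l + h)) (q := s j)
      have := hfd (l + h); have := hwd j hj'; have := hnat _ (hs j)
      omega

end SqSieve
end

section
open Polynomial
namespace SqSieve

lemma stepanov_half (p : ℕ) [Fact p.Prime] (f q : (ZMod p)[X]) (a : ZMod p) (d : ℕ)
    (hp2 : p ≠ 2) (hbig : 1024 ≤ p) (hbig2 : 2 * d + 4 ≤ p) (hd : f.natDegree ≤ d)
    (hq : Irreducible q) (h1 : q ∣ f) (h2 : ¬ q ^ 2 ∣ f) (ha : a ≠ 0) :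
    ((Finset.univ.filter fun x : ZMod p => f.eval x ^ (p / 2) = a).card : ℝ) ≤ p / 2 + (10 * d + 9) * √p := by
  classical
  have hf0 : f ≠ 0 := by rintro rfl; simp at h2
  obtain ⟨c, hc⟩ : ∃ c, f.eval c ≠ 0 := by
    by_contra hcon
    push Not at hcon
    have := card_roots' f
    have h3 : (Finset.univ : Finset (ZMod p)).card ≤ f.roots.card := by
      rw [← Finset.card_val]
      apply Multiset.card_le_card
      rw [Multiset.le_iff_subset Finset.univ.nodup]
      intro x _
      rw [mem_roots hf0]; exact hcon x
    rw [Finset.card_univ, ZMod.card] at h3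
    omega
  have hodd : p % 2 = 1 := (Nat.Prime.eq_two_or_odd (Fact.out)).resolve_left hp2
  set l := Nat.sqrt p with hl
  have hl1 : l * l ≤ p := Nat.sqrt_le p
  have hl2 : p < (l + 1) * (l + 1) := Nat.lt_succ_sqrt p
  have hl32 : 32 ≤ l := by rw [hl, Nat.le_sqrt]; omega
  set m := (p - d) / 2 with hm
  set J := l / 2 + (4 * d + 5) with hJ
  have hm2 : 4 * m ≥ p := by omega
  have hlJ : 2 * J ≥ l + (8 * d + 9) := by omega
  have hlt : l * (m + l * d + J) < 2 * (m * J) := by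
    have e1 : 2 * (m * J) ≥ m * (l + (8 * d + 9)) := by nlinarith
    have e2 : 32 * l ≤ p := by nlinarith
    have e3 : 2 * J ≤ l + (8 * d + 10) := by omega
    have e4 : 4 * (m * (8 * d + 9)) ≥ p * (8 * d + 9) := by nlinarith
    have e5 : 2 * (l * J) ≤ l * l + l * (8 * d + 10) := by nlinarith
    have e6 : l * l * d ≤ p * d := Nat.mul_le_mul_right _ hl1
    have e7 : 32 * (l * (8 * d + 10)) ≤ p * (8 * d + 10) := by nlinarith
    nlinarith
  have key := stepanov_count p f q c a (p / 2) l m J d (by omega) hd (by omega) hc hq h1 h2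
    (by nlinarith) (by omega) hlt ha
  set N := (Finset.univ.filter fun x : ZMod p => f.eval x ^ (p / 2) = a).card
  have key' : (N : ℝ) * l ≤ (l + p / 2) * d + p / 2 + p * (l / 2 + (4 * d + 4)) := by
    have e1 : (J - 1 : ℕ) = l / 2 + (4 * d + 4) := by omega
    have e2 : ((l / 2 : ℕ) : ℝ) ≤ (l : ℝ) / 2 := Nat.cast_div_le
    have e3 : ((p / 2 : ℕ) : ℝ) ≤ (p : ℝ) / 2 := Nat.cast_div_le
    have e4 : (m : ℝ) ≤ (p : ℝ) / 2 := by
      have : 2 * m ≤ p := by omega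
      have : (2 : ℝ) * m ≤ p := by exact_mod_cast this
      linarith
    have e5 : (N : ℝ) * l ≤ (l + (p / 2 : ℕ)) * d + m + p * ((l / 2 : ℕ) + (4 * d + 4)) := by
      rw [e1] at key
      exact_mod_cast key
    have : (0 : ℝ) ≤ d := by positivity
    have : (0 : ℝ) ≤ p := by positivity
    nlinarith [mul_le_mul_of_nonneg_right e3 (by positivity : (0:ℝ) ≤ d), mul_le_mul_of_nonneg_left e2 (by positivity : (0:ℝ) ≤ p)]
  have hs : √(p : ℝ) ≤ 2 * l := by
    rw [Real.sqrt_le_left (by positivity)]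
    have : p ≤ (2 * l) ^ 2 := by nlinarith
    exact_mod_cast this
  have hss : √(p : ℝ) * √(p : ℝ) = p := Real.mul_self_sqrt (by positivity)
  have hs0 : 0 ≤ √(p : ℝ) := Real.sqrt_nonneg _
  have hlp : (0 : ℝ) < l := by exact_mod_cast (by omega : 0 < l)
  have hs1 : 1 ≤ √(p : ℝ) := by
    rw [Real.one_le_sqrt]; exact_mod_cast (by omega : 1 ≤ p)
  have hpl : (p : ℝ) ≤ 2 * l * √p := by nlinarith
  have hd0 : (0 : ℝ) ≤ d := by positivity
  have : (N : ℝ) * l ≤ (p / 2 + (10 * d + 9) * √p) * l := by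
    have e1 : (p : ℝ) * (9 * d + 9) ≤ (2 * l * √p) * (9 * d + 9) := by gcongr
    have e2 : (l : ℝ) * d ≤ l * d * √p := by nlinarith [mul_nonneg hlp.le hd0]
    nlinarith
  exact le_of_mul_le_mul_right this hlp

/-- Weil bound (Stepanov). -/
theorem weil (d : ℕ) (p : ℕ) [Fact p.Prime] (hp2 : p ≠ 2) (f q : (ZMod p)[X]) (hd : f.natDegree ≤ d)
    (hq : Irreducible q) (h1 : q ∣ f) (h2 : ¬ q ^ 2 ∣ f) :
    |((∑ x : ZMod p, quadraticChar (ZMod p) (f.eval x) : ℤ) : ℝ)| ≤ (23 * d + 1046) * √p := by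
  classical
  have hss : √(p : ℝ) * √(p : ℝ) = p := Real.mul_self_sqrt (by positivity)
  have hp1 : 1 ≤ p := (Fact.out : p.Prime).one_lt.le
  have hs1 : 1 ≤ √(p : ℝ) := by
    rw [Real.one_le_sqrt]; exact_mod_cast hp1
  have hd0 : (0 : ℝ) ≤ d := by positivity
  by_cases hbig : 1024 + 2 * d + 4 ≤ p
  · have hf0 : f ≠ 0 := by rintro rfl; simp at h2
    have hchar : ringChar (ZMod p) ≠ 2 := by rwa [ZMod.ringChar_zmod_n]
    have b1 := stepanov_half p f q 1 d hp2 (by omega) (by omega) hd hq h1 h2 one_ne_zero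
    have b2 := stepanov_half p f q (-1) d hp2 (by omega) (by omega) hd hq h1 h2 (by simp)
    set A := Finset.univ.filter fun x : ZMod p => f.eval x ^ (p / 2) = 1 with hA
    set B := Finset.univ.filter fun x : ZMod p => f.eval x ^ (p / 2) = -1 with hB
    set Z := Finset.univ.filter fun x : ZMod p => f.eval x = 0 with hZ
    have hZc : Z.card ≤ d := by
      refine le_trans ?_ ((card_roots' f).trans hd)
      rw [← Finset.card_val]
      apply Multiset.card_le_card
      rw [Multiset.le_iff_subset Z.nodup]
      intro x hx
      rw [mem_roots hf0]
      simpa [hZ] using hx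
    have hne : (1 : ZMod p) ≠ -1 := by
      intro h
      exact Ring.neg_one_ne_one_of_char_ne_two hchar h.symm
    have hval : ∀ x : ZMod p, quadraticChar (ZMod p) (f.eval x) =
        (if f.eval x ^ (p / 2) = 1 then 1 else 0) - (if f.eval x ^ (p / 2) = -1 then 1 else 0) := by
      intro x
      by_cases h0 : f.eval x = 0
      · have hp3 : p / 2 ≠ 0 := by omega
        simp [h0, zero_pow hp3]
      · have hdich := ZMod.pow_div_two_eq_neg_one_or_one p h0
        have hc := quadraticChar_eq_pow_of_char_ne_two hchar h0
        rw [ZMod.card] at hc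
        rw [hc]
        rcases hdich with h | h
        · simp [h, hne]
        · simp [h, hne.symm]
    have hcov : p ≤ A.card + B.card + Z.card := by
      calc p = (Finset.univ : Finset (ZMod p)).card := by rw [Finset.card_univ, ZMod.card]
        _ ≤ ((A ∪ B) ∪ Z).card := by
          apply Finset.card_le_card
          intro x _
          simp only [hA, hB, hZ, Finset.mem_union, Finset.mem_filter, Finset.mem_univ, true_and]
          by_cases h0 : f.eval x = 0
          · exact Or.inr h0
          · exact Or.inl (ZMod.pow_div_two_eq_neg_one_or_one p h0)
        _ ≤ _ := (Finset.card_union_le _ _).trans (by gcongr; exact Finset.card_union_le _ _)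
    have hsum : (∑ x : ZMod p, quadraticChar (ZMod p) (f.eval x) : ℤ) = (A.card : ℤ) - B.card := by
      simp_rw [hval]
      rw [Finset.sum_sub_distrib]
      simp [hA, hB]
    rw [hsum]
    have hcov' : (p : ℝ) ≤ A.card + B.card + d := by exact_mod_cast hcov.trans (by omega)
    push_cast
    have e : (d : ℝ) ≤ d * √p := by nlinarith
    have hs0 : 0 ≤ √(p : ℝ) := Real.sqrt_nonneg _
    rw [abs_le]
    constructor <;> nlinarith
  · have hb : (p : ℝ) ≤ 1028 + 2 * d := by
      push Not at hbig
      have := hbig.le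
      have : p ≤ 1028 + 2 * d := by omega
      exact_mod_cast this
    have : |((∑ x : ZMod p, quadraticChar (ZMod p) (f.eval x) : ℤ) : ℝ)| ≤ p := by
      push_cast
      refine (Finset.abs_sum_le_sum_abs _ _).trans ?_
      calc ∑ x : ZMod p, |((quadraticChar (ZMod p) (f.eval x) : ℤ) : ℝ)| ≤ ∑ x : ZMod p, (1 : ℝ) := by
            apply Finset.sum_le_sum
            intro x _
            by_cases h0 : f.eval x = 0
            · simp [h0]
            · rcases quadraticChar_dichotomy h0 with h | h <;> simp [h]
        _ = p := by simp
    refine this.trans (hb.trans ?_)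
    nlinarith

end SqSieve
end

section
open Polynomial
namespace SqSieve

lemma psi_norm {p : ℕ} [NeZero p] (a : ZMod p) : ‖(ZMod.stdAddChar a : ℂ)‖ = 1 := by
  exact AddChar.norm_apply _ _

/-- Orthogonality. -/
lemma psi_sum {p : ℕ} [NeZero p] (a : ZMod p) :
    ∑ y : ZMod p, (ZMod.stdAddChar (y * a) : ℂ) = if a = 0 then (p : ℂ) else 0 := by
  have := AddChar.sum_mulShift (R := ZMod p) (R' := ℂ) a (ZMod.isPrimitive_stdAddChar p)
  rw [ZMod.card] at this
  exact_mod_cast this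

lemma psi_parseval {p : ℕ} [NeZero p] (g : ZMod p → ℂ) :
    ∑ y : ZMod p, ‖∑ t : ZMod p, g t * ZMod.stdAddChar (y * t)‖ ^ 2 = p * ∑ t : ZMod p, ‖g t‖ ^ 2 := by
  have h : ((∑ y : ZMod p, ‖∑ t : ZMod p, g t * ZMod.stdAddChar (y * t)‖ ^ 2 : ℝ) : ℂ) =
      ((p * ∑ t : ZMod p, ‖g t‖ ^ 2 : ℝ) : ℂ) := by
    push_cast
    have e : ∀ y : ZMod p, ((‖∑ t : ZMod p, g t * ZMod.stdAddChar (y * t)‖ : ℂ)) ^ 2 =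
        ∑ t : ZMod p, ∑ s : ZMod p, (g t * (starRingEnd ℂ) (g s)) * ZMod.stdAddChar (y * (t - s)) := by
      intro y
      rw [← Complex.mul_conj', map_sum, Finset.sum_mul_sum]
      refine Finset.sum_congr rfl fun t _ => Finset.sum_congr rfl fun s _ => ?_
      rw [map_mul (starRingEnd ℂ), ← AddChar.map_neg_eq_conj]
      have : (ZMod.stdAddChar (y * (t - s)) : ℂ) = ZMod.stdAddChar (y * t) * ZMod.stdAddChar (-(y * s)) := by
        rw [← AddChar.map_add_eq_mul]; congr 1; ring
      rw [this]; ring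
    simp_rw [e]
    rw [Finset.sum_comm, Finset.mul_sum]
    refine Finset.sum_congr rfl fun t _ => ?_
    rw [Finset.sum_comm]
    simp_rw [← Finset.mul_sum, psi_sum]
    rw [Finset.sum_eq_single t]
    · simp only [sub_self, if_true]; rw [Complex.mul_conj']; ring
    · intro s _ hs
      rw [if_neg (sub_ne_zero.2 hs.symm), mul_zero]
    · simp
  exact_mod_cast h

lemma gauss_bound {p : ℕ} [Fact p.Prime] (hp2 : p ≠ 2) :
    ∃ τ : ℂ, ‖τ‖ ^ 2 = p ∧ ∀ a : ZMod p, ∑ y : ZMod p, ((quadraticChar (ZMod p) y : ℤ) : ℂ) * ZMod.stdAddChar (y * a)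
      = ((quadraticChar (ZMod p) a : ℤ) : ℂ) * τ := by
  have hchar : ringChar (ZMod p) ≠ 2 := by rwa [ZMod.ringChar_zmod_n]
  let χ : MulChar (ZMod p) ℂ := (quadraticChar (ZMod p)).ringHomComp (Int.castRingHom ℂ)
  have hχq : χ.IsQuadratic := (quadraticChar_isQuadratic (ZMod p)).comp _
  have hχ1 : χ ≠ 1 := by
    intro h
    obtain ⟨a, ha⟩ := quadraticChar_exists_neg_one hchar
    have ha0 : a ≠ 0 := by rintro rfl; simp at ha
    have : χ a = 1 := by
      rw [h, MulChar.one_apply (IsUnit.mk0 _ ha0)]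
    simp only [χ, MulChar.ringHomComp_apply, ha] at this
    norm_num at this
  refine ⟨gaussSum χ ZMod.stdAddChar, ?_, ?_⟩
  · have h := gaussSum_sq hχ1 hχq (ZMod.isPrimitive_stdAddChar p)
    have h2 := congrArg norm h
    rw [norm_pow, norm_mul] at h2
    rw [h2, ZMod.card]
    have : ‖χ (-1)‖ = 1 := by
      have h3 : χ (-1) = ((quadraticChar (ZMod p) (-1) : ℤ) : ℂ) := rfl
      rw [h3]
      rcases quadraticChar_dichotomy (F := ZMod p) (a := -1) (by simp) with h | h <;> simp [h]
    rw [this]; simp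
  · intro a
    by_cases ha : a = 0
    · subst ha
      have := quadraticChar_sum_zero hchar
      simp only [mul_zero, AddChar.map_zero_eq_one, mul_one, quadraticChar_zero, Int.cast_zero, zero_mul]
      exact_mod_cast this
    · have h := gaussSum_mulShift χ ZMod.stdAddChar (Units.mk0 a ha)
      have hsq : χ a * χ a = 1 := by
        have h3 : χ a = ((quadraticChar (ZMod p) a : ℤ) : ℂ) := rfl
        rw [h3]
        rcases quadraticChar_dichotomy ha with h | h <;> simp [h]
      have h4 : gaussSum χ (AddChar.mulShift ZMod.stdAddChar a) = ∑ y : ZMod p, ((quadraticChar (ZMod p) y : ℤ) : ℂ) * ZMod.stdAddChar (y * a) := by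
        rw [gaussSum]
        refine Finset.sum_congr rfl fun y _ => ?_
        rw [AddChar.mulShift_apply, mul_comm a y]; rfl
      rw [← h4]
      have h5 : χ a * gaussSum χ (AddChar.mulShift ZMod.stdAddChar a) = gaussSum χ ZMod.stdAddChar := h
      calc _ = (χ a * χ a) * gaussSum χ (AddChar.mulShift ZMod.stdAddChar a) := by rw [hsq, one_mul]
        _ = χ a * gaussSum χ ZMod.stdAddChar := by rw [mul_assoc, h5]
        _ = _ := rfl

lemma exists_simple_factor {F : Type*} [Field F] (f g : F[X]) (hf : Squarefree f) (hdeg : 2 ≤ f.natDegree)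
    (hg : g.natDegree ≤ 1) (hg0 : g ≠ 0) : ∃ q, Irreducible q ∧ q ∣ f * g ∧ ¬ q ^ 2 ∣ f * g := by
  by_cases h : ∃ q, Irreducible q ∧ q ∣ f ∧ ¬ q ∣ g
  · obtain ⟨q, hq, h1, h2⟩ := h
    refine ⟨q, hq, h1.mul_right g, fun h3 => ?_⟩
    have : q ^ 2 ∣ f := by
      apply IsCoprime.dvd_of_dvd_mul_right _ h3
      apply IsCoprime.pow_left
      exact (hq.coprime_iff_not_dvd).2 h2
    have := hf q (by rwa [← pow_two])
    exact hq.not_isUnit this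
  · exfalso
    push Not at h
    have hf0 : f ≠ 0 := hf.ne_zero
    have nu : ∀ k : F[X], 1 ≤ k.natDegree → ¬ IsUnit k := by
      intro k hk hu
      have := natDegree_eq_zero_of_isUnit hu
      omega
    obtain ⟨q, hq, k, hk⟩ := WfDvdMonoid.exists_irreducible_factor (nu f (by omega)) hf0
    have hqg := h q hq ⟨k, hk⟩
    have hq1 := natDegree_le_of_dvd hqg hg0
    have hk0 : k ≠ 0 := by rintro rfl; simp [hk] at hf0
    have hkd : 1 ≤ k.natDegree := by
      rw [hk, natDegree_mul hq.ne_zero hk0] at hdeg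
      omega
    obtain ⟨q', hq', k', hk'⟩ := WfDvdMonoid.exists_irreducible_factor (nu k hkd) hk0
    have hqg' := h q' hq' ⟨q * k', by rw [hk, hk']; ring⟩
    obtain ⟨u, hu⟩ := hqg
    have hqpos := hq.natDegree_pos
    have hu0 : u ≠ 0 := by rintro rfl; simp [hu] at hg0
    have huu : IsUnit u := by
      rw [hu, natDegree_mul hq.ne_zero hu0] at hg
      rw [isUnit_iff_degree_eq_zero, degree_eq_natDegree hu0]
      have : u.natDegree = 0 := by omega
      simp [this]
    have hass : q' ∣ q := by
      rw [hu] at hqg'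
      exact (huu.dvd_mul_right).1 hqg'
    have : Associated q' q := hq'.associated_of_dvd hq hass
    have hqk : q * q ∣ f := by
      rw [hk]
      exact mul_dvd_mul_left q ((this.symm.dvd).trans ⟨k', hk'⟩)
    exact hq.not_isUnit (hf q hqk)

end SqSieve
end

section
open Polynomial
namespace SqSieve

noncomputable section

variable {p : ℕ} [Fact p.Prime]

def flq (Φ : ZMod p → ZMod p → ZMod p) (x y : ZMod p) : ℝ :=
  ((quadraticChar (ZMod p) (Φ x y) : ℤ) : ℝ) + if Φ x y = 0 then 1 else 0

def Mq (Φ : ZMod p → ZMod p → ZMod p) (y : ZMod p) : ℝ := (∑ x : ZMod p, flq Φ x y) / p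

def kap (D p : ℕ) : ℝ := (24 * D + 1069) / √(p : ℝ)

def bloc (D : ℕ) (Φ : ZMod p → ZMod p → ZMod p) (x y : ZMod p) : ℝ :=
  if y = 0 then 1 else (flq Φ x y - Mq Φ y) / (1 + kap D p)

def zq (f0 : (ZMod p)[X]) (t : ZMod p) : ℝ := if f0.eval t = 0 then 1 else 0

def cq (f0 : (ZMod p)[X]) (t : ZMod p) : ℝ := ((quadraticChar (ZMod p) (f0.eval t) : ℤ) : ℝ)

lemma qc_abs (a : ZMod p) : |((quadraticChar (ZMod p) a : ℤ) : ℝ)| ≤ 1 := by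
  by_cases h0 : a = 0
  · simp [h0]
  · rcases quadraticChar_dichotomy h0 with h | h <;> simp [h]

lemma qc_odd (D : ℕ) (hD : Odd D) (y : ZMod p) : quadraticChar (ZMod p) (y ^ D) = quadraticChar (ZMod p) y := by
  by_cases h0 : y = 0
  · subst h0; obtain ⟨k, rfl⟩ := hD; simp
  · obtain ⟨k, rfl⟩ := hD
    rw [map_pow, pow_succ, pow_mul, quadraticChar_sq_one h0]; simp

lemma flq_eq (D : ℕ) (hD : Odd D) (f0 : (ZMod p)[X]) (Φ : ZMod p → ZMod p → ZMod p)
    (hΦ : ∀ t y, Φ (t * y) y = y ^ D * f0.eval t) (t y : ZMod p) (hy : y ≠ 0) :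
    flq Φ (t * y) y = ((quadraticChar (ZMod p) y : ℤ) : ℝ) * cq f0 t + zq f0 t := by
  rw [flq, hΦ, map_mul, qc_odd D hD, cq, zq]
  simp [hy]

lemma sum_scale {M : Type*} [AddCommMonoid M] (G : ZMod p → M) (y : ZMod p) (hy : y ≠ 0) :
    ∑ x : ZMod p, G x = ∑ t : ZMod p, G (t * y) :=
  (Equiv.sum_comp (Equiv.mulRight₀ y hy) G).symm

lemma zq_sum (D : ℕ) (f0 : (ZMod p)[X]) (hd : f0.natDegree ≤ D) (h0 : f0 ≠ 0) :
    ∑ t, zq f0 t ≤ D := by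
  classical
  have : ∑ t, zq f0 t = ((Finset.univ.filter fun t : ZMod p => f0.eval t = 0).card : ℝ) := by
    simp [zq]
  rw [this]
  have : (Finset.univ.filter fun t : ZMod p => f0.eval t = 0).card ≤ D := by
    refine le_trans ?_ ((card_roots' f0).trans hd)
    rw [← Finset.card_val]
    apply Multiset.card_le_card
    rw [Multiset.le_iff_subset (Finset.nodup _)]
    intro x hx
    rw [mem_roots h0]
    simpa using hx
  exact_mod_cast this

lemma zq_nonneg (f0 : (ZMod p)[X]) (t : ZMod p) : 0 ≤ zq f0 t := by
  rw [zq]; split_ifs <;> norm_num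

lemma zq_fourier (D : ℕ) (f0 : (ZMod p)[X]) (hd : f0.natDegree ≤ D) (h0 : f0 ≠ 0) (g : ZMod p → ZMod p) :
    ‖∑ t, (zq f0 t : ℂ) * ZMod.stdAddChar (g t)‖ ≤ D := by
  refine (norm_sum_le _ _).trans (le_trans (le_of_eq ?_) (zq_sum D f0 hd h0))
  refine Finset.sum_congr rfl fun t _ => ?_
  rw [norm_mul, psi_norm, mul_one, Complex.norm_real, Real.norm_of_nonneg (zq_nonneg _ _)]

lemma kap_pos (D : ℕ) : 0 < kap D p := by
  have : 0 < (p : ℝ) := by exact_mod_cast (Fact.out : p.Prime).pos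
  unfold kap; positivity

lemma Mq_bound (D : ℕ) (hD : Odd D) (hp2 : p ≠ 2) (f0 : (ZMod p)[X]) (hd : f0.natDegree ≤ D)
    (hsq : Squarefree f0) (hdeg : 2 ≤ f0.natDegree) (Φ : ZMod p → ZMod p → ZMod p)
    (hΦ : ∀ t y, Φ (t * y) y = y ^ D * f0.eval t) (y : ZMod p) (hy : y ≠ 0) :
    |Mq Φ y| ≤ kap D p := by
  obtain ⟨q, hq, h1, h2⟩ := exists_simple_factor f0 1 hsq hdeg (by simp) one_ne_zero
  rw [mul_one] at h1 h2
  have hw := weil D p hp2 f0 q hd hq h1 h2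
  have hp : 0 < (p : ℝ) := by exact_mod_cast (Fact.out : p.Prime).pos
  have hs : ∑ x : ZMod p, flq Φ x y = ((quadraticChar (ZMod p) y : ℤ) : ℝ) * ∑ t, cq f0 t + ∑ t, zq f0 t := by
    rw [sum_scale _ y hy, Finset.mul_sum, ← Finset.sum_add_distrib]
    exact Finset.sum_congr rfl fun t _ => flq_eq D hD f0 Φ hΦ t y hy
  rw [Mq, hs, kap, abs_div, abs_of_pos hp]
  have hw' : |∑ t, cq f0 t| ≤ (23 * D + 1046) * √p := by
    have : ∑ t, cq f0 t = ((∑ x : ZMod p, quadraticChar (ZMod p) (f0.eval x) : ℤ) : ℝ) := by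
      simp [cq]
    rw [this]; exact hw
  have hz := zq_sum D f0 hd hsq.ne_zero
  have hz0 : 0 ≤ ∑ t, zq f0 t := Finset.sum_nonneg fun t _ => zq_nonneg _ _
  have hss : √(p : ℝ) * √(p : ℝ) = p := Real.mul_self_sqrt (by positivity)
  have hs1 : 1 ≤ √(p : ℝ) := by
    rw [Real.one_le_sqrt]; exact_mod_cast (Fact.out : p.Prime).one_lt.le
  have hD0 : (0 : ℝ) ≤ D := by positivity
  rw [div_le_div_iff₀ hp (by positivity)]
  have : |((quadraticChar (ZMod p) y : ℤ) : ℝ) * ∑ t, cq f0 t + ∑ t, zq f0 t| ≤ (24 * D + 1046) * √p := by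
    refine (abs_add_le _ _).trans ?_
    rw [abs_mul, abs_of_nonneg hz0]
    nlinarith [qc_abs y, abs_nonneg (∑ t, cq f0 t)]
  calc _ ≤ ((24 * D + 1046) * √p) * √p := by gcongr
    _ = (24 * D + 1046) * p := by rw [mul_assoc, hss]
    _ ≤ _ := by gcongr; norm_num

lemma flq_abs (Φ : ZMod p → ZMod p → ZMod p) (x y : ZMod p) : |flq Φ x y| ≤ 1 := by
  rw [flq]
  by_cases h : Φ x y = 0
  · simp [h]
  · simpa [h] using qc_abs (Φ x y)

lemma bloc_abs (D : ℕ) (hD : Odd D) (hp2 : p ≠ 2) (f0 : (ZMod p)[X]) (hd : f0.natDegree ≤ D)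
    (hsq : Squarefree f0) (hdeg : 2 ≤ f0.natDegree) (Φ : ZMod p → ZMod p → ZMod p)
    (hΦ : ∀ t y, Φ (t * y) y = y ^ D * f0.eval t) (x y : ZMod p) : |bloc D Φ x y| ≤ 1 := by
  rw [bloc]
  split_ifs with hy
  · simp
  · have h1 := Mq_bound D hD hp2 f0 hd hsq hdeg Φ hΦ y hy
    have h2 := flq_abs Φ x y
    have := kap_pos (p := p) D
    rw [abs_div, abs_of_pos (by linarith : 0 < 1 + kap D p), div_le_one (by linarith)]
    exact (abs_sub _ _).trans (by linarith)

lemma bloc_sq (D : ℕ) (hD : Odd D) (hp2 : p ≠ 2) (f0 : (ZMod p)[X]) (hd : f0.natDegree ≤ D)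
    (hsq : Squarefree f0) (hdeg : 2 ≤ f0.natDegree) (Φ : ZMod p → ZMod p → ZMod p)
    (hΦ : ∀ t y, Φ (t * y) y = y ^ D * f0.eval t) (x y : ZMod p) (h : IsSquare (Φ x y)) :
    1 - 2 * kap D p ≤ bloc D Φ x y := by
  have hk := kap_pos (p := p) D
  rw [bloc]
  split_ifs with hy
  · linarith
  · have h1 := Mq_bound D hD hp2 f0 hd hsq hdeg Φ hΦ y hy
    have h2 : flq Φ x y = 1 := by
      rw [flq]
      by_cases h0 : Φ x y = 0
      · simp [h0]
      · have := (quadraticChar_one_iff_isSquare h0).2 h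
        simp [h0, this]
    rw [h2, le_div_iff₀ (by linarith)]
    have := (abs_le.1 h1).2
    nlinarith

lemma bloc_mean (D : ℕ) (Φ : ZMod p → ZMod p → ZMod p) (y : ZMod p) (hy : y ≠ 0) :
    ∑ x, bloc D Φ x y = 0 := by
  have hp : (p : ℝ) ≠ 0 := by exact_mod_cast (Fact.out : p.Prime).pos.ne'
  simp only [bloc, if_neg hy]
  rw [← Finset.sum_div, Finset.sum_sub_distrib, Finset.sum_const, Finset.card_univ, ZMod.card, Mq]
  rw [nsmul_eq_mul, mul_div_cancel₀ _ hp]; simp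

/-- Fourier coefficient in `x` for nonzero frequency. -/
lemma bloc_fourier (D : ℕ) (hD : Odd D) (f0 : (ZMod p)[X]) (Φ : ZMod p → ZMod p → ZMod p)
    (hΦ : ∀ t y, Φ (t * y) y = y ^ D * f0.eval t) (h y : ZMod p) (hh : h ≠ 0) :
    ∑ x, (bloc D Φ x y : ℂ) * ZMod.stdAddChar (x * h) =
      if y = 0 then 0 else (1 + kap D p : ℂ)⁻¹ * (((quadraticChar (ZMod p) y : ℤ) : ℂ) * ∑ t, (cq f0 t : ℂ) * ZMod.stdAddChar (y * h * t)
        + ∑ t, (zq f0 t : ℂ) * ZMod.stdAddChar (y * h * t)) := by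
  split_ifs with hy
  · simp only [bloc, if_pos hy]
    have := psi_sum (p := p) h
    rw [if_neg hh] at this
    simpa using this
  · simp only [bloc, if_neg hy]
    have e : ∑ x : ZMod p, (((flq Φ x y - Mq Φ y) / (1 + kap D p) : ℝ) : ℂ) * ZMod.stdAddChar (x * h) =
        (1 + kap D p : ℂ)⁻¹ * (∑ x : ZMod p, (flq Φ x y : ℂ) * ZMod.stdAddChar (x * h) - Mq Φ y * ∑ x : ZMod p, ZMod.stdAddChar (x * h)) := by
      rw [Finset.mul_sum, ← Finset.sum_sub_distrib, Finset.mul_sum]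
      refine Finset.sum_congr rfl fun x _ => ?_
      push_cast
      rw [div_eq_mul_inv]; ring
    rw [e, psi_sum, if_neg hh, mul_zero, sub_zero]
    congr 1
    rw [sum_scale _ y hy, Finset.mul_sum, ← Finset.sum_add_distrib]
    refine Finset.sum_congr rfl fun t _ => ?_
    rw [flq_eq D hD f0 Φ hΦ t y hy]
    push_cast
    have : t * y * h = y * h * t := by ring
    rw [this]; ring

lemma inv_kap_norm (D : ℕ) : ‖(1 + kap D p : ℂ)⁻¹‖ = (1 + kap D p)⁻¹ := by
  have hk := kap_pos (p := p) D
  rw [norm_inv]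
  congr 1
  have : (1 + kap D p : ℂ) = ((1 + kap D p : ℝ) : ℂ) := by push_cast; rfl
  rw [this, Complex.norm_real, Real.norm_of_nonneg (by linarith)]

lemma bloc_LN (D : ℕ) (hD : Odd D) (f0 : (ZMod p)[X]) (hd : f0.natDegree ≤ D)
    (hsq : Squarefree f0) (Φ : ZMod p → ZMod p → ZMod p)
    (hΦ : ∀ t y, Φ (t * y) y = y ^ D * f0.eval t) (h : ZMod p) :
    ∑ y, ‖∑ x, (bloc D Φ x y : ℂ) * ZMod.stdAddChar (x * h)‖ ^ 2 ≤ (p : ℝ) ^ 2 := by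
  have hp : 0 < (p : ℝ) := by exact_mod_cast (Fact.out : p.Prime).pos
  have hk := kap_pos (p := p) D
  by_cases hh : h = 0
  · subst hh
    rw [Finset.sum_eq_single 0]
    · simp [bloc]
    · intro y _ hy
      have := bloc_mean D Φ y hy
      have h2 : ∑ x, (bloc D Φ x y : ℂ) = 0 := by exact_mod_cast congrArg (fun r : ℝ => (r : ℂ)) this
      simp [h2]
    · simp
  · set ε : ℝ := D / √p with hε
    have hsp : 0 < √(p : ℝ) := Real.sqrt_pos.2 hp
    have hDpos : 0 < (D : ℝ) := by
      obtain ⟨k, rfl⟩ := hD; positivity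
    have hεpos : 0 < ε := by positivity
    have hεk : ε ≤ kap D p := by
      rw [hε, kap]; gcongr; linarith
    have step : ∀ y : ZMod p, ‖∑ x, (bloc D Φ x y : ℂ) * ZMod.stdAddChar (x * h)‖ ^ 2 ≤
        ((1 + kap D p)⁻¹) ^ 2 * ((1 + ε) * ‖∑ t, (cq f0 t : ℂ) * ZMod.stdAddChar (y * h * t)‖ ^ 2 + (1 + ε⁻¹) * (D : ℝ) ^ 2) := by
      intro y
      rw [bloc_fourier D hD f0 Φ hΦ h y hh]
      split_ifs with hy
      · simp only [norm_zero]
        rw [zero_pow two_ne_zero]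
        have h5 : 0 ≤ ε⁻¹ := by positivity
        positivity
      · rw [norm_mul, mul_pow, inv_kap_norm]
        gcongr
        set a := ((quadraticChar (ZMod p) y : ℤ) : ℂ) * ∑ t, (cq f0 t : ℂ) * ZMod.stdAddChar (y * h * t)
        set b := ∑ t, (zq f0 t : ℂ) * ZMod.stdAddChar (y * h * t) with hb
        have hb1 : ‖b‖ ≤ D := zq_fourier D f0 hd hsq.ne_zero _
        have ha1 : ‖a‖ ≤ ‖∑ t, (cq f0 t : ℂ) * ZMod.stdAddChar (y * h * t)‖ := by
          simp only [a]
          rw [norm_mul]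
          have : ‖((quadraticChar (ZMod p) y : ℤ) : ℂ)‖ ≤ 1 := by
            have := qc_abs y
            rw [Complex.norm_intCast]; exact this
          exact mul_le_of_le_one_left (norm_nonneg _) this
        have h3 : ‖a + b‖ ≤ ‖a‖ + ‖b‖ := norm_add_le _ _
        have h4 : (‖a‖ + ‖b‖) ^ 2 ≤ (1 + ε) * ‖a‖ ^ 2 + (1 + ε⁻¹) * ‖b‖ ^ 2 := by
          have : (1 + ε) * ‖a‖ ^ 2 + (1 + ε⁻¹) * ‖b‖ ^ 2 - (‖a‖ + ‖b‖) ^ 2 = ε⁻¹ * (ε * ‖a‖ - ‖b‖) ^ 2 := by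
            field_simp; ring
          have : 0 ≤ ε⁻¹ * (ε * ‖a‖ - ‖b‖) ^ 2 := by positivity
          linarith
        calc ‖a + b‖ ^ 2 ≤ (‖a‖ + ‖b‖) ^ 2 := by gcongr
          _ ≤ _ := h4
          _ ≤ _ := by gcongr
    refine (Finset.sum_le_sum fun y _ => step y).trans ?_
    rw [← Finset.mul_sum, Finset.sum_add_distrib, ← Finset.mul_sum, Finset.sum_const, Finset.card_univ, ZMod.card]
    have hpar : ∑ y : ZMod p, ‖∑ t, (cq f0 t : ℂ) * ZMod.stdAddChar (y * h * t)‖ ^ 2 ≤ (p : ℝ) ^ 2 := by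
      have e := sum_scale (fun y : ZMod p => ‖∑ t, (cq f0 t : ℂ) * ZMod.stdAddChar (y * t)‖ ^ 2) h hh
      rw [← e, psi_parseval]
      have : ∑ t, ‖(cq f0 t : ℂ)‖ ^ 2 ≤ (p : ℝ) := by
        calc ∑ t, ‖(cq f0 t : ℂ)‖ ^ 2 ≤ ∑ t : ZMod p, (1 : ℝ) := by
              refine Finset.sum_le_sum fun t _ => ?_
              rw [Complex.norm_real]
              exact pow_le_one₀ (norm_nonneg _) (qc_abs _)
          _ = p := by simp
      nlinarith
    have hDε : (D : ℝ) ^ 2 = ε ^ 2 * p := by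
      rw [hε, div_pow, Real.sq_sqrt hp.le, div_mul_cancel₀ _ hp.ne']
    have e2 : (p : ℕ) • ((1 + ε⁻¹) * (D : ℝ) ^ 2) = (ε ^ 2 + ε) * (p : ℝ) ^ 2 := by
      rw [hDε, nsmul_eq_mul]; field_simp
    rw [e2]
    calc ((1 + kap D p)⁻¹) ^ 2 * ((1 + ε) * ∑ y : ZMod p, ‖∑ t, (cq f0 t : ℂ) * ZMod.stdAddChar (y * h * t)‖ ^ 2 + (ε ^ 2 + ε) * (p : ℝ) ^ 2)
        ≤ ((1 + kap D p)⁻¹) ^ 2 * ((1 + ε) * (p : ℝ) ^ 2 + (ε ^ 2 + ε) * (p : ℝ) ^ 2) := by gcongr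
      _ = ((1 + ε) / (1 + kap D p)) ^ 2 * (p : ℝ) ^ 2 := by field_simp; ring
      _ ≤ 1 * (p : ℝ) ^ 2 := by
        gcongr
        apply pow_le_one₀ (by positivity)
        rw [div_le_one (by linarith)]; linarith
      _ = _ := one_mul _

lemma bloc_hat (D : ℕ) (hD : Odd D) (hp2 : p ≠ 2) (f0 : (ZMod p)[X]) (hd : f0.natDegree ≤ D)
    (hsq : Squarefree f0) (hdeg : 2 ≤ f0.natDegree) (Φ : ZMod p → ZMod p → ZMod p)
    (hΦ : ∀ t y, Φ (t * y) y = y ^ D * f0.eval t) (h k : ZMod p) :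
    ‖∑ y, (∑ x, (bloc D Φ x y : ℂ) * ZMod.stdAddChar (x * h)) * ZMod.stdAddChar (y * k)‖ ≤ (24 * D + 1069) * (p : ℝ) := by
  have hp : 0 < (p : ℝ) := by exact_mod_cast (Fact.out : p.Prime).pos
  have hk := kap_pos (p := p) D
  have hD0 : (0 : ℝ) ≤ D := by positivity
  by_cases hh : h = 0
  · subst hh
    rw [Finset.sum_eq_single 0]
    · simp [bloc]; nlinarith
    · intro y _ hy
      have := bloc_mean D Φ y hy
      have h2 : ∑ x, (bloc D Φ x y : ℂ) = 0 := by exact_mod_cast congrArg (fun r : ℝ => (r : ℂ)) this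
      simp [h2]
    · simp
  · obtain ⟨τ, hτ, hg⟩ := gauss_bound (p := p) hp2
    have key : ∑ y, (∑ x, (bloc D Φ x y : ℂ) * ZMod.stdAddChar (x * h)) * ZMod.stdAddChar (y * k) =
        (1 + kap D p : ℂ)⁻¹ * ((∑ t, (cq f0 t : ℂ) * (((quadraticChar (ZMod p) (h * t + k) : ℤ) : ℂ) * τ)) +
          ∑ y, if y = 0 then 0 else (∑ t, (zq f0 t : ℂ) * ZMod.stdAddChar (y * h * t)) * ZMod.stdAddChar (y * k)) := by
      simp_rw [bloc_fourier D hD f0 Φ hΦ h _ hh, ← hg, Finset.mul_sum]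
      rw [Finset.sum_comm, ← Finset.sum_add_distrib, Finset.mul_sum]
      refine Finset.sum_congr rfl fun y _ => ?_
      split_ifs with hy
      · simp [hy]
      · rw [mul_assoc, add_mul, Finset.sum_mul]
        congr 2
        refine Finset.sum_congr rfl fun t _ => ?_
        have : y * (h * t + k) = y * h * t + y * k := by ring
        rw [this, AddChar.map_add_eq_mul]; ring
    rw [key, norm_mul, inv_kap_norm]
    have hfill : ‖∑ y : ZMod p, if y = 0 then 0 else (∑ t, (zq f0 t : ℂ) * ZMod.stdAddChar (y * h * t)) * ZMod.stdAddChar (y * k)‖ ≤ D * p := by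
      refine (norm_sum_le _ _).trans ?_
      calc _ ≤ ∑ y : ZMod p, (D : ℝ) := by
            refine Finset.sum_le_sum fun y _ => ?_
            split_ifs
            · simp
            · rw [norm_mul, psi_norm, mul_one]; exact zq_fourier D f0 hd hsq.ne_zero _
        _ = D * p := by simp [mul_comm]
    have hmain : ‖∑ t, (cq f0 t : ℂ) * (((quadraticChar (ZMod p) (h * t + k) : ℤ) : ℂ) * τ)‖ ≤ (23 * D + 1069) * p := by
      set g : (ZMod p)[X] := C h * X + C k with hgdef
      have hg1 : g.natDegree = 1 := natDegree_linear hh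
      have hg0 : g ≠ 0 := by intro h0; rw [h0] at hg1; simp at hg1
      obtain ⟨q, hq, h1, h2⟩ := exists_simple_factor f0 g hsq hdeg hg1.le hg0
      have hw := weil (D + 1) p hp2 (f0 * g) q (by
        refine natDegree_mul_le.trans ?_; omega) hq h1 h2
      have e : ∑ t, (cq f0 t : ℂ) * (((quadraticChar (ZMod p) (h * t + k) : ℤ) : ℂ) * τ) =
          (((∑ x : ZMod p, quadraticChar (ZMod p) ((f0 * g).eval x) : ℤ) : ℝ) : ℂ) * τ := by
        push_cast
        rw [Finset.sum_mul]
        refine Finset.sum_congr rfl fun t _ => ?_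
        have e9 : eval t g = h * t + k := by simp [hgdef]
        rw [eval_mul, e9, map_mul, cq]
        push_cast
        ring
      rw [e, norm_mul, Complex.norm_real, Real.norm_eq_abs]
      have hτ' : ‖τ‖ = √p := by rw [← hτ, Real.sqrt_sq (norm_nonneg _)]
      rw [hτ']
      push_cast at hw
      have hss : √(p : ℝ) * √(p : ℝ) = p := Real.mul_self_sqrt (by positivity)
      push_cast
      calc _ ≤ ((23 * (D + 1) + 1046) * √p) * √(p : ℝ) := by gcongr
        _ = (23 * D + 1069) * p := by rw [mul_assoc, hss]; ring
    have h1 : (1 + kap D p)⁻¹ ≤ 1 := inv_le_one_of_one_le₀ (by linarith)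
    calc _ ≤ 1 * ((23 * (D : ℝ) + 1069) * p + D * p) := by
          refine mul_le_mul h1 ((norm_add_le _ _).trans (add_le_add hmain hfill)) (norm_nonneg _) zero_le_one
      _ = _ := by ring

end
end SqSieve
end

section
namespace SqSieve

noncomputable section

/-- average over a period -/
def avg (m : ℕ) (G : ℤ → ℂ) : ℂ := (∑ x ∈ Finset.range m, G x) / m

/-- `e(a/m)` -/
def ee (m : ℕ) (a : ℤ) : ℂ := Complex.exp (2 * Real.pi * Complex.I * a / m)

def Per (m : ℕ) (G : ℤ → ℂ) : Prop := ∀ x, G (x + m) = G x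

lemma Per.mul_int {m : ℕ} {G : ℤ → ℂ} (h : Per m G) (x k : ℤ) : G (x + m * k) = G x := by
  induction k using Int.induction_on with
  | zero => simp
  | succ k ih => rw [← ih, mul_add, mul_one, ← add_assoc]; exact h _
  | pred k ih => rw [← ih, ← h]; congr 1; ring

lemma Per.congr {m : ℕ} {G : ℤ → ℂ} (h : Per m G) {x y : ℤ} (hxy : (m : ℤ) ∣ x - y) : G x = G y := by
  obtain ⟨k, hk⟩ := hxy
  rw [show x = y + m * k by linarith, h.mul_int]

lemma Per.of_dvd {m n : ℕ} {G : ℤ → ℂ} (h : Per m G) (hd : m ∣ n) : Per n G := by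
  intro x
  apply h.congr
  simpa using Int.natCast_dvd_natCast.2 hd

lemma Per.mul {m : ℕ} {G H : ℤ → ℂ} (h : Per m G) (h2 : Per m H) : Per m (fun x => G x * H x) := by
  intro x; simp only [h x, h2 x]

lemma Per.mul' {m n : ℕ} {G H : ℤ → ℂ} (h : Per m G) (h2 : Per n H) : Per (m * n) (fun x => G x * H x) :=
  (h.of_dvd (dvd_mul_right _ _)).mul (h2.of_dvd (dvd_mul_left _ _))

lemma ee_add (m : ℕ) (a b : ℤ) : ee m (a + b) = ee m a * ee m b := by
  rw [ee, ee, ee, ← Complex.exp_add]; congr 1; push_cast; ring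

lemma ee_zero (m : ℕ) : ee m 0 = 1 := by simp [ee]

lemma ee_mul_self (m : ℕ) (a : ℤ) : ee m (m * a) = 1 := by
  rcases Nat.eq_zero_or_pos m with rfl | hm
  · simp [ee]
  · rw [ee, Complex.exp_eq_one_iff]
    refine ⟨a, ?_⟩
    have : (m : ℂ) ≠ 0 := by exact_mod_cast hm.ne'
    push_cast; field_simp

lemma ee_norm (m : ℕ) (a : ℤ) : ‖ee m a‖ = 1 := by
  have : (2 * Real.pi * Complex.I * a / m : ℂ) = ((2 * Real.pi * a / m : ℝ) : ℂ) * Complex.I := by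
    push_cast; ring
  rw [ee, this, Complex.norm_exp_ofReal_mul_I]

lemma ee_per (m : ℕ) (h : ℤ) : Per m (fun x => ee m (h * x)) := by
  intro x
  dsimp only
  rw [mul_add, ee_add, mul_comm h (m : ℤ), ee_mul_self, mul_one]

lemma ee_conj (m : ℕ) (a : ℤ) : (starRingEnd ℂ) (ee m a) = ee m (-a) := by
  have h1 : ee m a * ee m (-a) = 1 := by rw [← ee_add, add_neg_cancel, ee_zero]
  have h2 : ee m a * (starRingEnd ℂ) (ee m a) = 1 := by rw [Complex.mul_conj', ee_norm]; simp
  have h3 : ee m a ≠ 0 := by intro h; rw [h] at h1; simp at h1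
  exact mul_left_cancel₀ h3 (h2.trans h1.symm)

lemma ee_scale (m n : ℕ) (hn : n ≠ 0) (a : ℤ) : ee (m * n) (n * a) = ee m a := by
  rw [ee, ee]
  congr 1
  have : (n : ℂ) ≠ 0 := by exact_mod_cast hn
  push_cast
  rcases Nat.eq_zero_or_pos m with rfl | hm
  · simp
  · have : (m : ℂ) ≠ 0 := by exact_mod_cast hm.ne'
    field_simp

lemma ee_crt (m1 m2 : ℕ) (h1 : m1 ≠ 0) (h2 : m2 ≠ 0) (c1 c2 : ℤ) (hc : c1 * m2 + c2 * m1 = 1) (a : ℤ) :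
    ee (m1 * m2) a = ee m1 (c1 * a) * ee m2 (c2 * a) := by
  rw [← ee_scale m1 m2 h2 (c1 * a), ← ee_scale m2 m1 h1 (c2 * a), mul_comm m2 m1, ← ee_add]
  congr 1
  linear_combination (-a) * hc

lemma ee_eq_one_iff (m : ℕ) (hm : m ≠ 0) (a : ℤ) : ee m a = 1 ↔ (m : ℤ) ∣ a := by
  constructor
  · intro h
    rw [ee, Complex.exp_eq_one_iff] at h
    obtain ⟨k, hk⟩ := h
    have hm' : (m : ℂ) ≠ 0 := by exact_mod_cast hm
    have hpi : (Real.pi : ℂ) ≠ 0 := by exact_mod_cast Real.pi_ne_zero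
    refine ⟨k, ?_⟩
    have : (a : ℂ) = m * k := by
      field_simp at hk
      linear_combination hk
    exact_mod_cast this
  · rintro ⟨k, rfl⟩
    exact ee_mul_self m k

lemma ee_pow (m : ℕ) (a : ℤ) (j : ℕ) : ee m (a * j) = ee m a ^ j := by
  rw [ee, ee, ← Complex.exp_nat_mul]; congr 1; push_cast; ring

lemma avg_ee (m : ℕ) (hm : m ≠ 0) (h : ℤ) : avg m (fun x => ee m (h * x)) = if (m : ℤ) ∣ h then 1 else 0 := by
  have hm' : (m : ℂ) ≠ 0 := by exact_mod_cast hm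
  rw [avg]
  simp_rw [ee_pow]
  split_ifs with hd
  · rw [(ee_eq_one_iff m hm h).2 hd]; simp [hm']
  · have hne : ee m h ≠ 1 := fun h' => hd ((ee_eq_one_iff m hm h).1 h')
    rw [geom_sum_eq hne, ← ee_pow, mul_comm, ee_mul_self]; simp

/-- CRT for averages -/
lemma avg_crt (m1 m2 : ℕ) (h1 : m1 ≠ 0) (h2 : m2 ≠ 0) (hco : Nat.Coprime m1 m2) (G1 G2 : ℤ → ℂ)
    (hG1 : Per m1 G1) (hG2 : Per m2 G2) :
    avg (m1 * m2) (fun x => G1 x * G2 x) = avg m1 G1 * avg m2 G2 := by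
  rw [avg, avg, avg, div_mul_div_comm, Finset.sum_mul_sum, ← Finset.sum_product']
  push_cast
  congr 1
  refine Finset.sum_bij (fun x _ => (x % m1, x % m2)) ?_ ?_ ?_ ?_
  · intro x _
    simp [Nat.mod_lt _ (Nat.pos_of_ne_zero h1), Nat.mod_lt _ (Nat.pos_of_ne_zero h2)]
  · intro x hx y hy hxy
    simp only [Prod.mk.injEq] at hxy
    have : x ≡ y [MOD m1 * m2] := (Nat.modEq_and_modEq_iff_modEq_mul hco).1 hxy
    exact this.eq_of_lt_of_lt (Finset.mem_range.1 hx) (Finset.mem_range.1 hy)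
  · rintro ⟨a, b⟩ hab
    simp only [Finset.mem_product, Finset.mem_range] at hab
    obtain ⟨k, hk1, hk2⟩ := Nat.chineseRemainder hco a b
    refine ⟨k % (m1 * m2), Finset.mem_range.2 (Nat.mod_lt _ (by positivity)), ?_⟩
    simp only [Prod.mk.injEq]
    refine ⟨?_, ?_⟩
    · rw [Nat.mod_mul_right_mod, hk1, Nat.mod_eq_of_lt hab.1]
    · rw [Nat.mod_mul_left_mod, hk2, Nat.mod_eq_of_lt hab.2]
  · intro x _
    have e1 : G1 ((x % m1 : ℕ) : ℤ) = G1 x := by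
      apply hG1.congr
      rw [← Int.modEq_iff_dvd]; push_cast; exact (Int.mod_modEq _ _).symm
    have e2 : G2 ((x % m2 : ℕ) : ℤ) = G2 x := by
      apply hG2.congr
      rw [← Int.modEq_iff_dvd]; push_cast; exact (Int.mod_modEq _ _).symm
    rw [e1, e2]

lemma avg_shrink (m n : ℕ) (hm : m ≠ 0) (hn : n ≠ 0) (G : ℤ → ℂ) (hG : Per m G) : avg (m * n) G = avg m G := by
  have key : ∀ n : ℕ, ∑ x ∈ Finset.range (m * n), G x = n * ∑ x ∈ Finset.range m, G x := by
    intro n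
    induction n with
    | zero => simp
    | succ n ih =>
      rw [mul_add, mul_one, Finset.sum_range_add, ih]
      push_cast
      rw [add_mul, one_mul]
      congr 1
      refine Finset.sum_congr rfl fun x _ => ?_
      rw [add_comm, hG.mul_int]
  have hm' : (m : ℂ) ≠ 0 := by exact_mod_cast hm
  have hn' : (n : ℂ) ≠ 0 := by exact_mod_cast hn
  rw [avg, avg, key]
  push_cast
  field_simp

lemma avg_norm_le (m : ℕ) (G : ℤ → ℂ) (c : ℝ) (hc : 0 ≤ c) (h : ∀ x, ‖G x‖ ≤ c) : ‖avg m G‖ ≤ c := by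
  rcases Nat.eq_zero_or_pos m with rfl | hm
  · simpa [avg] using hc
  · have hm' : 0 < (m : ℝ) := by exact_mod_cast hm
    rw [avg, norm_div, Complex.norm_natCast, div_le_iff₀ hm']
    refine (norm_sum_le _ _).trans ?_
    calc _ ≤ ∑ x ∈ Finset.range m, c := Finset.sum_le_sum fun x _ => h x
      _ = _ := by simp [mul_comm]

lemma avg_mul_left (m : ℕ) (c : ℂ) (G : ℤ → ℂ) : avg m (fun x => c * G x) = c * avg m G := by
  rw [avg, avg, ← Finset.mul_sum, mul_div_assoc]

lemma avg_mul_right (m : ℕ) (c : ℂ) (G : ℤ → ℂ) : avg m (fun x => G x * c) = avg m G * c := by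
  rw [avg, avg, ← Finset.sum_mul]; ring

lemma avg_sum {ι : Type*} (m : ℕ) (s : Finset ι) (G : ι → ℤ → ℂ) :
    avg m (fun x => ∑ i ∈ s, G i x) = ∑ i ∈ s, avg m (G i) := by
  simp only [avg]
  rw [Finset.sum_comm, Finset.sum_div]

/-- frequency vanishing -/
lemma avg_freq_zero (m n : ℕ) (hm : m ≠ 0) (hn : n ≠ 0) (G : ℤ → ℂ) (hG : Per m G) (a : ℤ) (ha : ¬ (n : ℤ) ∣ a) :
    avg (m * n) (fun x => G x * ee (m * n) (a * x)) = 0 := by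
  set H : ℤ → ℂ := fun x => G x * ee (m * n) (a * x)
  have hH : Per (m * n) H := (hG.of_dvd (dvd_mul_right _ _)).mul (ee_per _ _)
  have shift : ∑ x ∈ Finset.range (m * n), H (x + m) = ∑ x ∈ Finset.range (m * n), H x := by
    have key : ∀ k : ℕ, ∑ x ∈ Finset.range (m * n), H (x + k) = ∑ x ∈ Finset.range (m * n), H x := by
      intro k
      induction k with
      | zero => simp
      | succ k ih =>
        rw [← ih]
        have e1 := Finset.sum_range_succ' (fun x : ℕ => H (x + k)) (m * n)
        have e2 := Finset.sum_range_succ (fun x : ℕ => H (x + k)) (m * n)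
        have e3 : H (((m * n : ℕ) : ℤ) + k) = H (((0 : ℕ) : ℤ) + k) := by
          have := hH ((0 : ℕ) + (k : ℤ))
          rw [← this]; congr 1; push_cast; ring
        rw [e3] at e2
        have e4 := add_right_cancel (e1.symm.trans e2)
        rw [← e4]
        refine Finset.sum_congr rfl fun x _ => ?_
        congr 1; push_cast; ring
    exact key m
  have mult : ∀ x, H (x + m) = ee n a * H x := by
    intro x
    simp only [H]
    rw [hG x, mul_add, ee_add]
    have : ee (m * n) (a * m) = ee n a := by
      rw [mul_comm m n, mul_comm a, ee_scale n m hm]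
    rw [this]; ring
  simp_rw [mult] at shift
  rw [← Finset.mul_sum] at shift
  have hne : ee n a ≠ 1 := fun h => ha ((ee_eq_one_iff n hn a).1 h)
  have : (∑ x ∈ Finset.range (m * n), H x) = 0 := by
    by_contra h0
    apply hne
    exact mul_right_cancel₀ h0 (by rw [shift, one_mul])
  rw [avg, this, zero_div]

lemma avg_freq (m n : ℕ) (hm : m ≠ 0) (hn : n ≠ 0) (G : ℤ → ℂ) (hG : Per m G) (h : ℤ) :
    avg (m * n) (fun x => G x * ee (m * n) (n * h * x)) = avg m (fun x => G x * ee m (h * x)) := by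
  have : (fun x => G x * ee (m * n) (n * h * x)) = fun x => G x * ee m (h * x) := by
    funext x
    rw [mul_assoc, ee_scale m n hn]
  rw [this]
  exact avg_shrink m n hm hn _ (hG.mul (ee_per m h))

/-- Parseval -/
lemma parseval (m : ℕ) (hm : m ≠ 0) (A : ℤ → ℂ) :
    ∑ k ∈ Finset.range m, ‖avg m (fun y => A y * ee m (k * y))‖ ^ 2 = (∑ y ∈ Finset.range m, ‖A y‖ ^ 2) / m := by
  have hmC : (m : ℂ) ≠ 0 := by exact_mod_cast hm
  have h : ((∑ k ∈ Finset.range m, ‖avg m (fun y => A y * ee m (k * y))‖ ^ 2 : ℝ) : ℂ) = (((∑ y ∈ Finset.range m, ‖A y‖ ^ 2) / m : ℝ) : ℂ) := by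
    push_cast
    have e : ∀ k : ℕ, ((‖avg m (fun y => A y * ee m (k * y))‖ : ℂ)) ^ 2 =
        ∑ t ∈ Finset.range m, ∑ s ∈ Finset.range m, (A t * (starRingEnd ℂ) (A s)) / m ^ 2 * ee m ((t - s) * k) := by
      intro k
      rw [← Complex.mul_conj', avg, map_div₀, map_sum, div_mul_div_comm, Finset.sum_mul_sum, Complex.conj_natCast, Finset.sum_div]
      refine Finset.sum_congr rfl fun t _ => ?_
      rw [Finset.sum_div]
      refine Finset.sum_congr rfl fun s _ => ?_
      rw [map_mul, ee_conj]
      have : ee m (((t : ℤ) - s) * k) = ee m (k * t) * ee m (-(k * s)) := by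
        rw [← ee_add]; congr 1; ring
      rw [this]; ring
    simp_rw [e]
    rw [Finset.sum_comm, Finset.sum_div]
    refine Finset.sum_congr rfl fun t ht => ?_
    rw [Finset.sum_comm]
    have horth : ∀ s : ℕ, ∑ k ∈ Finset.range m, ee m (((t : ℤ) - s) * k) = if (m : ℤ) ∣ (t : ℤ) - s then (m : ℂ) else 0 := by
      intro s
      have := avg_ee m hm ((t : ℤ) - s)
      rw [avg, div_eq_iff hmC] at this
      rw [this]; split_ifs <;> simp
    simp_rw [← Finset.mul_sum, horth]
    rw [Finset.sum_eq_single t]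
    · simp only [sub_self, dvd_zero, if_true]; rw [Complex.mul_conj']; field_simp
    · intro s hs hst
      rw [if_neg, mul_zero]
      intro hd
      apply hst
      have h1 := Finset.mem_range.1 hs
      have h2 := Finset.mem_range.1 ht
      have := Int.eq_zero_of_abs_lt_dvd hd (by rw [abs_lt]; constructor <;> omega)
      omega
    · intro h; exact absurd ht h
  exact_mod_cast h

end
end SqSieve
end

section
namespace SqSieve

noncomputable section

def rowv (m : ℕ) (B : ℤ → ℤ → ℂ) (h y : ℤ) : ℂ := avg m (fun x => B x y * ee m (h * x))

def LNv (m : ℕ) (B : ℤ → ℤ → ℂ) (h : ℤ) : ℝ := (∑ y ∈ Finset.range m, ‖rowv m B h y‖ ^ 2) / m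

def hatv (m : ℕ) (B : ℤ → ℤ → ℂ) (h k : ℤ) : ℂ := avg m (fun y => rowv m B h y * ee m (k * y))

def Per2 (m : ℕ) (B : ℤ → ℤ → ℂ) : Prop := (∀ y, Per m (fun x => B x y)) ∧ ∀ x, Per m (fun y => B x y)

lemma Per2.of_dvd {m n : ℕ} {B : ℤ → ℤ → ℂ} (h : Per2 m B) (hd : m ∣ n) : Per2 n B :=
  ⟨fun y => (h.1 y).of_dvd hd, fun x => (h.2 x).of_dvd hd⟩

lemma Per2.mul' {m n : ℕ} {B C : ℤ → ℤ → ℂ} (h : Per2 m B) (h2 : Per2 n C) : Per2 (m * n) (fun x y => B x y * C x y) :=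
  ⟨fun y => (h.1 y).mul' (h2.1 y), fun x => (h.2 x).mul' (h2.2 x)⟩

lemma rowv_per {m : ℕ} {B : ℤ → ℤ → ℂ} (hB : Per2 m B) (h : ℤ) : Per m (rowv m B h) := by
  intro y
  simp only [rowv]
  congr 1
  funext x
  have := hB.2 x y
  simp only at this
  rw [this]

lemma rowv_crt (m1 m2 : ℕ) (h1 : m1 ≠ 0) (h2 : m2 ≠ 0) (hco : Nat.Coprime m1 m2) (c1 c2 : ℤ)
    (hc : c1 * m2 + c2 * m1 = 1) (B1 B2 : ℤ → ℤ → ℂ) (hB1 : Per2 m1 B1) (hB2 : Per2 m2 B2) (h y : ℤ) :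
    rowv (m1 * m2) (fun x y => B1 x y * B2 x y) h y = rowv m1 B1 (c1 * h) y * rowv m2 B2 (c2 * h) y := by
  simp only [rowv]
  rw [← avg_crt m1 m2 h1 h2 hco _ _ ((hB1.1 y).mul (ee_per m1 (c1 * h))) ((hB2.1 y).mul (ee_per m2 (c2 * h)))]
  congr 1
  funext x
  rw [ee_crt m1 m2 h1 h2 c1 c2 hc, mul_assoc c1, mul_assoc c2]
  ring

lemma hatv_crt (m1 m2 : ℕ) (h1 : m1 ≠ 0) (h2 : m2 ≠ 0) (hco : Nat.Coprime m1 m2) (c1 c2 : ℤ)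
    (hc : c1 * m2 + c2 * m1 = 1) (B1 B2 : ℤ → ℤ → ℂ) (hB1 : Per2 m1 B1) (hB2 : Per2 m2 B2) (h k : ℤ) :
    hatv (m1 * m2) (fun x y => B1 x y * B2 x y) h k = hatv m1 B1 (c1 * h) (c1 * k) * hatv m2 B2 (c2 * h) (c2 * k) := by
  simp only [hatv]
  rw [← avg_crt m1 m2 h1 h2 hco _ _ ((rowv_per hB1 (c1 * h)).mul (ee_per m1 (c1 * k)))
    ((rowv_per hB2 (c2 * h)).mul (ee_per m2 (c2 * k)))]
  congr 1
  funext y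
  rw [rowv_crt m1 m2 h1 h2 hco c1 c2 hc B1 B2 hB1 hB2, ee_crt m1 m2 h1 h2 c1 c2 hc, mul_assoc c1, mul_assoc c2]
  ring

lemma LNv_eq (m : ℕ) (B : ℤ → ℤ → ℂ) (h : ℤ) : (LNv m B h : ℂ) = avg m (fun y => ((‖rowv m B h y‖ ^ 2 : ℝ) : ℂ)) := by
  rw [LNv, avg]; push_cast; rfl

lemma LNv_crt (m1 m2 : ℕ) (h1 : m1 ≠ 0) (h2 : m2 ≠ 0) (hco : Nat.Coprime m1 m2) (c1 c2 : ℤ)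
    (hc : c1 * m2 + c2 * m1 = 1) (B1 B2 : ℤ → ℤ → ℂ) (hB1 : Per2 m1 B1) (hB2 : Per2 m2 B2) (h : ℤ) :
    LNv (m1 * m2) (fun x y => B1 x y * B2 x y) h = LNv m1 B1 (c1 * h) * LNv m2 B2 (c2 * h) := by
  have : (LNv (m1 * m2) (fun x y => B1 x y * B2 x y) h : ℂ) = ((LNv m1 B1 (c1 * h) * LNv m2 B2 (c2 * h) : ℝ) : ℂ) := by
    push_cast
    rw [LNv_eq, LNv_eq, LNv_eq, ← avg_crt m1 m2 h1 h2 hco]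
    · congr 1
      funext y
      rw [rowv_crt m1 m2 h1 h2 hco c1 c2 hc B1 B2 hB1 hB2, norm_mul, mul_pow]
      push_cast; rfl
    · intro y; dsimp only; rw [rowv_per hB1]
    · intro y; dsimp only; rw [rowv_per hB2]
  exact_mod_cast this

lemma LNv_nonneg (m : ℕ) (B : ℤ → ℤ → ℂ) (h : ℤ) : 0 ≤ LNv m B h := by
  unfold LNv; positivity

lemma bezout (m1 m2 : ℕ) (hco : Nat.Coprime m1 m2) : ∃ c1 c2 : ℤ, c1 * m2 + c2 * m1 = 1 := by
  obtain ⟨a, b, h⟩ := Nat.isCoprime_iff_coprime.2 hco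
  exact ⟨b, a, by linarith⟩

lemma parseval_hat (m : ℕ) (hm : m ≠ 0) (B : ℤ → ℤ → ℂ) (h : ℤ) :
    ∑ k ∈ Finset.range m, ‖hatv m B h k‖ ^ 2 = LNv m B h := parseval m hm _

lemma hatv_per (m : ℕ) (B : ℤ → ℤ → ℂ) (h k t : ℤ) : hatv m B h (k + m * t) = hatv m B h k := by
  simp only [hatv]
  congr 1
  funext y
  rw [add_mul, ee_add, mul_assoc (m : ℤ), ee_mul_self, mul_one]

/-- the Fejer weight -/
def wt (N J : ℕ) (x : ℤ) : ℝ := ‖∑ j ∈ Finset.range J, ee N (j * x)‖ ^ 2 / (J : ℝ) ^ 2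

lemma wt_nonneg (N J : ℕ) (x : ℤ) : 0 ≤ wt N J x := by unfold wt; positivity

lemma wt_per (N J : ℕ) (x : ℤ) : wt N J (x + N) = wt N J x := by
  unfold wt
  congr 3
  refine Finset.sum_congr rfl fun j _ => ?_
  have := ee_per N (j : ℤ) x
  exact this

lemma wt_lower (N J : ℕ) (hJ : 0 < J) (x : ℤ) (hx : |x| * (8 * J) ≤ N) : 1 / 2 ≤ wt N J x := by
  have hJ' : 0 < (J : ℝ) := by exact_mod_cast hJ
  have hre : (J : ℝ) * (√2 / 2) ≤ (∑ j ∈ Finset.range J, ee N (j * x)).re := by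
    rw [Complex.re_sum]
    calc (J : ℝ) * (√2 / 2) = ∑ j ∈ Finset.range J, (√2 / 2) := by simp
      _ ≤ _ := by
        refine Finset.sum_le_sum fun j hj => ?_
        have hj' : j < J := Finset.mem_range.1 hj
        have e : (2 * Real.pi * Complex.I * ((j * x : ℤ) : ℂ) / N : ℂ) = ((2 * Real.pi * (j * x) / N : ℝ) : ℂ) * Complex.I := by
          push_cast; ring
        rw [ee, e, Complex.exp_ofReal_mul_I_re, ← Real.cos_pi_div_four, ← Real.cos_abs (2 * Real.pi * (j * x) / N)]
        apply Real.cos_le_cos_of_nonneg_of_le_pi (abs_nonneg _)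
        · linarith [Real.pi_pos]
        · rcases Nat.eq_zero_or_pos N with rfl | hN
          · simp; positivity
          · have hN' : 0 < (N : ℝ) := by exact_mod_cast hN
            rw [abs_div, abs_of_pos hN', div_le_iff₀ hN', abs_mul, abs_of_pos (by positivity : 0 < 2 * Real.pi), abs_mul,
              abs_of_nonneg (by positivity : (0:ℝ) ≤ j)]
            have hx' : |(x : ℝ)| * (8 * J) ≤ N := by exact_mod_cast hx
            have hjJ : (j : ℝ) ≤ J := by exact_mod_cast hj'.le
            have h1 : (j : ℝ) * |(x : ℝ)| ≤ J * |(x : ℝ)| := by gcongr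
            have := Real.pi_pos
            nlinarith
  have h0 : 0 ≤ (J : ℝ) * (√2 / 2) := by positivity
  have h1 : (J : ℝ) * (√2 / 2) ≤ ‖∑ j ∈ Finset.range J, ee N (j * x)‖ := hre.trans (Complex.re_le_norm _)
  rw [wt, le_div_iff₀ (by positivity)]
  calc 1 / 2 * (J : ℝ) ^ 2 = ((J : ℝ) * (√2 / 2)) ^ 2 := by
        rw [mul_pow, div_pow, Real.sq_sqrt (by norm_num)]; ring
    _ ≤ _ := by gcongr

def cf (n J : ℕ) (h : ℤ) : ℝ :=
  (((Finset.range J ×ˢ Finset.range J).filter fun ij => (ij.1 : ℤ) - ij.2 = n * h).card : ℝ) / J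

lemma cf_nonneg (n J : ℕ) (h : ℤ) : 0 ≤ cf n J h := by unfold cf; positivity

lemma cf_le (n J : ℕ) (h : ℤ) : cf n J h ≤ 1 := by
  unfold cf
  apply div_le_one_of_le₀ _ (by positivity)
  have : ((Finset.range J ×ˢ Finset.range J).filter fun ij => (ij.1 : ℤ) - ij.2 = n * h).card ≤ (Finset.range J).card := by
    apply Finset.card_le_card_of_injOn (fun ij => ij.1)
    · intro ij hij
      simp only [Finset.coe_filter, Finset.mem_product, Set.mem_ofPred_eq] at hij
      exact hij.1.1
    · intro a ha b hb hab
      simp only [Finset.coe_filter, Finset.mem_product, Set.mem_ofPred_eq] at ha hb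
      have h3 : (a.1 : ℤ) = b.1 := by exact_mod_cast hab
      apply Prod.ext
      · exact hab
      · have : (a.2 : ℤ) = b.2 := by linarith [ha.2, hb.2]
        exact_mod_cast this
  rw [Finset.card_range] at this
  exact_mod_cast this

lemma wt_expand (N J : ℕ) (x : ℤ) : (wt N J x : ℂ) =
    (∑ ij ∈ Finset.range J ×ˢ Finset.range J, ee N (((ij.1 : ℤ) - ij.2) * x)) / (J : ℂ) ^ 2 := by
  rw [wt]
  push_cast
  congr 1
  rw [← Complex.mul_conj', map_sum, Finset.sum_mul_sum, Finset.sum_product]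
  refine Finset.sum_congr rfl fun i _ => Finset.sum_congr rfl fun j _ => ?_
  rw [ee_conj, ← ee_add]; congr 1; ring

lemma wsum (m n J : ℕ) (hm : m ≠ 0) (hn : n ≠ 0) (hJ : J ≠ 0) (φ : ℤ → ℂ) (hφ : Per m φ) :
    ∑ x ∈ Finset.range (m * n), (wt (m * n) J x : ℂ) * φ x =
      ((m * n : ℕ) / J : ℂ) * ∑ h ∈ Finset.Icc (-((J / n : ℕ) : ℤ)) ((J / n : ℕ) : ℤ),
        (cf n J h : ℂ) * avg m (fun x => φ x * ee m (h * x)) := by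
  have hJC : (J : ℂ) ≠ 0 := by exact_mod_cast hJ
  have hmn : ((m * n : ℕ) : ℂ) ≠ 0 := by exact_mod_cast (Nat.mul_ne_zero hm hn)
  have e1 : ∑ x ∈ Finset.range (m * n), (wt (m * n) J x : ℂ) * φ x =
      ((m * n : ℕ) / (J : ℂ) ^ 2) * ∑ ij ∈ Finset.range J ×ˢ Finset.range J, avg (m * n) (fun x => φ x * ee (m * n) (((ij.1 : ℤ) - ij.2) * x)) := by
    simp_rw [avg, ← Finset.sum_div]
    rw [Finset.sum_comm]
    simp_rw [wt_expand, ← Finset.mul_sum]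
    rw [div_mul_div_comm, mul_comm ((J : ℂ) ^ 2), mul_div_mul_left _ _ hmn, Finset.sum_div]
    refine Finset.sum_congr rfl fun x _ => ?_
    ring
  have e2 : ∀ a : ℤ, |a| < J → avg (m * n) (fun x => φ x * ee (m * n) (a * x)) =
      ∑ h ∈ Finset.Icc (-((J / n : ℕ) : ℤ)) ((J / n : ℕ) : ℤ), if a = n * h then avg m (fun x => φ x * ee m (h * x)) else 0 := by
    intro a ha
    by_cases hd : (n : ℤ) ∣ a
    · obtain ⟨t, rfl⟩ := hd
      rw [avg_freq m n hm hn φ hφ, Finset.sum_eq_single t]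
      · simp
      · intro b _ hb
        rw [if_neg]
        intro h
        apply hb
        have : (n : ℤ) ≠ 0 := by exact_mod_cast hn
        exact (mul_left_cancel₀ this h).symm
      · intro ht
        exfalso
        apply ht
        rw [Finset.mem_Icc, ← abs_le]
        push_cast
        rw [Int.le_ediv_iff_mul_le (by exact_mod_cast Nat.pos_of_ne_zero hn)]
        rw [abs_mul] at ha
        have : |(n : ℤ)| = n := abs_of_nonneg (by positivity)
        rw [this] at ha
        linarith
    · rw [avg_freq_zero m n hm hn φ hφ a hd, eq_comm]
      apply Finset.sum_eq_zero
      intro h _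
      rw [if_neg]
      rintro rfl
      exact hd (dvd_mul_right _ _)
  rw [e1]
  have e3 : ∑ ij ∈ Finset.range J ×ˢ Finset.range J, avg (m * n) (fun x => φ x * ee (m * n) (((ij.1 : ℤ) - ij.2) * x)) =
      (J : ℂ) * ∑ h ∈ Finset.Icc (-((J / n : ℕ) : ℤ)) ((J / n : ℕ) : ℤ), (cf n J h : ℂ) * avg m (fun x => φ x * ee m (h * x)) := by
    have : ∀ ij ∈ Finset.range J ×ˢ Finset.range J, avg (m * n) (fun x => φ x * ee (m * n) (((ij.1 : ℤ) - ij.2) * x)) =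
        ∑ h ∈ Finset.Icc (-((J / n : ℕ) : ℤ)) ((J / n : ℕ) : ℤ), if (ij.1 : ℤ) - ij.2 = n * h then avg m (fun x => φ x * ee m (h * x)) else 0 := by
      intro ij hij
      apply e2
      simp only [Finset.mem_product, Finset.mem_range] at hij
      rw [abs_lt]; constructor <;> omega
    rw [Finset.sum_congr rfl this, Finset.sum_comm, Finset.mul_sum]
    refine Finset.sum_congr rfl fun h _ => ?_
    rw [← Finset.sum_filter, Finset.sum_const, cf, nsmul_eq_mul]
    push_cast
    field_simp
  rw [e3]
  field_simp

end
end SqSieve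
end

section
namespace SqSieve

noncomputable section
open Finset

/-- product over a finset of a family -/
def pr (c : ℕ → ℤ → ℤ → ℂ) (S : Finset ℕ) (x y : ℤ) : ℂ := ∏ ℓ ∈ S, c ℓ x y

lemma pr_per (c : ℕ → ℤ → ℤ → ℂ) (S : Finset ℕ) (hc : ∀ ℓ ∈ S, Per2 ℓ (c ℓ)) : Per2 (∏ ℓ ∈ S, ℓ) (pr c S) := by
  constructor
  · intro y x
    refine prod_congr rfl fun ℓ hℓ => ?_
    exact (((hc ℓ hℓ).1 y).of_dvd (dvd_prod_of_mem _ hℓ)) x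
  · intro x y
    refine prod_congr rfl fun ℓ hℓ => ?_
    exact (((hc ℓ hℓ).2 x).of_dvd (dvd_prod_of_mem _ hℓ)) y

lemma coprime_prod {S : Finset ℕ} (hp : ∀ ℓ ∈ S, ℓ.Prime) {a : ℕ} (ha : a.Prime) (haS : a ∉ S) :
    Nat.Coprime a (∏ ℓ ∈ S, ℓ) := by
  apply Nat.Coprime.prod_right
  intro i hi
  exact (Nat.coprime_primes ha (hp i hi)).2 (fun h => haS (h ▸ hi))

lemma prod_ne_zero' {S : Finset ℕ} (hp : ∀ ℓ ∈ S, ℓ.Prime) : (∏ ℓ ∈ S, ℓ) ≠ 0 :=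
  prod_ne_zero_iff.2 fun ℓ h => (hp ℓ h).ne_zero

lemma pr_LN (c : ℕ → ℤ → ℤ → ℂ) (α : ℕ → ℝ) (S : Finset ℕ) (hp : ∀ ℓ ∈ S, ℓ.Prime) (hc : ∀ ℓ ∈ S, Per2 ℓ (c ℓ))
    (hα : ∀ ℓ ∈ S, ∀ h, LNv ℓ (c ℓ) h ≤ α ℓ) (h : ℤ) : LNv (∏ ℓ ∈ S, ℓ) (pr c S) h ≤ ∏ ℓ ∈ S, α ℓ := by
  induction S using Finset.induction_on generalizing h with
  | empty => simp [LNv, rowv, avg, pr, ee_norm]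
  | insert a S ha ih =>
    have hp' : ∀ ℓ ∈ S, ℓ.Prime := fun ℓ h => hp ℓ (mem_insert_of_mem h)
    have hc' : ∀ ℓ ∈ S, Per2 ℓ (c ℓ) := fun ℓ h => hc ℓ (mem_insert_of_mem h)
    have hpa := hp a (mem_insert_self _ _)
    have hco := coprime_prod hp' hpa ha
    obtain ⟨c1, c2, hc12⟩ := bezout a _ hco
    have e : pr c (insert a S) = fun x y => c a x y * pr c S x y := by
      funext x y; simp only [pr]; rw [prod_insert ha]
    rw [prod_insert ha, prod_insert ha, e, LNv_crt a _ hpa.ne_zero (prod_ne_zero' hp') hco c1 c2 hc12 _ _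
      (hc a (mem_insert_self _ _)) (pr_per c S hc')]
    have h0 := hα a (mem_insert_self _ _) (c1 * h)
    exact mul_le_mul h0 (ih hp' hc' (fun ℓ h => hα ℓ (mem_insert_of_mem h)) _) (LNv_nonneg _ _ _) ((LNv_nonneg _ _ _).trans h0)

lemma pr_avg (c : ℕ → ℤ → ℤ → ℂ) (S : Finset ℕ) (hp : ∀ ℓ ∈ S, ℓ.Prime) (hc : ∀ ℓ ∈ S, Per2 ℓ (c ℓ)) (y : ℤ) :
    avg (∏ ℓ ∈ S, ℓ) (fun x => pr c S x y) = ∏ ℓ ∈ S, avg ℓ (fun x => c ℓ x y) := by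
  induction S using Finset.induction_on with
  | empty => simp [avg, pr]
  | insert a S ha ih =>
    have hp' : ∀ ℓ ∈ S, ℓ.Prime := fun ℓ h => hp ℓ (mem_insert_of_mem h)
    have hc' : ∀ ℓ ∈ S, Per2 ℓ (c ℓ) := fun ℓ h => hc ℓ (mem_insert_of_mem h)
    have hpa := hp a (mem_insert_self _ _)
    have hco := coprime_prod hp' hpa ha
    have e : (fun x => pr c (insert a S) x y) = fun x => c a x y * pr c S x y := by
      funext x; simp only [pr]; rw [prod_insert ha]
    rw [prod_insert ha, prod_insert ha, e, avg_crt a _ hpa.ne_zero (prod_ne_zero' hp') hco _ _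
      ((hc a (mem_insert_self _ _)).1 y) ((pr_per c S hc').1 y), ih hp' hc']

lemma pr_norm (c : ℕ → ℤ → ℤ → ℂ) (S : Finset ℕ) (h1 : ∀ ℓ ∈ S, ∀ x y, ‖c ℓ x y‖ ≤ 1) (x y : ℤ) : ‖pr c S x y‖ ≤ 1 := by
  rw [pr, norm_prod]
  exact prod_le_one (fun _ _ => norm_nonneg _) fun ℓ h => h1 ℓ h x y

lemma LNv_le_one (m : ℕ) (B : ℤ → ℤ → ℂ) (h1 : ∀ x y, ‖B x y‖ ≤ 1) (h : ℤ) : LNv m B h ≤ 1 := by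
  rcases Nat.eq_zero_or_pos m with rfl | hm
  · simp [LNv]
  · have hm' : 0 < (m : ℝ) := by exact_mod_cast hm
    rw [LNv, div_le_one hm']
    calc _ ≤ ∑ y ∈ range m, (1 : ℝ) := by
          refine sum_le_sum fun y _ => ?_
          have : ‖rowv m B h y‖ ≤ 1 := by
            apply avg_norm_le _ _ _ zero_le_one
            intro x
            rw [norm_mul, ee_norm, mul_one]; exact h1 x y
          exact pow_le_one₀ (norm_nonneg _) this
      _ = m := by simp

/-- bound for a weighted sum when the modulus is small: only the mean survives. -/
lemma wsum_mean (N m U : ℕ) (hN : N ≠ 0) (hU : U ≠ 0) (hmN : m ∣ N) (hUN : 8 * U ∣ N) (hm : m < 8 * U) (φ : ℤ → ℂ) (hφ : Per m φ) :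
    ‖∑ x ∈ range N, (wt N (N / (8 * U)) x : ℂ) * φ x‖ ≤ 8 * U * ‖avg m φ‖ := by
  obtain ⟨n, rfl⟩ := hmN
  obtain ⟨J, hJ⟩ := hUN
  have hm0 : m ≠ 0 := by rintro rfl; simp at hN
  have hn0 : n ≠ 0 := by rintro rfl; simp at hN
  have hJ0 : J ≠ 0 := by rintro rfl; simp [hJ] at hN
  have hJe : m * n / (8 * U) = J := by rw [hJ]; exact Nat.mul_div_cancel_left _ (by omega)
  have hJn : J / n = 0 := by
    apply Nat.div_eq_of_lt
    by_contra hcon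
    push Not at hcon
    have h1 : 8 * U * n ≤ 8 * U * J := Nat.mul_le_mul_left _ hcon
    rw [← hJ] at h1
    have := Nat.le_of_mul_le_mul_right h1 (Nat.pos_of_ne_zero hn0)
    omega
  rw [hJe, wsum m n J hm0 hn0 hJ0 φ hφ, hJn]
  simp only [Nat.cast_zero, neg_zero, Icc_self, sum_singleton, zero_mul, ee_zero, mul_one]
  have e : (((m * n : ℕ) : ℂ) / J) = ((8 * U : ℕ) : ℂ) := by
    rw [hJ]; push_cast
    have : (J : ℂ) ≠ 0 := by exact_mod_cast hJ0
    field_simp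
  rw [e, norm_mul, norm_mul, Complex.norm_natCast, Complex.norm_real, Real.norm_of_nonneg (cf_nonneg _ _ _)]
  push_cast
  have := cf_le n J 0
  have h3 := norm_nonneg (avg m φ)
  have : cf n J 0 * ‖avg m φ‖ ≤ 1 * ‖avg m φ‖ := by gcongr
  rw [one_mul] at this
  gcongr

lemma sum_mod (m : ℕ) (hm : 0 < m) (f : ℤ → ℝ) (hf0 : ∀ k, 0 ≤ f k) (hf : ∀ k t, f (k + m * t) = f k) (a : ℤ) (n : ℕ) :
    ∑ k ∈ range (m * n), f (a + k) = n * ∑ k ∈ range m, f k := by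
  have h1 : ∀ a : ℤ, ∑ k ∈ range m, f (a + k) = ∑ k ∈ range m, f k := by
    have hstep : ∀ a : ℤ, ∑ k ∈ range m, f (a + 1 + k) = ∑ k ∈ range m, f (a + k) := by
      intro a
      have e1 := sum_range_succ' (fun k : ℕ => f (a + k)) m
      have e2 := sum_range_succ (fun k : ℕ => f (a + k)) m
      have e3 : f (a + m) = f a := by simpa using hf a 1
      rw [e2] at e1
      simp only [Nat.cast_zero, add_zero, e3, Nat.cast_succ] at e1
      have e4 := add_right_cancel e1
      rw [e4]
      refine sum_congr rfl fun k _ => ?_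
      congr 1; ring
    intro a
    induction a using Int.induction_on with
    | zero => simp
    | succ k ih => rw [hstep, ih]
    | pred k ih => rw [← ih, ← hstep]; simp
  induction n with
  | zero => simp
  | succ n ih =>
    rw [mul_add, mul_one, sum_range_add, ih]
    have : ∑ x ∈ range m, f (a + ((m * n + x : ℕ) : ℤ)) = ∑ k ∈ range m, f k := by
      rw [← h1 (a + m * n)]
      refine sum_congr rfl fun k _ => ?_
      congr 1; push_cast; ring
    rw [this]; push_cast; ring

lemma sum_Icc_per (m : ℕ) (hm : 0 < m) (f : ℤ → ℝ) (hf0 : ∀ k, 0 ≤ f k) (hf : ∀ k t, f (k + m * t) = f k) (K : ℕ) :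
    ∑ k ∈ Icc (-(K : ℤ)) K, f k ≤ ((2 * K + 1 : ℝ) / m + 1) * ∑ k ∈ range m, f k := by
  set n := (2 * K + 1) / m + 1
  have hn : (n : ℝ) ≤ (2 * K + 1 : ℝ) / m + 1 := by
    simp only [n]; push_cast
    have := @Nat.cast_div_le ℝ _ _ _ (2 * K + 1) m
    push_cast at this
    linarith
  have hlt : 2 * K + 1 ≤ m * n := by
    have := Nat.lt_mul_div_succ (2 * K + 1) hm
    exact this.le
  have hS : 0 ≤ ∑ k ∈ range m, f k := sum_nonneg fun k _ => hf0 _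
  calc ∑ k ∈ Icc (-(K : ℤ)) K, f k = ∑ k ∈ range (2 * K + 1), f (-(K : ℤ) + k) := by
        symm
        refine sum_bij (fun k _ => -(K : ℤ) + k) ?_ ?_ ?_ ?_
        · intro a ha; simp only [mem_range, mem_Icc] at *; omega
        · intro a _ b _ h; simpa using h
        · intro b hb
          simp only [mem_Icc] at hb
          exact ⟨(b + K).toNat, by simp only [mem_range]; omega, by omega⟩
        · intros; rfl
    _ ≤ ∑ k ∈ range (m * n), f (-(K : ℤ) + k) :=
        sum_le_sum_of_subset_of_nonneg (range_mono hlt) fun _ _ _ => hf0 _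
    _ = n * ∑ k ∈ range m, f k := sum_mod m hm f hf0 hf _ n
    _ ≤ _ := by gcongr

lemma sum_range_mul_unit (q : ℕ) (hq : 0 < q) (c : ℤ) (hc : IsCoprime c (q : ℤ)) (f : ℤ → ℝ) (hf : ∀ k t, f (k + q * t) = f k) :
    ∑ k ∈ range q, f (c * k) = ∑ k ∈ range q, f k := by
  have hq' : (0 : ℤ) < q := by exact_mod_cast hq
  have hmod : ∀ k : ℤ, f (k % q) = f k := by
    intro k
    conv_rhs => rw [← Int.emod_add_mul_ediv k q]
    rw [hf]
  have hinj : Set.InjOn (fun k : ℕ => ((c * k) % q).toNat) (range q : Finset ℕ) := by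
    intro a ha b hb hab
    simp only [coe_range, Set.mem_Iio] at ha hb
    simp only at hab
    have h1 := Int.emod_nonneg (c * a) hq'.ne'
    have h2 := Int.emod_nonneg (c * b) hq'.ne'
    have h3 : (c * a) % q = (c * b) % (q : ℤ) := by omega
    have h4 : (q : ℤ) ∣ c * b - c * a := Int.ModEq.dvd h3
    rw [← mul_sub] at h4
    have h5 := hc.symm.dvd_of_dvd_mul_left h4
    obtain ⟨t, ht⟩ := h5
    have : t = 0 := by nlinarith [abs_lt.1 (show |t| < 1 by
      have h6 : |(b : ℤ) - a| < q := by rw [abs_lt]; constructor <;> omega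
      rw [ht, abs_mul, abs_of_pos hq'] at h6
      by_contra h7; push Not at h7; nlinarith)]
    subst this
    omega
  have himg : (range q).image (fun k : ℕ => ((c * k) % q).toNat) = range q := by
    apply eq_of_subset_of_card_le
    · intro k hk
      rw [mem_image] at hk
      obtain ⟨a, _, rfl⟩ := hk
      have := Int.emod_lt_of_pos (c * a) hq'
      have := Int.emod_nonneg (c * a) hq'.ne'
      rw [mem_range]; omega
    · rw [card_image_of_injOn hinj]
  conv_rhs => rw [← himg, sum_image hinj]
  refine sum_congr rfl fun k _ => ?_
  have := Int.emod_nonneg (c * k) hq'.ne'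
  rw [Int.toNat_of_nonneg this, hmod]

end
end SqSieve
end

section
namespace SqSieve

noncomputable section
open Finset

lemma sum_wt_freq (N m U : ℕ) (hN : N ≠ 0) (hU : U ≠ 0) (hmN : m ∣ N) (hUN : 8 * U ∣ N) (φ : ℤ → ℂ) (hφ : Per m φ) :
    ∃ c : ℤ → ℝ, (∀ h, 0 ≤ c h ∧ c h ≤ 1) ∧ ∀ φ : ℤ → ℂ, Per m φ → 
    ∑ x ∈ range N, (wt N (N / (8 * U)) x : ℂ) * φ x = (8 * U : ℕ) *
      ∑ h ∈ Icc (-((m / (8 * U) : ℕ) : ℤ)) ((m / (8 * U) : ℕ) : ℤ), (c h : ℂ) * avg m (fun x => φ x * ee m (h * x)) := by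
  obtain ⟨n, rfl⟩ := hmN
  obtain ⟨J, hJ⟩ := hUN
  have hm0 : m ≠ 0 := by rintro rfl; simp at hN
  have hn0 : n ≠ 0 := by rintro rfl; simp at hN
  have hJ0 : J ≠ 0 := by rintro rfl; simp [hJ] at hN
  have hJe : m * n / (8 * U) = J := by rw [hJ]; exact Nat.mul_div_cancel_left _ (by omega)
  have hJn : J / n = m / (8 * U) := by
    rw [← hJe, Nat.div_div_eq_div_mul, Nat.mul_div_mul_right _ _ (Nat.pos_of_ne_zero hn0)]
  refine ⟨cf n J, fun h => ⟨cf_nonneg _ _ _, cf_le _ _ _⟩, fun φ hφ => ?_⟩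
  rw [hJe, wsum m n J hm0 hn0 hJ0 φ hφ, hJn]
  congr 1
  rw [hJ]; push_cast
  have : (J : ℂ) ≠ 0 := by exact_mod_cast hJ0
  field_simp

lemma double_bound (N m U V : ℕ) (hN : N ≠ 0) (hU : U ≠ 0) (hV : V ≠ 0) (hmN : m ∣ N) (hUN : 8 * U ∣ N) (hVN : 8 * V ∣ N)
    (Φ : ℤ → ℤ → ℂ) (hΦ : Per2 m Φ) :
    ‖∑ y ∈ range N, (wt N (N / (8 * V)) y : ℂ) * ∑ x ∈ range N, (wt N (N / (8 * U)) x : ℂ) * Φ x y‖ ≤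
      64 * U * V * ∑ h ∈ Icc (-((m / (8 * U) : ℕ) : ℤ)) ((m / (8 * U) : ℕ) : ℤ),
        ∑ k ∈ Icc (-((m / (8 * V) : ℕ) : ℤ)) ((m / (8 * V) : ℕ) : ℤ), ‖hatv m Φ h k‖ := by
  obtain ⟨c1, hc1, e1⟩ := sum_wt_freq N m U hN hU hmN hUN (fun x => Φ x 0) (hΦ.1 0)
  obtain ⟨c2, hc2, e2⟩ := sum_wt_freq N m V hN hV hmN hVN (fun x => Φ x 0) (hΦ.1 0)
  have e : ∑ y ∈ range N, (wt N (N / (8 * V)) y : ℂ) * ∑ x ∈ range N, (wt N (N / (8 * U)) x : ℂ) * Φ x y =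
      (8 * U : ℕ) * ∑ h ∈ Icc (-((m / (8 * U) : ℕ) : ℤ)) ((m / (8 * U) : ℕ) : ℤ), (c1 h : ℂ) *
        ((8 * V : ℕ) * ∑ k ∈ Icc (-((m / (8 * V) : ℕ) : ℤ)) ((m / (8 * V) : ℕ) : ℤ), (c2 k : ℂ) * hatv m Φ h k) := by
    have : ∀ y ∈ range N, (wt N (N / (8 * V)) y : ℂ) * ∑ x ∈ range N, (wt N (N / (8 * U)) x : ℂ) * Φ x y =
        ∑ h ∈ Icc (-((m / (8 * U) : ℕ) : ℤ)) ((m / (8 * U) : ℕ) : ℤ), (8 * U : ℕ) * (c1 h : ℂ) * ((wt N (N / (8 * V)) y : ℂ) * rowv m Φ h y) := by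
      intro y _
      rw [e1 (fun x => Φ x y) (hΦ.1 y), mul_sum, mul_sum]
      refine sum_congr rfl fun h _ => ?_
      rw [rowv]; ring
    rw [sum_congr rfl this, sum_comm, mul_sum]
    refine sum_congr rfl fun h _ => ?_
    rw [← mul_sum, e2 _ (rowv_per hΦ h)]
    simp only [hatv]; ring
  rw [e, norm_mul, Complex.norm_natCast]
  have : ∀ h ∈ Icc (-((m / (8 * U) : ℕ) : ℤ)) ((m / (8 * U) : ℕ) : ℤ), ‖(c1 h : ℂ) *
        ((8 * V : ℕ) * ∑ k ∈ Icc (-((m / (8 * V) : ℕ) : ℤ)) ((m / (8 * V) : ℕ) : ℤ), (c2 k : ℂ) * hatv m Φ h k)‖ ≤ 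
        8 * V * ∑ k ∈ Icc (-((m / (8 * V) : ℕ) : ℤ)) ((m / (8 * V) : ℕ) : ℤ), ‖hatv m Φ h k‖ := by
    intro h _
    rw [norm_mul, norm_mul, Complex.norm_natCast, Complex.norm_real, Real.norm_of_nonneg (hc1 h).1]
    have h2 : ‖∑ k ∈ Icc (-((m / (8 * V) : ℕ) : ℤ)) ((m / (8 * V) : ℕ) : ℤ), (c2 k : ℂ) * hatv m Φ h k‖ ≤
        ∑ k ∈ Icc (-((m / (8 * V) : ℕ) : ℤ)) ((m / (8 * V) : ℕ) : ℤ), ‖hatv m Φ h k‖ := by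
      refine (norm_sum_le _ _).trans (sum_le_sum fun k _ => ?_)
      rw [norm_mul, Complex.norm_real, Real.norm_of_nonneg (hc2 k).1]
      exact mul_le_of_le_one_left (norm_nonneg _) (hc2 k).2
    refine (mul_le_of_le_one_left (by positivity) (hc1 h).2).trans ?_
    rw [Nat.cast_mul, Nat.cast_ofNat]
    gcongr
  calc _ ≤ ((8 * U : ℕ) : ℝ) * ∑ h ∈ Icc (-((m / (8 * U) : ℕ) : ℤ)) ((m / (8 * U) : ℕ) : ℤ), 
        (8 * V * ∑ k ∈ Icc (-((m / (8 * V) : ℕ) : ℤ)) ((m / (8 * V) : ℕ) : ℤ), ‖hatv m Φ h k‖) := by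
        gcongr
        exact (norm_sum_le _ _).trans (sum_le_sum this)
    _ = _ := by
      rw [← mul_sum]; push_cast; ring

lemma row_CS (q : ℕ) (hq : 0 < q) (B : ℤ → ℤ → ℂ) (lam : ℝ) (hL : ∀ h, LNv q B h ≤ lam) (c : ℤ) (hc : IsCoprime c (q : ℤ))
    (h : ℤ) (K : ℕ) :
    ∑ k ∈ Icc (-(K : ℤ)) K, ‖hatv q B h (c * k)‖ ≤ √((2 * K + 1) * (((2 * K + 1 : ℝ) / q + 1) * lam)) := by
  apply Real.le_sqrt_of_sq_le
  have h1 := sq_sum_le_card_mul_sum_sq (s := Icc (-(K : ℤ)) K) (f := fun k => ‖hatv q B h (c * k)‖)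
  refine h1.trans ?_
  have hcard : ((Icc (-(K : ℤ)) K).card : ℝ) = 2 * K + 1 := by
    rw [Int.card_Icc]
    have : ((K : ℤ) + 1 - -(K : ℤ)).toNat = 2 * K + 1 := by omega
    rw [this]; push_cast; ring
  rw [hcard]
  gcongr
  have hper : ∀ k t : ℤ, (fun k => ‖hatv q B h (c * k)‖ ^ 2) (k + q * t) = (fun k => ‖hatv q B h (c * k)‖ ^ 2) k := by
    intro k t
    simp only
    rw [show c * (k + q * t) = c * k + q * (c * t) by ring, hatv_per]
  have h2 := sum_Icc_per q hq (fun k => ‖hatv q B h (c * k)‖ ^ 2) (fun _ => by positivity) hper K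
  refine h2.trans ?_
  gcongr
  have h3 := sum_range_mul_unit q hq c hc (fun k => ‖hatv q B h k‖ ^ 2) (fun k t => by simp only [hatv_per])
  rw [h3]
  rw [parseval_hat q hq.ne']
  exact hL h

lemma offdiag (K0 : ℝ) (hK0 : 0 ≤ K0) (N p1 p2 q U V : ℕ) (hN : N ≠ 0) (hU : U ≠ 0) (hV : V ≠ 0) (hmN : p1 * (p2 * q) ∣ N)
    (hUN : 8 * U ∣ N) (hVN : 8 * V ∣ N) (hp1 : 0 < p1) (hp2 : 0 < p2) (hq : 0 < q) (hco1 : Nat.Coprime p1 (p2 * q))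
    (hco2 : Nat.Coprime p2 q) (hVp : V ≤ p1 * p2) (b1 b2 B : ℤ → ℤ → ℂ) (hb1 : Per2 p1 b1) (hb2 : Per2 p2 b2) (hB : Per2 q B)
    (h1 : ∀ h k, ‖hatv p1 b1 h k‖ ≤ K0 / p1) (h2 : ∀ h k, ‖hatv p2 b2 h k‖ ≤ K0 / p2) (lam : ℝ) (hlam : 0 ≤ lam)
    (hL : ∀ h, LNv q B h ≤ lam) :
    ‖∑ y ∈ range N, (wt N (N / (8 * V)) y : ℂ) * ∑ x ∈ range N, (wt N (N / (8 * U)) x : ℂ) * (b1 x y * (b2 x y * B x y))‖ ≤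
      128 * K0 ^ 2 * (((p1 * (p2 * q) : ℕ) : ℝ) + U) * √(q * lam) := by
  have hU' : 0 < (U : ℝ) := by exact_mod_cast Nat.pos_of_ne_zero hU
  have hV' : 0 < (V : ℝ) := by exact_mod_cast Nat.pos_of_ne_zero hV
  have hp1' : 0 < (p1 : ℝ) := by exact_mod_cast hp1
  have hp2' : 0 < (p2 : ℝ) := by exact_mod_cast hp2
  have hq' : 1 ≤ (q : ℝ) := by exact_mod_cast hq
  have hVp' : (V : ℝ) ≤ p1 * p2 := by exact_mod_cast hVp
  obtain ⟨c1, c2, hc12⟩ := bezout p1 _ hco1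
  obtain ⟨c3, c4, hc34⟩ := bezout p2 _ hco2
  have hB2 : Per2 (p2 * q) (fun x y => b2 x y * B x y) := hb2.mul' hB
  have hΦ : Per2 (p1 * (p2 * q)) (fun x y => b1 x y * (b2 x y * B x y)) := hb1.mul' hB2
  refine (double_bound N _ U V hN hU hV hmN hUN hVN _ hΦ).trans ?_
  set m := p1 * (p2 * q) with hm
  have hmR : (m : ℝ) = p1 * (p2 * q) := by rw [hm]; push_cast; ring
  have hcc : IsCoprime (c4 * c2) (q : ℤ) := by
    apply IsCoprime.mul_left
    · exact ⟨p2, c3, by linarith⟩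
    · refine ⟨p1, c1 * p2, ?_⟩; push_cast at hc12; linarith
  set K := m / (8 * V) with hK
  set H := m / (8 * U) with hH
  have hKle : (K : ℝ) ≤ m / (8 * V) := by
    have := @Nat.cast_div_le ℝ _ _ _ m (8 * V); push_cast at this; exact this
  have hHle : (H : ℝ) ≤ m / (8 * U) := by
    have := @Nat.cast_div_le ℝ _ _ _ m (8 * U); push_cast at this; exact this
  set s : ℝ := p1 * p2 / V with hs
  have hs1 : 1 ≤ s := by rw [hs, le_div_iff₀ hV']; linarith
  have hmV : (m : ℝ) / (8 * V) = s * q / 8 := by rw [hmR, hs]; field_simp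
  rw [hmV] at hKle
  have hrow : ∀ h ∈ Icc (-(H : ℤ)) H, ∑ k ∈ Icc (-(K : ℤ)) K, ‖hatv m (fun x y => b1 x y * (b2 x y * B x y)) h k‖ ≤
      K0 / p1 * (K0 / p2) * (2 * s * √(q * lam)) := by
    intro h _
    have hterm : ∀ k ∈ Icc (-(K : ℤ)) K, ‖hatv m (fun x y => b1 x y * (b2 x y * B x y)) h k‖ ≤
        K0 / p1 * (K0 / p2) * ‖hatv q B (c4 * c2 * h) (c4 * c2 * k)‖ := by
      intro k _
      rw [hm, hatv_crt p1 (p2 * q) hp1.ne' (Nat.mul_pos hp2 hq).ne' hco1 c1 c2 hc12 b1 (fun x y => b2 x y * B x y) hb1 hB2,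
        hatv_crt p2 q hp2.ne' hq.ne' hco2 c3 c4 hc34 b2 B hb2 hB, norm_mul, norm_mul, ← mul_assoc c4, ← mul_assoc c4, ← mul_assoc]
      gcongr
      · exact h1 _ _
      · exact h2 _ _
    refine (sum_le_sum hterm).trans ?_
    rw [← mul_sum]
    gcongr
    refine (row_CS q hq B lam hL (c4 * c2) hcc _ K).trans ?_
    have e4 : 2 * s * √(q * lam) = √((2 * s) ^ 2 * (q * lam)) := by
      rw [Real.sqrt_mul (by positivity) (q * lam), Real.sqrt_sq (by positivity)]
    rw [e4]
    apply Real.sqrt_le_sqrt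
    have hA : 2 * (K : ℝ) + 1 ≤ 5 / 4 * (s * q) := by nlinarith
    have hA2 : (2 * (K : ℝ) + 1) / q + 1 ≤ 9 / 4 * s := by
      have : (2 * (K : ℝ) + 1) / q ≤ 5 / 4 * s := by rw [div_le_iff₀ (by linarith)]; linarith
      linarith
    calc (2 * (K : ℝ) + 1) * (((2 * K + 1 : ℝ) / q + 1) * lam) ≤ 5 / 4 * (s * q) * (9 / 4 * s * lam) := by gcongr
      _ = 45 / 16 * (s ^ 2 * q * lam) := by ring
      _ ≤ 4 * (s ^ 2 * q * lam) := by
        have : 0 ≤ s ^ 2 * q * lam := by positivity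
        linarith
      _ = _ := by ring
  have hcard : ((Icc (-(H : ℤ)) H).card : ℝ) = 2 * H + 1 := by
    rw [Int.card_Icc]
    have : ((H : ℤ) + 1 - -(H : ℤ)).toNat = 2 * H + 1 := by omega
    rw [this]; push_cast; ring
  calc _ ≤ 64 * U * V * ∑ h ∈ Icc (-(H : ℤ)) H, K0 / p1 * (K0 / p2) * (2 * s * √(q * lam)) := by
        gcongr with h hh
        exact hrow h hh
    _ = 64 * U * V * ((2 * H + 1) * (K0 / p1 * (K0 / p2) * (2 * s * √(q * lam)))) := by
        rw [sum_const, nsmul_eq_mul, hcard]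
    _ = 128 * K0 ^ 2 * (U * (2 * H + 1)) * √(q * lam) := by rw [hs]; field_simp; ring
    _ ≤ _ := by
        gcongr
        have : U * (H : ℝ) ≤ m / 8 := by
          calc U * (H : ℝ) ≤ U * (m / (8 * U)) := by gcongr
            _ = m / 8 := by field_simp
        have hm0 : (0 : ℝ) ≤ m := by positivity
        linarith

end
end SqSieve
end

section
namespace SqSieve

noncomputable section
open Finset

open Classical in
/-- index set of the sieve -/
def Ix (G : Set ℕ) (Q P : ℕ) : Finset (ℕ × ℕ) :=
  ((Ioc 0 P) ×ˢ (Ioc 0 Q)).filter fun i => i.1.Prime ∧ i.1 ∈ G ∧ Squarefree i.2 ∧ (∀ ℓ ∈ i.2.primeFactors, ℓ ∈ G) ∧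
    P < 4 * (i.1 * i.2) ∧ i.1 * i.2 ≤ P

lemma mem_Ix {G : Set ℕ} {Q P : ℕ} {i : ℕ × ℕ} : i ∈ Ix G Q P ↔ ((0 < i.1 ∧ i.1 ≤ P) ∧ (0 < i.2 ∧ i.2 ≤ Q)) ∧
    i.1.Prime ∧ i.1 ∈ G ∧ Squarefree i.2 ∧ (∀ ℓ ∈ i.2.primeFactors, ℓ ∈ G) ∧
    P < 4 * (i.1 * i.2) ∧ i.1 * i.2 ≤ P := by
  simp [Ix]

def th (n : ℕ) : ℝ := ∑ p ∈ (Ioc 0 n).filter Nat.Prime, Real.log p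

lemma th_eq (n : ℕ) : th n = Chebyshev.theta n := by
  rw [th, Chebyshev.theta, Nat.floor_natCast]

lemma th_nonneg (n : ℕ) : 0 ≤ th n := by rw [th_eq]; exact Chebyshev.theta_nonneg _

lemma log4_le : Real.log 4 ≤ 2 := by
  have : Real.log 4 = 2 * Real.log 2 := by
    rw [show (4 : ℝ) = 2 ^ 2 by norm_num, Real.log_pow]; norm_num
  rw [this]
  have := Real.log_two_lt_d9
  linarith

lemma th_le (n : ℕ) : th n ≤ 2 * n := by
  rw [th_eq]
  have h := Chebyshev.theta_le_log4_mul_x (x := (n : ℝ)) (by positivity)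
  have : (0 : ℝ) ≤ n := by positivity
  nlinarith [log4_le]

/-- upper Mertens bound -/
lemma mertens_aux (n : ℕ) : ∑ p ∈ (Ioc 0 n).filter Nat.Prime, Real.log p / p ≤ th n / n + 2 * ∑ k ∈ Ioc 0 n, (1 : ℝ) / k := by
  induction n with
  | zero => simp
  | succ n ih =>
    have e1 : ∀ f : ℕ → ℝ, ∑ p ∈ (Ioc 0 (n + 1)).filter Nat.Prime, f p =
        ∑ p ∈ (Ioc 0 n).filter Nat.Prime, f p + (if (n + 1).Prime then f (n + 1) else 0) := by
      intro f
      rw [sum_filter, sum_filter, sum_Ioc_succ_top (by omega)]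
    have e2 : th (n + 1) = th n + (if (n + 1).Prime then Real.log (n + 1 : ℕ) else 0) := e1 _
    rw [e1, sum_Ioc_succ_top (by omega), e2]
    have hn1 : (0 : ℝ) < n + 1 := by positivity
    have h3 : th n / n ≤ th n / (n + 1) + 2 / (n + 1) := by
      rcases Nat.eq_zero_or_pos n with rfl | hn
      · simp [th]
      · have hn0 : (0 : ℝ) < n := by exact_mod_cast hn
        rw [← add_div, div_le_div_iff₀ hn0 hn1]
        nlinarith [th_le n]
    have h4 : (if (n + 1).Prime then Real.log ((n + 1 : ℕ) : ℝ) / ((n + 1 : ℕ) : ℝ) else 0) =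
        (if (n + 1).Prime then Real.log ((n + 1 : ℕ) : ℝ) else 0) / (n + 1) := by
      split_ifs <;> push_cast <;> simp
    rw [h4]
    push_cast
    rw [add_div, mul_add]
    have : 2 * ((1 : ℝ) / (n + 1)) = 2 / (n + 1) := by ring
    rw [this]
    linarith

lemma harm_le (n : ℕ) : ∑ k ∈ Ioc 0 n, (1 : ℝ) / k ≤ 1 + Real.log n := by
  have h := harmonic_le_one_add_log n
  rw [harmonic_eq_sum_Icc] at h
  push_cast at h
  simp only [one_div]
  exact h

lemma harm_ge (n : ℕ) : Real.log n ≤ ∑ k ∈ Ioc 0 n, (1 : ℝ) / k := by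
  have h := log_add_one_le_harmonic n
  rw [harmonic_eq_sum_Icc] at h
  push_cast at h
  simp only [one_div]
  refine le_trans ?_ h
  rcases Nat.eq_zero_or_pos n with rfl | hn
  · simp
  · have hn0 : (0 : ℝ) < n := by exact_mod_cast hn
    exact Real.log_le_log hn0 (by linarith)

lemma mertens (n : ℕ) : ∑ p ∈ (Ioc 0 n).filter Nat.Prime, Real.log p / p ≤ 4 * (1 + Real.log n) := by
  have h1 := mertens_aux n
  have h2 := harm_le n
  have h3 : th n / n ≤ 2 := div_le_of_le_mul₀ (by positivity) (by norm_num) (th_le n)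
  have h4 : 0 ≤ Real.log n := Real.log_natCast_nonneg n
  linarith

lemma gcd_sum_le (Y : ℕ) (f : ℕ → ℝ) (hf : ∀ d, 0 ≤ f d) (w : ℕ → ℝ) (hw : ∀ d, 0 ≤ w d) :
    ∑ a ∈ Ioc 0 Y, ∑ b ∈ Ioc 0 Y, f (Nat.gcd a b) * (w a * w b) ≤
      ∑ d ∈ Ioc 0 Y, f d * (∑ a ∈ (Ioc 0 Y).filter (d ∣ ·), w a) ^ 2 := by
  have h1 : ∀ a ∈ Ioc 0 Y, ∀ b ∈ Ioc 0 Y, f (Nat.gcd a b) * (w a * w b) ≤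
      ∑ d ∈ Ioc 0 Y, f d * ((if d ∣ a then w a else 0) * (if d ∣ b then w b else 0)) := by
    intro a ha b hb
    rw [mem_Ioc] at ha hb
    have hg : Nat.gcd a b ∈ Ioc 0 Y := by
      rw [mem_Ioc]
      exact ⟨Nat.gcd_pos_of_pos_left _ ha.1, (Nat.gcd_le_left _ ha.1).trans ha.2⟩
    refine le_trans ?_ (single_le_sum (f := fun d => f d * ((if d ∣ a then w a else 0) * (if d ∣ b then w b else 0))) ?_ hg)
    · simp only [if_pos (Nat.gcd_dvd_left a b), if_pos (Nat.gcd_dvd_right a b)]; exact le_rfl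
    · intro d _
      have := hf d; have := hw a; have := hw b
      positivity
  refine (sum_le_sum fun a ha => sum_le_sum (h1 a ha)).trans (le_of_eq ?_)
  have : ∀ a ∈ Ioc 0 Y, ∑ b ∈ Ioc 0 Y, ∑ d ∈ Ioc 0 Y, f d * ((if d ∣ a then w a else 0) * (if d ∣ b then w b else 0)) =
      ∑ d ∈ Ioc 0 Y, f d * ((if d ∣ a then w a else 0) * ∑ b ∈ (Ioc 0 Y).filter (d ∣ ·), w b) := by
    intro a _
    rw [sum_comm]
    refine sum_congr rfl fun d _ => ?_
    rw [sum_filter, mul_sum, mul_sum]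
  rw [sum_congr rfl this, sum_comm]
  refine sum_congr rfl fun d _ => ?_
  rw [← mul_sum, ← sum_mul, ← sum_filter, sq]

lemma gcd_sq_sum (Y : ℕ) : ∑ a ∈ Ioc 0 Y, ∑ b ∈ Ioc 0 Y, ((Nat.gcd a b : ℕ) : ℝ) ^ 2 ≤ (Y : ℝ) ^ 3 := by
  have h := gcd_sum_le Y (fun d => (d : ℝ) ^ 2) (fun d => by positivity) (fun _ => 1) (fun _ => zero_le_one)
  simp only [mul_one] at h
  refine h.trans ?_
  calc _ ≤ ∑ d ∈ Ioc 0 Y, (Y : ℝ) ^ 2 := by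
        refine sum_le_sum fun d hd => ?_
        rw [mem_Ioc] at hd
        rw [sum_const, Nat.Ioc_filter_dvd_card_eq_div, nsmul_eq_mul, mul_one, ← mul_pow]
        gcongr
        have : d * (Y / d) ≤ Y := Nat.mul_div_le _ _
        exact_mod_cast this
    _ = (Y : ℝ) ^ 3 := by simp; ring

lemma mult_sum (Q d : ℕ) (hd : 0 < d) : ∑ a ∈ (Ioc 0 Q).filter (d ∣ ·), (1 : ℝ) / a ≤ (1 / d) * ∑ k ∈ Ioc 0 Q, (1 : ℝ) / k := by
  have hd' : (d : ℝ) ≠ 0 := by exact_mod_cast hd.ne'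
  have e : ∑ a ∈ (Ioc 0 Q).filter (d ∣ ·), (1 : ℝ) / a = ∑ a ∈ (Ioc 0 Q).filter (d ∣ ·), (1 / (d : ℝ)) * (1 / ((a / d : ℕ) : ℝ)) := by
    refine sum_congr rfl fun a ha => ?_
    rw [mem_filter] at ha
    obtain ⟨k, rfl⟩ := ha.2
    rw [Nat.mul_div_cancel_left _ hd]
    push_cast
    field_simp
  rw [e, ← mul_sum]
  gcongr
  have hinj : Set.InjOn (fun a => a / d) ((Ioc 0 Q).filter (d ∣ ·) : Finset ℕ) := by
    intro a ha b hb hab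
    simp only [coe_filter, Set.mem_ofPred_eq] at ha hb
    obtain ⟨k, rfl⟩ := ha.2
    obtain ⟨l, rfl⟩ := hb.2
    simp only [Nat.mul_div_cancel_left _ hd] at hab
    rw [hab]
  rw [← sum_image (f := fun k : ℕ => (1 : ℝ) / k) hinj]
  apply sum_le_sum_of_subset_of_nonneg
  · intro k hk
    rw [mem_image] at hk
    obtain ⟨a, ha, rfl⟩ := hk
    rw [mem_filter, mem_Ioc] at ha
    obtain ⟨k, rfl⟩ := ha.2
    simp only [Nat.mul_div_cancel_left _ hd, mem_Ioc]
    have := Nat.le_mul_of_pos_left k hd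
    constructor
    · exact Nat.pos_of_mul_pos_left ha.1.1
    · omega
  · intros; positivity

def zc : ℝ := ∑' n : ℕ, 1 / (n : ℝ) ^ ((3 : ℝ) / 2)

lemma zsum : Summable fun n : ℕ => 1 / (n : ℝ) ^ ((3 : ℝ) / 2) := Real.summable_one_div_nat_rpow.2 (by norm_num)

lemma zc_nonneg : 0 ≤ zc := tsum_nonneg fun n => by positivity

lemma gcd_sqrt_sum (Q : ℕ) : ∑ a ∈ Ioc 0 Q, ∑ b ∈ Ioc 0 Q, √((Nat.gcd a b : ℕ) : ℝ) * ((1 / a : ℝ) * (1 / b)) ≤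
    zc * (1 + Real.log Q) ^ 2 := by
  have h := gcd_sum_le Q (fun d => √(d : ℝ)) (fun d => by positivity) (fun a => 1 / (a : ℝ)) (fun _ => by positivity)
  refine h.trans ?_
  have hl : 0 ≤ 1 + Real.log Q := by have := Real.log_natCast_nonneg Q; linarith
  calc _ ≤ ∑ d ∈ Ioc 0 Q, (1 / (d : ℝ) ^ ((3 : ℝ) / 2)) * (1 + Real.log Q) ^ 2 := by
        refine sum_le_sum fun d hd => ?_
        rw [mem_Ioc] at hd
        have hd' : 0 < (d : ℝ) := by exact_mod_cast hd.1
        have h1 : ∑ a ∈ (Ioc 0 Q).filter (d ∣ ·), (1 : ℝ) / a ≤ 1 / d * (1 + Real.log Q) :=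
          (mult_sum Q d hd.1).trans (by gcongr; exact harm_le Q)
        have h0 : 0 ≤ ∑ a ∈ (Ioc 0 Q).filter (d ∣ ·), (1 : ℝ) / a := sum_nonneg fun _ _ => by positivity
        calc _ ≤ √(d : ℝ) * (1 / d * (1 + Real.log Q)) ^ 2 := by gcongr
          _ = _ := by
            have e : (d : ℝ) ^ ((3 : ℝ) / 2) * √d = (d : ℝ) ^ 2 := by
              rw [Real.sqrt_eq_rpow, ← Real.rpow_add hd']
              norm_num
            have h5 : (d : ℝ) ^ ((3 : ℝ) / 2) ≠ 0 := by positivity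
            rw [mul_pow, ← mul_assoc]
            congr 1
            field_simp
            linarith
    _ = (∑ d ∈ Ioc 0 Q, (1 / (d : ℝ) ^ ((3 : ℝ) / 2))) * (1 + Real.log Q) ^ 2 := by rw [sum_mul]
    _ ≤ _ := by
        gcongr
        exact zsum.sum_le_tsum _ (fun _ _ => by positivity)

lemma diag_sum (G : Set ℕ) (Q P : ℕ) (hP : 0 < P) :
    ∑ i ∈ Ix G Q P, ∑ j ∈ (Ix G Q P).filter (fun j => j.1 = i.1), Real.log i.1 * Real.log j.1 *
      (((Nat.gcd i.2 j.2 : ℕ) : ℝ) ^ 2 / (i.2 * j.2)) ≤ 64 * P * (1 + Real.log P) ^ 2 := by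
  have hP' : 0 < (P : ℝ) := by exact_mod_cast hP
  have hlP : 0 ≤ Real.log P := Real.log_natCast_nonneg P
  have hmap : ∀ i ∈ Ix G Q P, i.1 ∈ (Ioc 0 P).filter Nat.Prime := by
    intro i hi
    rw [mem_Ix] at hi
    rw [mem_filter, mem_Ioc]
    exact ⟨hi.1.1, hi.2.1⟩
  rw [← sum_fiberwise_of_maps_to hmap]
  have key : ∀ p ∈ (Ioc 0 P).filter Nat.Prime, ∑ i ∈ (Ix G Q P).filter (fun i => i.1 = p),
      ∑ j ∈ (Ix G Q P).filter (fun j => j.1 = i.1), Real.log i.1 * Real.log j.1 *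
      (((Nat.gcd i.2 j.2 : ℕ) : ℝ) ^ 2 / (i.2 * j.2)) ≤ Real.log P * (16 * P) * (Real.log p / p) := by
    intro p hp
    rw [mem_filter, mem_Ioc] at hp
    have hp0 : 0 < (p : ℝ) := by exact_mod_cast hp.1.1
    have hlp : 0 ≤ Real.log p := Real.log_natCast_nonneg p
    have hsub : (Ix G Q P).filter (fun i => i.1 = p) ⊆ {p} ×ˢ Ioc 0 (P / p) := by
      intro i hi
      rw [mem_filter, mem_Ix] at hi
      obtain ⟨hi, rfl⟩ := hi
      rw [mem_product, mem_singleton, mem_Ioc]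
      refine ⟨rfl, hi.1.2.1, ?_⟩
      rw [Nat.le_div_iff_mul_le hi.1.1.1, mul_comm]
      exact hi.2.2.2.2.2.2
    calc _ ≤ ∑ i ∈ (Ix G Q P).filter (fun i => i.1 = p), ∑ j ∈ (Ix G Q P).filter (fun i => i.1 = p),
          Real.log p ^ 2 * (16 * (p : ℝ) ^ 2 / P ^ 2) * ((Nat.gcd i.2 j.2 : ℕ) : ℝ) ^ 2 := by
          refine sum_le_sum fun i hi => ?_
          have hip : i.1 = p := (mem_filter.1 hi).2
          rw [hip]
          refine sum_le_sum fun j hj => ?_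
          have hjp : j.1 = p := (mem_filter.1 hj).2
          have hi' := mem_Ix.1 (mem_filter.1 hi).1
          have hj' := mem_Ix.1 (mem_filter.1 hj).1
          rw [hjp]
          rw [hip] at hi'
          rw [hjp] at hj'
          have a1 : (P : ℝ) ≤ 4 * (p * i.2) := by exact_mod_cast hi'.2.2.2.2.2.1.le
          have a2 : (P : ℝ) ≤ 4 * (p * j.2) := by exact_mod_cast hj'.2.2.2.2.2.1.le
          have i0 : 0 < (i.2 : ℝ) := by exact_mod_cast hi'.1.2.1
          have j0 : 0 < (j.2 : ℝ) := by exact_mod_cast hj'.1.2.1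
          have : 1 / ((i.2 : ℝ) * j.2) ≤ 16 * (p : ℝ) ^ 2 / P ^ 2 := by
            rw [div_le_div_iff₀ (by positivity) (by positivity)]
            have : (P : ℝ) * P ≤ 4 * (p * i.2) * (4 * (p * j.2)) := by gcongr
            nlinarith
          calc Real.log p * Real.log p * (((Nat.gcd i.2 j.2 : ℕ) : ℝ) ^ 2 / (i.2 * j.2)) 
              = Real.log p ^ 2 * (1 / ((i.2 : ℝ) * j.2)) * ((Nat.gcd i.2 j.2 : ℕ) : ℝ) ^ 2 := by ring
            _ ≤ _ := by gcongr
      _ ≤ ∑ i ∈ {p} ×ˢ Ioc 0 (P / p), ∑ j ∈ {p} ×ˢ Ioc 0 (P / p),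
          Real.log p ^ 2 * (16 * (p : ℝ) ^ 2 / P ^ 2) * ((Nat.gcd i.2 j.2 : ℕ) : ℝ) ^ 2 := by
          refine (sum_le_sum fun i _ => sum_le_sum_of_subset_of_nonneg hsub fun _ _ _ => by positivity).trans ?_
          exact sum_le_sum_of_subset_of_nonneg hsub fun _ _ _ => sum_nonneg fun _ _ => by positivity
      _ = Real.log p ^ 2 * (16 * (p : ℝ) ^ 2 / P ^ 2) * ∑ a ∈ Ioc 0 (P / p), ∑ b ∈ Ioc 0 (P / p), ((Nat.gcd a b : ℕ) : ℝ) ^ 2 := by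
          simp only [sum_product, sum_singleton, ← mul_sum]
      _ ≤ Real.log p ^ 2 * (16 * (p : ℝ) ^ 2 / P ^ 2) * (P / p : ℝ) ^ 3 := by
          gcongr
          refine (gcd_sq_sum _).trans ?_
          gcongr
          exact Nat.cast_div_le
      _ = Real.log p * (16 * P) * (Real.log p / p) := by field_simp
      _ ≤ _ := by
          have : Real.log p ≤ Real.log P := Real.log_le_log hp0 (by exact_mod_cast hp.1.2)
          gcongr
  refine (sum_le_sum key).trans ?_
  rw [← mul_sum]
  calc _ ≤ Real.log P * (16 * P) * (4 * (1 + Real.log P)) := by gcongr; exact mertens P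
    _ ≤ _ := by nlinarith [mul_nonneg hP'.le hlP]

lemma off_sum (G : Set ℕ) (Q P : ℕ) (hQP : Q ≤ P) (hQ : 0 < Q) :
    ∑ i ∈ Ix G Q P, ∑ j ∈ Ix G Q P, Real.log i.1 * Real.log j.1 * √((Nat.gcd i.2 j.2 : ℕ) : ℝ) ≤
      4 * zc * P ^ 2 * (1 + Real.log P) ^ 2 := by
  set R : Finset (Σ _ : ℕ, ℕ) := (Ioc 0 Q).sigma fun r => (Ioc 0 (P / r)).filter Nat.Prime
  have hlQ : Real.log Q ≤ Real.log P := Real.log_le_log (by exact_mod_cast hQ) (by exact_mod_cast hQP)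
  have hlQ0 : 0 ≤ Real.log Q := Real.log_natCast_nonneg Q
  have hle : ∀ f : ℕ → ℕ → ℝ, (∀ p r, 0 ≤ f p r) → ∑ i ∈ Ix G Q P, f i.1 i.2 ≤ ∑ r ∈ Ioc 0 Q, ∑ p ∈ (Ioc 0 (P / r)).filter Nat.Prime, f p r := by
    intro f hf
    rw [sum_sigma' (Ioc 0 Q) (fun r => (Ioc 0 (P / r)).filter Nat.Prime) (fun r p => f p r)]
    have hinj : Set.InjOn (fun i : ℕ × ℕ => (⟨i.2, i.1⟩ : Σ _ : ℕ, ℕ)) (Ix G Q P : Finset (ℕ × ℕ)) := by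
      intro a _ b _ h
      simp only [Sigma.mk.injEq, heq_eq_eq] at h
      exact Prod.ext h.2 h.1
    rw [show ∑ i ∈ Ix G Q P, f i.1 i.2 = ∑ i ∈ Ix G Q P, (fun s : Σ _ : ℕ, ℕ => f s.2 s.1) ⟨i.2, i.1⟩ from rfl, 
      ← sum_image (f := fun s : Σ _ : ℕ, ℕ => f s.2 s.1) hinj]
    apply sum_le_sum_of_subset_of_nonneg
    · intro s hs
      rw [mem_image] at hs
      obtain ⟨i, hi, rfl⟩ := hs
      rw [mem_Ix] at hi
      rw [mem_sigma, mem_filter, mem_Ioc, mem_Ioc]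
      refine ⟨hi.1.2, ⟨hi.1.1.1, ?_⟩, hi.2.1⟩
      rw [Nat.le_div_iff_mul_le hi.1.2.1]
      exact hi.2.2.2.2.2.2
    · intros; exact hf _ _
  have hl : ∀ n : ℕ, 0 ≤ Real.log n := Real.log_natCast_nonneg
  calc _ ≤ ∑ r ∈ Ioc 0 Q, ∑ p ∈ (Ioc 0 (P / r)).filter Nat.Prime, ∑ j ∈ Ix G Q P, Real.log p * Real.log j.1 * √((Nat.gcd r j.2 : ℕ) : ℝ) := by
        apply hle (fun p r => ∑ j ∈ Ix G Q P, Real.log p * Real.log j.1 * √((Nat.gcd r j.2 : ℕ) : ℝ))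
        intro p r
        refine sum_nonneg fun j _ => ?_
        have := hl p; have := hl j.1
        positivity
    _ ≤ ∑ r ∈ Ioc 0 Q, ∑ p ∈ (Ioc 0 (P / r)).filter Nat.Prime, 
          ∑ s ∈ Ioc 0 Q, ∑ t ∈ (Ioc 0 (P / s)).filter Nat.Prime, Real.log p * Real.log t * √((Nat.gcd r s : ℕ) : ℝ) := by
        refine sum_le_sum fun r _ => sum_le_sum fun p _ => ?_
        apply hle (fun t s => Real.log p * Real.log t * √((Nat.gcd r s : ℕ) : ℝ))
        intro t s
        have := hl p; have := hl t
        positivity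
    _ = ∑ r ∈ Ioc 0 Q, ∑ s ∈ Ioc 0 Q, √((Nat.gcd r s : ℕ) : ℝ) * (th (P / r) * th (P / s)) := by
        refine sum_congr rfl fun r _ => ?_
        rw [sum_comm]
        refine sum_congr rfl fun s _ => ?_
        rw [th, th, sum_mul_sum, mul_sum]
        refine sum_congr rfl fun p _ => ?_
        rw [mul_sum]
        refine sum_congr rfl fun p _ => ?_
        ring
    _ ≤ ∑ r ∈ Ioc 0 Q, ∑ s ∈ Ioc 0 Q, 4 * P ^ 2 * (√((Nat.gcd r s : ℕ) : ℝ) * (1 / r * (1 / s))) := by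
        refine sum_le_sum fun r _ => sum_le_sum fun s _ => ?_
        have h1 : ∀ r : ℕ, th (P / r) ≤ 2 * P * (1 / r) := by
          intro r
          refine (th_le _).trans ?_
          have := @Nat.cast_div_le ℝ _ _ _ P r
          calc 2 * ((P / r : ℕ) : ℝ) ≤ 2 * (P / r : ℝ) := by gcongr
            _ = _ := by ring
        calc _ ≤ √((Nat.gcd r s : ℕ) : ℝ) * (2 * P * (1 / r) * (2 * P * (1 / s))) := by
              have := th_nonneg (P / s)
              gcongr <;> apply h1
          _ = _ := by ring
    _ = 4 * P ^ 2 * ∑ r ∈ Ioc 0 Q, ∑ s ∈ Ioc 0 Q, (√((Nat.gcd r s : ℕ) : ℝ) * (1 / r * (1 / s))) := by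
        simp only [mul_sum]
    _ ≤ 4 * P ^ 2 * (zc * (1 + Real.log Q) ^ 2) := by gcongr; exact gcd_sqrt_sum Q
    _ ≤ 4 * P ^ 2 * (zc * (1 + Real.log P) ^ 2) := by
        have := zc_nonneg
        gcongr
    _ = _ := by ring

lemma upper_sum (G : Set ℕ) (Q P : ℕ) (hQP : Q ≤ P) (hQ : 0 < Q) (T : ℕ × ℕ → ℕ × ℕ → ℝ) (A M : ℝ) (hA : 0 ≤ A) (hM : 0 ≤ M)
    (hd : ∀ i ∈ Ix G Q P, ∀ j ∈ Ix G Q P, i.1 = j.1 → T i j ≤ A * (((Nat.gcd i.2 j.2 : ℕ) : ℝ) ^ 2 / (i.2 * j.2)))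
    (ho : ∀ i ∈ Ix G Q P, ∀ j ∈ Ix G Q P, i.1 ≠ j.1 → T i j ≤ M * √((Nat.gcd i.2 j.2 : ℕ) : ℝ)) :
    ∑ i ∈ Ix G Q P, ∑ j ∈ Ix G Q P, Real.log i.1 * Real.log j.1 * T i j ≤
      (64 * A * P + 4 * zc * M * P ^ 2) * (1 + Real.log P) ^ 2 := by
  have h1 := diag_sum G Q P (by omega)
  have h2 := off_sum G Q P hQP hQ
  have hl : ∀ n : ℕ, 0 ≤ Real.log n := Real.log_natCast_nonneg
  calc _ ≤ ∑ i ∈ Ix G Q P, ∑ j ∈ Ix G Q P, ((if j.1 = i.1 then A * (Real.log i.1 * Real.log j.1 *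
      (((Nat.gcd i.2 j.2 : ℕ) : ℝ) ^ 2 / (i.2 * j.2))) else 0) + M * (Real.log i.1 * Real.log j.1 * √((Nat.gcd i.2 j.2 : ℕ) : ℝ))) := by
        refine sum_le_sum fun i hi => sum_le_sum fun j hj => ?_
        have := hl i.1; have := hl j.1
        split_ifs with h
        · calc _ ≤ Real.log i.1 * Real.log j.1 * (A * (((Nat.gcd i.2 j.2 : ℕ) : ℝ) ^ 2 / (i.2 * j.2))) := by
                gcongr; exact hd i hi j hj h.symm
            _ = A * (Real.log i.1 * Real.log j.1 * (((Nat.gcd i.2 j.2 : ℕ) : ℝ) ^ 2 / (i.2 * j.2))) := by ring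
            _ ≤ _ := le_add_of_nonneg_right (by positivity)
        · calc _ ≤ Real.log i.1 * Real.log j.1 * (M * √((Nat.gcd i.2 j.2 : ℕ) : ℝ)) := by
                gcongr; exact ho i hi j hj (Ne.symm h)
            _ = _ := by ring
    _ = A * ∑ i ∈ Ix G Q P, ∑ j ∈ (Ix G Q P).filter (fun j => j.1 = i.1), Real.log i.1 * Real.log j.1 *
      (((Nat.gcd i.2 j.2 : ℕ) : ℝ) ^ 2 / (i.2 * j.2)) + 
        M * ∑ i ∈ Ix G Q P, ∑ j ∈ Ix G Q P, Real.log i.1 * Real.log j.1 * √((Nat.gcd i.2 j.2 : ℕ) : ℝ) := by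
        simp only [sum_add_distrib, mul_sum, sum_filter]
        congr 1
        simp only [mul_ite, mul_zero]
    _ ≤ A * (64 * P * (1 + Real.log P) ^ 2) + M * (4 * zc * P ^ 2 * (1 + Real.log P) ^ 2) := by gcongr
    _ = _ := by ring

end
end SqSieve
end

section
namespace SqSieve

noncomputable section
open Finset

lemma log_quarter (x : ℝ) (hx : 1 ≤ x) : ∃ t : ℝ, 1 ≤ t ∧ t ^ 4 = x ∧ √x = t ^ 2 ∧ Real.log x ≤ 4 * t := by
  have hx0 : 0 ≤ x := by linarith
  refine ⟨√√x, ?_, ?_, ?_, ?_⟩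
  · rw [Real.one_le_sqrt, Real.one_le_sqrt]; exact hx
  · rw [show (√√x) ^ 4 = ((√√x) ^ 2) ^ 2 by ring, Real.sq_sqrt (by positivity), Real.sq_sqrt hx0]
  · rw [Real.sq_sqrt (by positivity)]
  · have e : x = (√√x) ^ 4 := by
      rw [show (√√x) ^ 4 = ((√√x) ^ 2) ^ 2 by ring, Real.sq_sqrt (by positivity), Real.sq_sqrt hx0]
    have hpos : 0 < √√x := by positivity
    conv_lhs => rw [e]
    rw [Real.log_pow]
    push_cast
    have := Real.log_le_sub_one_of_pos hpos
    linarith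

lemma theta_gap (x : ℝ) (hx : 1000 ^ 4 ≤ x) : x / 4 ≤ Chebyshev.theta x - Chebyshev.theta (x / 4) := by
  have hx1 : 1 ≤ x := by norm_num at hx; linarith
  obtain ⟨t, ht1, htx, hts, htl⟩ := log_quarter x hx1
  have h1 := Chebyshev.theta_ge' hx1
  have h2 := Chebyshev.theta_le_log4_mul_x (x := x / 4) (by linarith)
  have e4 : Real.log 4 = 2 * Real.log 2 := by
    rw [show (4 : ℝ) = 2 ^ 2 by norm_num, Real.log_pow]; norm_num
  have ht : 1000 ≤ t := by
    by_contra h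
    push Not at h
    have : t ^ 4 < 1000 ^ 4 := by gcongr
    linarith
  have h3 : Real.log (x + 2) ≤ 2 + 4 * t := by
    have : Real.log (x + 2) ≤ Real.log (3 * x) := Real.log_le_log (by linarith) (by linarith)
    rw [Real.log_mul (by norm_num) (by linarith)] at this
    have h5 : Real.log 3 ≤ 2 := by have := Real.log_le_sub_one_of_pos (show (0:ℝ) < 3 by norm_num); linarith
    linarith
  have h4 : 2 * √x * Real.log x ≤ 8 * t ^ 3 := by
    rw [hts]
    calc 2 * t ^ 2 * Real.log x ≤ 2 * t ^ 2 * (4 * t) := by gcongr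
      _ = _ := by ring
  have l1 := Real.log_two_gt_d9
  have l2 := Real.log_two_lt_d9
  rw [e4] at h2
  have h6 : (Real.log 2) * x ≥ 0.69 * x := by nlinarith
  have h7 : 8 * t ^ 3 ≤ 0.008 * x := by rw [← htx]; nlinarith [pow_pos (by linarith : 0 < t) 3]
  have h8 : t ≤ 0.000001 * x := by
    rw [← htx]
    have : (1000:ℝ) ^ 3 ≤ t ^ 3 := by gcongr
    nlinarith
  nlinarith

lemma th_div (P r : ℕ) : th (P / r) = Chebyshev.theta ((P : ℝ) / r) := by
  rw [th_eq, Chebyshev.theta_eq_theta_coe_floor ((P : ℝ) / r), Nat.floor_div_eq_div]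

lemma sum_log_primeFactors (N0 : ℕ) (hN0 : N0 ≠ 0) : ∑ p ∈ N0.primeFactors, Real.log p ≤ Real.log N0 := by
  have : (∏ p ∈ N0.primeFactors, p) ≤ N0 := Nat.le_of_dvd (Nat.pos_of_ne_zero hN0) (Nat.prod_primeFactors_dvd N0)
  have h0 : (0 : ℝ) < ((∏ p ∈ N0.primeFactors, p : ℕ) : ℝ) := by
    exact_mod_cast prod_pos fun p hp => (Nat.prime_of_mem_primeFactors hp).pos
  rw [← Real.log_prod]
  · rw [← Nat.cast_prod]
    exact Real.log_le_log h0 (by exact_mod_cast this)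
  · intro p hp
    exact_mod_cast (Nat.prime_of_mem_primeFactors hp).ne_zero

/-- good primes -/
def GG (z0 N0 : ℕ) : Set ℕ := {ℓ | ℓ.Prime ∧ z0 < ℓ ∧ ¬ ℓ ∣ N0}

lemma fiber_lower (z0 N0 Q P r : ℕ) (hN0 : N0 ≠ 0) (hr : 0 < r) (hrQ : r ≤ Q) (hsq : Squarefree r) (hg : ∀ ℓ ∈ r.primeFactors, ℓ ∈ GG z0 N0)
    (hX : 1000 ^ 4 ≤ (P : ℝ) / r) (hz : 4 * (z0 + 1) * r ≤ P) (hL : Real.log N0 ≤ (P : ℝ) / r / 8) :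
    (P : ℝ) / r / 8 ≤ ∑ i ∈ (Ix (GG z0 N0) Q P).filter (fun i => i.2 = r), Real.log i.1 := by
  have hgap := theta_gap _ hX
  rw [div_div, show (r : ℝ) * 4 = ((r * 4 : ℕ) : ℝ) by push_cast; ring, ← th_div, ← th_div] at hgap
  have hle : P / (r * 4) ≤ P / r := Nat.div_le_div_left (by omega) hr
  have e1 : th (P / r) - th (P / (r * 4)) = ∑ p ∈ (Ioc (P / (r * 4)) (P / r)).filter Nat.Prime, Real.log p := by
    rw [th, th, sum_filter, sum_filter, sum_filter, sub_eq_iff_eq_add, add_comm, sum_Ioc_consecutive _ (Nat.zero_le _) hle]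
  have hsub : (Ioc (P / (r * 4)) (P / r)).filter Nat.Prime ⊆
      ((Ix (GG z0 N0) Q P).filter (fun i => i.2 = r)).image Prod.fst ∪ N0.primeFactors := by
    intro p hp
    rw [mem_filter, mem_Ioc] at hp
    rw [mem_union]
    by_cases hd : p ∣ N0
    · right; exact Nat.mem_primeFactors.2 ⟨hp.2, hd, hN0⟩
    · left
      rw [mem_image]
      refine ⟨(p, r), ?_, rfl⟩
      rw [mem_filter, mem_Ix]
      have h1 : p * r ≤ P := (Nat.le_div_iff_mul_le hr).1 hp.1.2
      have h2 : P < p * (r * 4) := (Nat.div_lt_iff_lt_mul (by omega)).1 hp.1.1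
      have h3 : z0 + 1 ≤ P / (r * 4) := by
        rw [Nat.le_div_iff_mul_le (by omega)]; linarith
      refine ⟨⟨⟨⟨hp.2.pos, ?_⟩, hr, hrQ⟩, hp.2, ⟨hp.2, by omega, hd⟩, hsq, hg, by linarith, h1⟩, rfl⟩
      exact hp.1.2.trans (Nat.div_le_self _ _)
  have hl : ∀ n : ℕ, 0 ≤ Real.log n := Real.log_natCast_nonneg
  have e2 : ∑ p ∈ (Ioc (P / (r * 4)) (P / r)).filter Nat.Prime, Real.log p ≤
      ∑ i ∈ (Ix (GG z0 N0) Q P).filter (fun i => i.2 = r), Real.log i.1 + Real.log N0 := by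
    calc _ ≤ ∑ p ∈ ((Ix (GG z0 N0) Q P).filter (fun i => i.2 = r)).image Prod.fst ∪ N0.primeFactors, Real.log p :=
          sum_le_sum_of_subset_of_nonneg hsub fun p _ _ => hl p
      _ ≤ ∑ p ∈ ((Ix (GG z0 N0) Q P).filter (fun i => i.2 = r)).image Prod.fst, Real.log p + ∑ p ∈ N0.primeFactors, Real.log p := by
          rw [← sum_union_inter]
          exact le_add_of_nonneg_right (sum_nonneg fun p _ => hl p)
      _ ≤ _ := by
          gcongr
          · rw [sum_image]
            intro a ha b hb hab
            simp only [coe_filter, Set.mem_ofPred_eq] at ha hb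
            exact Prod.ext hab (ha.2.trans hb.2.symm)
          · exact sum_log_primeFactors N0 hN0
  have e3 : (P:ℝ)/((r*4:ℕ):ℝ) = (P:ℝ)/r/4 := by push_cast; rw [div_div]
  rw [e3] at hgap
  linarith

lemma prod_ge (s : Finset ℕ) (b k : ℕ → ℝ) (h : ∀ ℓ ∈ s, 1 - k ℓ ≤ b ℓ) (h1 : ∀ ℓ ∈ s, 0 ≤ k ℓ ∧ k ℓ ≤ 1) :
    1 - ∑ ℓ ∈ s, k ℓ ≤ ∏ ℓ ∈ s, b ℓ ∧ 0 ≤ ∏ ℓ ∈ s, b ℓ := by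
  have h0 : 0 ≤ ∏ ℓ ∈ s, b ℓ := prod_nonneg fun ℓ hℓ => by linarith [h ℓ hℓ, (h1 ℓ hℓ).2]
  refine ⟨?_, h0⟩
  clear h0
  induction s using Finset.induction_on with
  | empty => simp
  | insert a s ha ih =>
    have ih' := ih (fun ℓ hℓ => h ℓ (mem_insert_of_mem hℓ)) (fun ℓ hℓ => h1 ℓ (mem_insert_of_mem hℓ))
    have hP : 0 ≤ ∏ ℓ ∈ s, b ℓ := prod_nonneg fun ℓ hℓ => by
      linarith [h ℓ (mem_insert_of_mem hℓ), (h1 ℓ (mem_insert_of_mem hℓ)).2]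
    rw [sum_insert ha, prod_insert ha]
    have ha1 := h a (mem_insert_self _ _)
    have ha2 := h1 a (mem_insert_self _ _)
    have hS : 0 ≤ ∑ ℓ ∈ s, k ℓ := sum_nonneg fun ℓ hℓ => (h1 ℓ (mem_insert_of_mem hℓ)).1
    have : (1 - k a) * ∏ ℓ ∈ s, b ℓ ≤ b a * ∏ ℓ ∈ s, b ℓ := by gcongr
    have h5 : (1 - k a) * (1 - ∑ ℓ ∈ s, k ℓ) ≤ (1 - k a) * ∏ ℓ ∈ s, b ℓ :=
      mul_le_mul_of_nonneg_left ih' (by linarith)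
    nlinarith [mul_nonneg ha2.1 hS]

open Classical in
def RR (z0 N0 Q : ℕ) : Finset ℕ := (Ioc 0 Q).filter fun r => Squarefree r ∧ ∀ ℓ ∈ r.primeFactors, ℓ ∈ GG z0 N0

lemma mem_RR {z0 N0 Q r : ℕ} : r ∈ RR z0 N0 Q ↔ (0 < r ∧ r ≤ Q) ∧ Squarefree r ∧ ∀ ℓ ∈ r.primeFactors, ℓ ∈ GG z0 N0 := by
  simp [RR]

lemma prod_bad (B : Finset ℕ) (hB : ∀ ℓ ∈ B, 0 < ℓ) : ∏ ℓ ∈ B, (1 + 1 / (ℓ : ℝ)) ≤ B.card + 1 := by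
  induction B using Finset.induction_on_max with
  | empty => simp
  | insert a s hs ih =>
    have ha : a ∉ s := fun h => lt_irrefl _ (hs a h)
    rw [prod_insert ha, card_insert_of_notMem ha]
    have ih' := ih fun ℓ hℓ => hB ℓ (mem_insert_of_mem hℓ)
    have hcard : s.card + 1 ≤ a := by
      have : s ⊆ Ioo 0 a := fun ℓ hℓ => mem_Ioo.2 ⟨hB ℓ (mem_insert_of_mem hℓ), hs ℓ hℓ⟩
      have h2 := card_le_card this
      rw [Nat.card_Ioo] at h2
      have := hB a (mem_insert_self _ _)
      omega
    have ha0 : 0 < (a : ℝ) := by exact_mod_cast hB a (mem_insert_self _ _)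
    have hcard' : (s.card : ℝ) + 1 ≤ a := by exact_mod_cast hcard
    calc (1 + 1 / (a : ℝ)) * ∏ ℓ ∈ s, (1 + 1 / (ℓ : ℝ)) ≤ (1 + 1 / (a : ℝ)) * (s.card + 1) := by gcongr
      _ = (s.card + 1) + (s.card + 1) / a := by ring
      _ ≤ (s.card + 1) + 1 := by
          gcongr
          rw [div_le_one ha0]; exact hcard'
      _ = _ := by push_cast; ring

lemma S_lower (z0 N0 Q : ℕ) (hN0 : N0 ≠ 0) (hQ : 0 < Q) :
    Real.log Q ≤ zc * (z0 + 2 + N0.primeFactors.card) * ∑ r ∈ RR z0 N0 Q, (1 : ℝ) / r := by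
  classical
  set B : Finset ℕ := (range (z0 + 1) ∪ N0.primeFactors).filter Nat.Prime with hBdef
  have hBcard : (B.card : ℝ) + 1 ≤ z0 + 2 + N0.primeFactors.card := by
    have h1 : B.card ≤ (z0 + 1) + N0.primeFactors.card := by
      refine (card_filter_le _ _).trans ((card_union_le _ _).trans ?_)
      rw [card_range]
    have : (B.card : ℝ) ≤ (z0 + 1) + N0.primeFactors.card := by exact_mod_cast h1
    linarith
  set W := (Ioc 0 Q) ×ˢ (B.powerset ×ˢ RR z0 N0 Q) with hW
  set g : ℕ × (Finset ℕ × ℕ) → ℕ := fun w => w.1 ^ 2 * ((∏ ℓ ∈ w.2.1, ℓ) * w.2.2) with hg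
  have hcov : Ioc 0 Q ⊆ W.image g := by
    intro n hn
    rw [mem_Ioc] at hn
    obtain ⟨a, b, ha, hb, hab, hsq⟩ := Nat.sq_mul_squarefree_of_pos hn.1
    rw [mem_image]
    set r := ∏ ℓ ∈ a.primeFactors \ B, ℓ with hr
    have hra : r ∣ a := by
      rw [← Nat.prod_primeFactors_of_squarefree hsq]
      exact prod_dvd_prod_of_subset _ _ _ sdiff_subset
    have hrsq : Squarefree r := hsq.squarefree_of_dvd hra
    have haN : a ≤ n := by rw [← hab]; exact Nat.le_mul_of_pos_left _ (by positivity)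
    have hra' := Nat.le_of_dvd ha hra
    refine ⟨(b, (a.primeFactors ∩ B, r)), ?_, ?_⟩
    · rw [hW, mem_product, mem_product, mem_powerset, mem_RR, mem_Ioc]
      refine ⟨⟨hb, ?_⟩, inter_subset_right, ⟨Nat.pos_of_dvd_of_pos hra ha, hra'.trans (haN.trans hn.2)⟩, hrsq, ?_⟩
      · have : b ≤ b ^ 2 * a := by nlinarith [Nat.mul_pos hb ha]
        omega
      · intro ℓ hℓ
        have hp := Nat.prime_of_mem_primeFactors hℓ
        have hd := Nat.dvd_of_mem_primeFactors hℓ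
        rw [hr, hp.prime.dvd_finset_prod_iff] at hd
        obtain ⟨q, hq, hdq⟩ := hd
        rw [mem_sdiff] at hq
        have hqp := Nat.prime_of_mem_primeFactors hq.1
        have heq : ℓ = q := (Nat.prime_dvd_prime_iff_eq hp hqp).1 hdq
        subst heq
        have hnB := hq.2
        rw [hBdef, mem_filter, mem_union, mem_range, Nat.mem_primeFactors] at hnB
        refine ⟨hp, ?_, ?_⟩
        · by_contra hc; exact hnB ⟨Or.inl (by omega), hp⟩
        · intro hc; exact hnB ⟨Or.inr ⟨hp, hc, hN0⟩, hp⟩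
    · simp only [hg, hr]
      rw [prod_inter_mul_prod_sdiff, Nat.prod_primeFactors_of_squarefree hsq, hab]
  have hfin : ∑ w ∈ W, (1 : ℝ) / g w = (∑ b ∈ Ioc 0 Q, 1 / (b : ℝ) ^ 2) * (∏ ℓ ∈ B, (1 + 1 / (ℓ : ℝ))) * ∑ r ∈ RR z0 N0 Q, (1 : ℝ) / r := by
    rw [hW, sum_product, mul_assoc, sum_mul]
    refine sum_congr rfl fun b _ => ?_
    rw [sum_product, prod_one_add, sum_mul_sum, mul_sum]
    refine sum_congr rfl fun s _ => ?_
    rw [mul_sum]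
    refine sum_congr rfl fun r _ => ?_
    simp only [hg]
    push_cast
    rw [prod_div_distrib, prod_const_one]
    simp only [one_div, mul_inv]
  have hSnn : 0 ≤ ∑ r ∈ RR z0 N0 Q, (1 : ℝ) / r := sum_nonneg fun _ _ => by positivity
  calc Real.log Q ≤ ∑ k ∈ Ioc 0 Q, (1 : ℝ) / k := harm_ge Q
    _ ≤ ∑ k ∈ W.image g, (1 : ℝ) / k := sum_le_sum_of_subset_of_nonneg hcov fun _ _ _ => by positivity
    _ ≤ ∑ w ∈ W, (1 : ℝ) / g w := sum_image_le_of_nonneg (f := fun k : ℕ => (1 : ℝ) / k) (fun _ _ => by positivity)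
    _ = _ := hfin
    _ ≤ _ := by
      gcongr
      · have := zc_nonneg; exact this
      · calc _ ≤ ∑ b ∈ Ioc 0 Q, 1 / (b : ℝ) ^ ((3 : ℝ) / 2) := by
              refine sum_le_sum fun b hb => ?_
              have hb1 : (1 : ℝ) ≤ b := by exact_mod_cast (mem_Ioc.1 hb).1
              have hb0 : (0 : ℝ) < b := by linarith
              apply one_div_le_one_div_of_le (by positivity)
              rw [← Real.rpow_natCast]
              exact Real.rpow_le_rpow_of_exponent_le hb1 (by norm_num)
          _ ≤ zc := zsum.sum_le_tsum _ (fun _ _ => by positivity)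
      · exact (prod_bad B fun ℓ hℓ => (mem_filter.1 hℓ).2.pos).trans hBcard

end
end SqSieve
end

section
namespace SqSieve

noncomputable section
open Finset

lemma z0_exists (K0 : ℝ) (hK0 : 0 ≤ K0) : ∃ z0 : ℕ, (∀ ℓ : ℕ, z0 < ℓ → K0 / √ℓ ≤ 1 / 2) ∧
    ∀ t : Finset ℕ, (∀ ℓ ∈ t, z0 < ℓ) → ∑ ℓ ∈ t, K0 / √ℓ * (1 / ℓ) ≤ 1 / 2 := by
  obtain ⟨s, hs⟩ := summable_iff_vanishing_norm.1 zsum (1 / (2 * (K0 + 1))) (by positivity)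
  refine ⟨s.sup id + ⌈4 * K0 ^ 2⌉₊, ?_, ?_⟩
  · intro ℓ hℓ
    have h1 : 4 * K0 ^ 2 ≤ ℓ := (Nat.le_ceil _).trans (by exact_mod_cast (by omega))
    have h0 : (0 : ℝ) < √ℓ := Real.sqrt_pos.2 (by exact_mod_cast (by omega))
    rw [div_le_iff₀ h0]
    have : 2 * K0 ≤ √ℓ := by apply Real.le_sqrt_of_sq_le; linarith
    linarith
  · intro t ht
    have hd : Disjoint t s := by
      rw [Finset.disjoint_left]
      intro a ha has
      have h1 := ht a ha
      have h2 : a ≤ s.sup id := Finset.le_sup (f := id) has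
      omega
    have h := hs t hd
    have h2 : ∑ ℓ ∈ t, 1 / (ℓ : ℝ) ^ ((3 : ℝ) / 2) ≤ 1 / (2 * (K0 + 1)) := (Real.le_norm_self _).trans h.le
    have e : ∑ ℓ ∈ t, K0 / √ℓ * (1 / (ℓ : ℝ)) = K0 * ∑ ℓ ∈ t, 1 / (ℓ : ℝ) ^ ((3 : ℝ) / 2) := by
      rw [mul_sum]
      refine sum_congr rfl fun ℓ hℓ => ?_
      have h0 : (0 : ℝ) < ℓ := by have := ht ℓ hℓ; exact_mod_cast (by omega)
      rw [show (3 : ℝ) / 2 = 1 / 2 + 1 by norm_num, Real.rpow_add h0, Real.rpow_one, ← Real.sqrt_eq_rpow]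
      field_simp
    rw [e]
    calc K0 * ∑ ℓ ∈ t, 1 / (ℓ : ℝ) ^ ((3 : ℝ) / 2) ≤ K0 * (1 / (2 * (K0 + 1))) := by gcongr
      _ ≤ 1 / 2 := by
        rw [mul_one_div, div_le_div_iff₀ (by positivity) (by norm_num)]; linarith

lemma RR_dvd_sum (z0 N0 Q ℓ : ℕ) (hℓ : ℓ.Prime) :
    ∑ r ∈ (RR z0 N0 Q).filter (fun r => ℓ ∣ r), (1 : ℝ) / r ≤ (1 / ℓ) * ∑ r ∈ RR z0 N0 Q, (1 : ℝ) / r := by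
  have hsub : (RR z0 N0 Q).filter (fun r => ℓ ∣ r) ⊆ (RR z0 N0 Q).image (fun r => ℓ * r) := by
    intro r hr
    rw [mem_filter, mem_RR] at hr
    obtain ⟨⟨⟨h0, hQ⟩, hsq, hg⟩, k, rfl⟩ := hr
    rw [mem_image]
    refine ⟨k, ?_, rfl⟩
    rw [mem_RR]
    have hk : 0 < k := Nat.pos_of_mul_pos_left h0
    refine ⟨⟨hk, (Nat.le_mul_of_pos_left k hℓ.pos).trans hQ⟩, hsq.squarefree_of_dvd (Dvd.intro_left _ rfl), ?_⟩
    intro q hq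
    exact hg q (Nat.primeFactors_mono (Dvd.intro_left _ rfl) h0.ne' hq)
  calc _ ≤ ∑ r ∈ (RR z0 N0 Q).image (fun r => ℓ * r), (1 : ℝ) / r :=
        sum_le_sum_of_subset_of_nonneg hsub fun _ _ _ => by positivity
    _ = ∑ r ∈ RR z0 N0 Q, (1 : ℝ) / ((ℓ * r : ℕ) : ℝ) := by
        rw [sum_image]
        intro a _ b _ hab
        exact Nat.eq_of_mul_eq_mul_left hℓ.pos hab
    _ = _ := by
        rw [mul_sum]
        refine sum_congr rfl fun r _ => ?_
        push_cast
        simp only [one_div, mul_inv]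

lemma RR_beta (K0 : ℝ) (hK0 : 0 ≤ K0) (z0 N0 Q : ℕ)
    (hz1 : ∀ ℓ : ℕ, z0 < ℓ → K0 / √ℓ ≤ 1 / 2)
    (hz2 : ∀ t : Finset ℕ, (∀ ℓ ∈ t, z0 < ℓ) → ∑ ℓ ∈ t, K0 / √ℓ * (1 / ℓ) ≤ 1 / 2)
    (β : ℕ → ℝ) (hβ : ∀ ℓ ∈ GG z0 N0, 1 - K0 / √ℓ ≤ β ℓ) :
    (1 / 2) * ∑ r ∈ RR z0 N0 Q, (1 : ℝ) / r ≤ ∑ r ∈ RR z0 N0 Q, (1 : ℝ) / r * ∏ ℓ ∈ r.primeFactors, β ℓ := by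
  classical
  set S := ∑ r ∈ RR z0 N0 Q, (1 : ℝ) / r with hS
  have hSnn : 0 ≤ S := sum_nonneg fun _ _ => by positivity
  set t := (range (Q + 1)).filter (fun ℓ => ℓ ∈ GG z0 N0) with ht
  have h1 : ∀ r ∈ RR z0 N0 Q, (1 : ℝ) / r - ∑ ℓ ∈ t, (if ℓ ∣ r then K0 / √ℓ * (1 / r) else 0) ≤
      (1 : ℝ) / r * ∏ ℓ ∈ r.primeFactors, β ℓ := by
    intro r hr
    rw [mem_RR] at hr
    have hp := (prod_ge r.primeFactors β (fun ℓ => K0 / √ℓ) (fun ℓ hℓ => hβ ℓ (hr.2.2 ℓ hℓ))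
      (fun ℓ hℓ => ⟨by positivity, (hz1 ℓ (hr.2.2 ℓ hℓ).2.1).trans (by norm_num)⟩)).1
    have h2 : ∑ ℓ ∈ r.primeFactors, K0 / √ℓ ≤ ∑ ℓ ∈ t, (if ℓ ∣ r then K0 / √ℓ else 0) := by
      rw [← sum_filter]
      refine sum_le_sum_of_subset_of_nonneg ?_ fun _ _ _ => by positivity
      intro ℓ hℓ
      rw [mem_filter, ht, mem_filter, mem_range]
      have hd := Nat.dvd_of_mem_primeFactors hℓ
      have := Nat.le_of_dvd hr.1.1 hd
      exact ⟨⟨by omega, hr.2.2 ℓ hℓ⟩, hd⟩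
    have h3 : ∑ ℓ ∈ t, (if ℓ ∣ r then K0 / √ℓ * (1 / r) else 0) = (1 / r) * ∑ ℓ ∈ t, (if ℓ ∣ r then K0 / √ℓ else 0) := by
      rw [mul_sum]
      refine sum_congr rfl fun ℓ _ => ?_
      split_ifs <;> ring
    rw [h3]
    have h4 : (0:ℝ) ≤ 1 / r := by positivity
    calc (1:ℝ)/r - (1 / r) * ∑ ℓ ∈ t, (if ℓ ∣ r then K0 / √ℓ else 0) = (1 / r) * (1 - ∑ ℓ ∈ t, (if ℓ ∣ r then K0 / √ℓ else 0)) := by ring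
      _ ≤ _ := by
        apply mul_le_mul_of_nonneg_left _ h4
        linarith
  have h5 : ∑ r ∈ RR z0 N0 Q, ∑ ℓ ∈ t, (if ℓ ∣ r then K0 / √ℓ * (1 / (r:ℝ)) else 0) ≤ S / 2 := by
    rw [sum_comm]
    calc _ ≤ ∑ ℓ ∈ t, K0 / √ℓ * (1 / ℓ) * S := by
          refine sum_le_sum fun ℓ hℓ => ?_
          rw [ht, mem_filter] at hℓ
          rw [← sum_filter, ← mul_sum, mul_assoc]
          have := RR_dvd_sum z0 N0 Q ℓ hℓ.2.1
          gcongr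
      _ = (∑ ℓ ∈ t, K0 / √ℓ * (1 / ℓ)) * S := by rw [sum_mul]
      _ ≤ 1 / 2 * S := by
          gcongr
          exact hz2 t fun ℓ hℓ => (mem_filter.1 hℓ).2.2.1
      _ = _ := by ring
  have h6 := sum_le_sum h1
  rw [sum_sub_distrib] at h6
  linarith

lemma card_pf (N0 : ℕ) (hN0 : N0 ≠ 0) : (N0.primeFactors.card : ℝ) * Real.log 2 ≤ Real.log N0 := by
  refine le_trans ?_ (sum_log_primeFactors N0 hN0)
  rw [← nsmul_eq_mul]
  refine card_nsmul_le_sum _ _ _ fun p hp => ?_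
  have : (2:ℝ) ≤ p := by exact_mod_cast (Nat.prime_of_mem_primeFactors hp).two_le
  exact Real.log_le_log (by norm_num) this

theorem lower_sum (K0 K1 : ℝ) (hK0 : 0 ≤ K0) (hK1 : 0 ≤ K1) : ∃ z0 : ℕ, ∃ c : ℝ, 0 < c ∧ ∃ C1 : ℝ, 0 < C1 ∧ ∃ Q0 : ℕ, 0 < Q0 ∧
    ∀ N0 : ℕ, N0 ≠ 0 → ∀ T : ℝ, Real.log 2 ≤ T → Real.log N0 ≤ K1 * T → ∀ Q : ℕ, Q0 ≤ Q → C1 * T ≤ (Q:ℝ) ^ 7 →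
    ∀ β : ℕ → ℝ, (∀ ℓ ∈ GG z0 N0, 1 - K0 / √ℓ ≤ β ℓ) →
    c * Q ^ 8 * Real.log Q / T ≤ ∑ i ∈ Ix (GG z0 N0) Q (Q ^ 8), Real.log i.1 * (β i.1 * ∏ ℓ ∈ i.2.primeFactors, β ℓ) := by
  obtain ⟨z0, hz1, hz2⟩ := z0_exists K0 hK0
  have hlog2 : 0 < Real.log 2 := Real.log_pos (by norm_num)
  have hzc := zc_nonneg
  refine ⟨z0, Real.log 2 / (32 * (zc + 1) * (z0 + 2 + K1)), by positivity, 8 * K1 + 1, by positivity, 1000 + 4 * (z0 + 1), by omega, ?_⟩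
  intro N0 hN0 T hT hNT Q hQ hC β hβ
  have hT0 : 0 < T := by linarith
  have hQ0 : 0 < Q := by omega
  have hQr : (0:ℝ) < Q := by exact_mod_cast hQ0
  set S := ∑ r ∈ RR z0 N0 Q, (1 : ℝ) / r with hS
  have hSnn : 0 ≤ S := sum_nonneg fun _ _ => by positivity
  have hmaps : ∀ i ∈ Ix (GG z0 N0) Q (Q ^ 8), i.2 ∈ RR z0 N0 Q := by
    intro i hi
    rw [mem_Ix] at hi
    rw [mem_RR]
    exact ⟨hi.1.2, hi.2.2.2.1, hi.2.2.2.2.1⟩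
  rw [← sum_fiberwise_of_maps_to hmaps]
  have hfib : ∀ r ∈ RR z0 N0 Q, (Q:ℝ) ^ 8 / 16 * ((1 : ℝ) / r * ∏ ℓ ∈ r.primeFactors, β ℓ) ≤
      ∑ i ∈ (Ix (GG z0 N0) Q (Q ^ 8)).filter (fun i => i.2 = r), Real.log i.1 * (β i.1 * ∏ ℓ ∈ i.2.primeFactors, β ℓ) := by
    intro r hr
    rw [mem_RR] at hr
    obtain ⟨⟨hr0, hrQ⟩, hsq, hg⟩ := hr
    have hr0' : (0:ℝ) < r := by exact_mod_cast hr0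
    have hrQ' : (r:ℝ) ≤ Q := by exact_mod_cast hrQ
    have hPr : (Q:ℝ) ^ 7 ≤ ((Q ^ 8 : ℕ) : ℝ) / r := by
      rw [le_div_iff₀ hr0']; push_cast
      calc (Q:ℝ) ^ 7 * r ≤ (Q:ℝ) ^ 7 * Q := by gcongr
        _ = _ := by ring
    have hprod := (prod_ge r.primeFactors β (fun ℓ => K0 / √ℓ) (fun ℓ hℓ => hβ ℓ (hg ℓ hℓ))
      (fun ℓ hℓ => ⟨by positivity, (hz1 ℓ (hg ℓ hℓ).2.1).trans (by norm_num)⟩)).2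
    have hQ1000 : (1000:ℝ) ≤ Q := by exact_mod_cast (by omega)
    have hfl := fiber_lower z0 N0 Q (Q ^ 8) r hN0 hr0 hrQ hsq hg ?_ ?_ ?_
    · calc (Q:ℝ) ^ 8 / 16 * ((1 : ℝ) / r * ∏ ℓ ∈ r.primeFactors, β ℓ)
          = (((Q ^ 8 : ℕ) : ℝ) / r / 8) * (1 / 2 * ∏ ℓ ∈ r.primeFactors, β ℓ) := by push_cast; field_simp; ring
        _ ≤ (∑ i ∈ (Ix (GG z0 N0) Q (Q ^ 8)).filter (fun i => i.2 = r), Real.log i.1) * (1 / 2 * ∏ ℓ ∈ r.primeFactors, β ℓ) := by gcongr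
        _ ≤ _ := by
          rw [sum_mul]
          refine sum_le_sum fun i hi => ?_
          rw [mem_filter, mem_Ix] at hi
          have hb := hβ i.1 hi.1.2.2.1
          have hk := hz1 i.1 hi.1.2.2.1.2.1
          rw [hi.2]
          have := Real.log_natCast_nonneg i.1
          gcongr
          linarith
    · calc (1000:ℝ) ^ 4 ≤ 1000 ^ 7 := by norm_num
        _ ≤ (Q:ℝ) ^ 7 := by gcongr
        _ ≤ _ := hPr
    · calc 4 * (z0 + 1) * r ≤ Q * Q := Nat.mul_le_mul (by omega) hrQ
        _ = Q ^ 2 := by ring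
        _ ≤ Q ^ 8 := Nat.pow_le_pow_right hQ0 (by norm_num)
    · have : (8 * K1 + 1) * T = 8 * (K1 * T) + T := by ring
      linarith
  have hRB := RR_beta K0 hK0 z0 N0 Q hz1 hz2 β hβ
  have hSl := S_lower z0 N0 Q hN0 hQ0
  have hcard := card_pf N0 hN0
  have h1 : Real.log Q * Real.log 2 ≤ (zc + 1) * (z0 + 2 + K1) * T * S := by
    have h2 : ((z0:ℝ) + 2 + N0.primeFactors.card) * Real.log 2 ≤ (z0 + 2 + K1) * T := by
      have : ((z0:ℝ) + 2) * Real.log 2 ≤ (z0 + 2) * T := by gcongr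
      nlinarith
    calc Real.log Q * Real.log 2 ≤ (zc * (z0 + 2 + N0.primeFactors.card) * S) * Real.log 2 := by gcongr
      _ = zc * ((z0 + 2 + N0.primeFactors.card) * Real.log 2) * S := by ring
      _ ≤ (zc + 1) * ((z0 + 2 + K1) * T) * S := by gcongr; linarith
      _ = _ := by ring
  calc _ ≤ (Q:ℝ) ^ 8 / 32 * S := by
        rw [div_le_iff₀ hT0]
        rw [show Real.log 2 / (32 * (zc + 1) * (z0 + 2 + K1)) * (Q:ℝ) ^ 8 * Real.log Q = (Q:ℝ) ^ 8 / 32 * ((Real.log Q * Real.log 2) / ((zc + 1) * (z0 + 2 + K1))) by field_simp]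
        rw [mul_assoc]
        gcongr
        rw [div_le_iff₀ (by positivity)]
        linarith
    _ = (Q:ℝ) ^ 8 / 16 * (1 / 2 * S) := by ring
    _ ≤ (Q:ℝ) ^ 8 / 16 * ∑ r ∈ RR z0 N0 Q, (1 : ℝ) / r * ∏ ℓ ∈ r.primeFactors, β ℓ := by gcongr
    _ ≤ _ := by
        rw [mul_sum]
        exact sum_le_sum hfib

end
end SqSieve
end

section
namespace SqSieve

noncomputable section
open Finset

structure LocFam (G : Set ℕ) (K0 : ℝ) (Sq : ℤ → ℤ → Prop) (b : ℕ → ℤ → ℤ → ℝ) : Prop where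
  prime : ∀ ℓ ∈ G, ℓ.Prime
  per : ∀ ℓ ∈ G, Per2 ℓ (fun x y => (b ℓ x y : ℂ))
  abs_le : ∀ ℓ ∈ G, ∀ x y, |b ℓ x y| ≤ 1
  sq : ∀ ℓ ∈ G, ∀ x y, Sq x y → 1 - K0 / √ℓ ≤ b ℓ x y
  mean : ∀ ℓ ∈ G, ∀ y : ℤ, ¬ (ℓ : ℤ) ∣ y → avg ℓ (fun x => (b ℓ x y : ℂ)) = 0
  LN : ∀ ℓ ∈ G, ∀ h, LNv ℓ (fun x y => (b ℓ x y : ℂ)) h ≤ 1 / ℓ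
  hat : ∀ ℓ ∈ G, ∀ h k, ‖hatv ℓ (fun x y => (b ℓ x y : ℂ)) h k‖ ≤ K0 / ℓ

open Classical in
def cc (b : ℕ → ℤ → ℤ → ℝ) (Dl : Finset ℕ) (ℓ : ℕ) (x y : ℤ) : ℂ :=
  if ℓ ∈ Dl then (b ℓ x y : ℂ) else (b ℓ x y : ℂ) * (b ℓ x y : ℂ)

section
variable {G : Set ℕ} {K0 : ℝ} {Sq : ℤ → ℤ → Prop} {b : ℕ → ℤ → ℤ → ℝ}

lemma LocFam.normb (hF : LocFam G K0 Sq b) {ℓ : ℕ} (hℓ : ℓ ∈ G) (x y : ℤ) : ‖(b ℓ x y : ℂ)‖ ≤ 1 := by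
  rw [Complex.norm_real]; exact hF.abs_le ℓ hℓ x y

lemma LocFam.cc_per (hF : LocFam G K0 Sq b) (Dl : Finset ℕ) {ℓ : ℕ} (hℓ : ℓ ∈ G) : Per2 ℓ (cc b Dl ℓ) := by
  have h := hF.per ℓ hℓ
  refine ⟨fun y x => ?_, fun x y => ?_⟩
  · have := h.1 y x
    simp only [cc] at this ⊢
    rw [this]
  · have := h.2 x y
    simp only [cc] at this ⊢
    rw [this]

lemma LocFam.cc_norm (hF : LocFam G K0 Sq b) (Dl : Finset ℕ) {ℓ : ℕ} (hℓ : ℓ ∈ G) (x y : ℤ) : ‖cc b Dl ℓ x y‖ ≤ 1 := by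
  have := hF.normb hℓ x y
  unfold cc
  split_ifs
  · exact this
  · rw [norm_mul]; exact mul_le_one₀ this (norm_nonneg _) this

lemma LocFam.row_bound (hF : LocFam G K0 Sq b) (N U : ℕ) (hN : N ≠ 0) (hU : U ≠ 0) (hUN : 8 * U ∣ N) (S Dl : Finset ℕ) (hS : ∀ ℓ ∈ S, ℓ ∈ G)
    (hD : Dl ⊆ S) (hSN : ∏ ℓ ∈ S, ℓ ∣ N) (hlt : ∏ ℓ ∈ S, ℓ < 8 * U) (y : ℤ) :
    ‖∑ x ∈ range N, (wt N (N / (8 * U)) x : ℂ) * pr (cc b Dl) S x y‖ ≤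
      8 * U * (if ((∏ ℓ ∈ Dl, ℓ : ℕ) : ℤ) ∣ y then 1 else 0) := by
  have hp : ∀ ℓ ∈ S, ℓ.Prime := fun ℓ hℓ => hF.prime ℓ (hS ℓ hℓ)
  have hc : ∀ ℓ ∈ S, Per2 ℓ (cc b Dl ℓ) := fun ℓ hℓ => hF.cc_per Dl (hS ℓ hℓ)
  refine (wsum_mean N _ U hN hU hSN hUN hlt _ ((pr_per _ S hc).1 y)).trans ?_
  gcongr
  split_ifs with hy
  · exact avg_norm_le _ _ 1 zero_le_one fun x => pr_norm _ S (fun ℓ hℓ => hF.cc_norm Dl (hS ℓ hℓ)) x y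
  · rw [pr_avg _ S hp hc]
    have : ∃ ℓ ∈ Dl, ¬ (ℓ : ℤ) ∣ y := by
      by_contra hcon
      push Not at hcon
      apply hy
      rw [Int.natCast_dvd]
      apply Finset.prod_primes_dvd
      · exact fun ℓ hℓ => (hp ℓ (hD hℓ)).prime
      · exact fun ℓ hℓ => Int.natCast_dvd.1 (hcon ℓ hℓ)
    obtain ⟨ℓ, hℓ, hndvd⟩ := this
    rw [prod_eq_zero (hD hℓ)]
    · simp
    · have := hF.mean ℓ (hS ℓ (hD hℓ)) y hndvd
      simpa only [cc, if_pos hℓ] using this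

lemma prod_cc (S1 S2 : Finset ℕ) (x y : ℤ) :
    (((∏ ℓ ∈ S1, b ℓ x y) * (∏ ℓ ∈ S2, b ℓ x y) : ℝ) : ℂ) = pr (cc b ((S1 ∪ S2) \ (S1 ∩ S2))) (S1 ∪ S2) x y := by
  classical
  rw [← prod_union_inter, pr]
  push_cast
  rw [← prod_inter_mul_prod_sdiff (S1 ∪ S2) (S1 ∩ S2) (fun ℓ => (b ℓ x y : ℂ)),
    ← prod_inter_mul_prod_sdiff (S1 ∪ S2) (S1 ∩ S2) (fun ℓ => cc b _ ℓ x y)]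
  have e : (S1 ∪ S2) ∩ (S1 ∩ S2) = S1 ∩ S2 := by
    rw [inter_eq_right]; exact inter_subset_left.trans subset_union_left
  rw [e]
  have h1 : ∏ ℓ ∈ S1 ∩ S2, cc b ((S1 ∪ S2) \ (S1 ∩ S2)) ℓ x y = (∏ ℓ ∈ S1 ∩ S2, (b ℓ x y : ℂ)) * ∏ ℓ ∈ S1 ∩ S2, (b ℓ x y : ℂ) := by
    rw [← prod_mul_distrib]
    refine prod_congr rfl fun ℓ hℓ => ?_
    rw [cc, if_neg (fun h => (mem_sdiff.1 h).2 hℓ)]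
  have h2 : ∏ ℓ ∈ (S1 ∪ S2) \ (S1 ∩ S2), cc b ((S1 ∪ S2) \ (S1 ∩ S2)) ℓ x y = ∏ ℓ ∈ (S1 ∪ S2) \ (S1 ∩ S2), (b ℓ x y : ℂ) := by
    refine prod_congr rfl fun ℓ hℓ => ?_
    rw [cc, if_pos hℓ]
  rw [h1, h2]; ring

lemma LocFam.LN_cc (hF : LocFam G K0 Sq b) (S1 S2 : Finset ℕ) (hS : ∀ ℓ ∈ S1 ∪ S2, ℓ ∈ G) (h : ℤ) :
    LNv (∏ ℓ ∈ S1 ∪ S2, ℓ) (pr (cc b ((S1 ∪ S2) \ (S1 ∩ S2))) (S1 ∪ S2)) h ≤ ((∏ ℓ ∈ S1 ∩ S2, ℓ : ℕ) : ℝ) / ((∏ ℓ ∈ S1 ∪ S2, ℓ : ℕ) : ℝ) := by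
  classical
  have hp : ∀ ℓ ∈ S1 ∪ S2, ℓ.Prime := fun ℓ hℓ => hF.prime ℓ (hS ℓ hℓ)
  refine (pr_LN _ (fun ℓ => if ℓ ∈ (S1 ∪ S2) \ (S1 ∩ S2) then 1 / (ℓ : ℝ) else 1) (S1 ∪ S2) hp
    (fun ℓ hℓ => hF.cc_per _ (hS ℓ hℓ)) ?_ h).trans ?_
  · intro ℓ hℓ h
    split_ifs with hd
    · have := hF.LN ℓ (hS ℓ hℓ) h
      have e : cc b ((S1 ∪ S2) \ (S1 ∩ S2)) ℓ = fun x y => (b ℓ x y : ℂ) := by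
        funext x y; rw [cc, if_pos hd]
      rw [e]; exact this
    · exact LNv_le_one _ _ (hF.cc_norm _ (hS ℓ hℓ)) h
  · rw [← prod_filter, filter_mem_eq_inter, inter_eq_right.2 sdiff_subset]
    have e2 : (∏ ℓ ∈ S1 ∪ S2, ℓ) = (∏ ℓ ∈ S1 ∩ S2, ℓ) * ∏ ℓ ∈ (S1 ∪ S2) \ (S1 ∩ S2), ℓ := by
      rw [← prod_inter_mul_prod_sdiff (S1 ∪ S2) (S1 ∩ S2), inter_eq_right.2 (inter_subset_left.trans subset_union_left)]
    have h0 : ((∏ ℓ ∈ S1 ∩ S2, ℓ : ℕ) : ℝ) ≠ 0 := by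
      exact_mod_cast prod_ne_zero' fun ℓ hℓ => hp ℓ (mem_union_left _ (mem_inter.1 hℓ).1)
    rw [e2, Nat.cast_mul, div_mul_cancel_left₀ h0, prod_div_distrib, prod_const_one]
    push_cast
    rw [one_div]
end

/-- arithmetic of prime factor sets -/
lemma pf_facts (n1 n2 : ℕ) (h1 : Squarefree n1) (h2 : Squarefree n2) :
    (∏ ℓ ∈ n1.primeFactors ∩ n2.primeFactors, ℓ) = Nat.gcd n1 n2 ∧
    (∏ ℓ ∈ n1.primeFactors ∪ n2.primeFactors, ℓ) * Nat.gcd n1 n2 = n1 * n2 ∧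
    (∏ ℓ ∈ (n1.primeFactors ∪ n2.primeFactors) \ (n1.primeFactors ∩ n2.primeFactors), ℓ) * Nat.gcd n1 n2 ^ 2 = n1 * n2 := by
  classical
  have n10 := h1.ne_zero
  have n20 := h2.ne_zero
  have e1 : (∏ ℓ ∈ n1.primeFactors ∩ n2.primeFactors, ℓ) = Nat.gcd n1 n2 := by
    rw [← Nat.primeFactors_gcd n10 n20]
    exact Nat.prod_primeFactors_of_squarefree (h1.squarefree_of_dvd (Nat.gcd_dvd_left _ _))
  have e2 : (∏ ℓ ∈ n1.primeFactors ∪ n2.primeFactors, ℓ) * Nat.gcd n1 n2 = n1 * n2 := by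
    rw [← e1, prod_union_inter, Nat.prod_primeFactors_of_squarefree h1, Nat.prod_primeFactors_of_squarefree h2]
  refine ⟨e1, e2, ?_⟩
  rw [← e2, ← prod_inter_mul_prod_sdiff (n1.primeFactors ∪ n2.primeFactors) (n1.primeFactors ∩ n2.primeFactors),
    inter_eq_right.2 (inter_subset_left.trans subset_union_left), e1]
  ring

end
end SqSieve
end

section
namespace SqSieve

noncomputable section
open Finset

/-- the test function attached to an index -/
def tt (b : ℕ → ℤ → ℤ → ℝ) (i : ℕ × ℕ) (x y : ℤ) : ℝ := b i.1 x y * ∏ ℓ ∈ i.2.primeFactors, b ℓ x y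

lemma Ix_large {G : Set ℕ} {Q : ℕ} {i : ℕ × ℕ} (hi : i ∈ Ix G Q (Q ^ 8)) : Q ^ 7 < 4 * i.1 := by
  rw [mem_Ix] at hi
  obtain ⟨⟨_, h0, hQ⟩, _, _, _, _, h, _⟩ := hi
  have hQ0 : 0 < Q := by omega
  have h1 : Q ^ 7 * Q < (4 * i.1) * Q := by
    calc Q ^ 7 * Q = Q ^ 8 := by ring
      _ < 4 * (i.1 * i.2) := h
      _ ≤ 4 * (i.1 * Q) := by gcongr
      _ = _ := by ring
  exact lt_of_mul_lt_mul_right h1 (Nat.zero_le _)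

lemma Ix_gt {G : Set ℕ} {Q : ℕ} (hQ : 2 ≤ Q) {i : ℕ × ℕ} (hi : i ∈ Ix G Q (Q ^ 8)) : Q < i.1 := by
  have h := Ix_large hi
  have h2 : 4 * Q ≤ Q ^ 7 := by
    calc 4 * Q ≤ Q ^ 6 * Q := by
          gcongr
          calc 4 ≤ 2 ^ 6 := by norm_num
            _ ≤ Q ^ 6 := by gcongr
      _ = _ := by ring
  omega

lemma Ix_notMem {G : Set ℕ} {Q : ℕ} (hQ : 2 ≤ Q) {i j : ℕ × ℕ} (hi : i ∈ Ix G Q (Q ^ 8)) (hj : j ∈ Ix G Q (Q ^ 8)) :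
    i.1 ∉ j.2.primeFactors := by
  intro h
  have h1 := Ix_gt hQ hi
  rw [mem_Ix] at hj
  have := Nat.le_of_dvd hj.1.2.1 (Nat.dvd_of_mem_primeFactors h)
  omega

lemma Ix_coprime {G : Set ℕ} {Q : ℕ} (hQ : 2 ≤ Q) {i j : ℕ × ℕ} (hi : i ∈ Ix G Q (Q ^ 8)) (hj : j ∈ Ix G Q (Q ^ 8)) :
    Nat.Coprime i.1 j.2 := by
  have h1 := Ix_notMem hQ hi hj
  rw [mem_Ix] at hi hj
  rw [hi.2.1.coprime_iff_not_dvd]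
  intro hd
  exact h1 (Nat.mem_primeFactors.2 ⟨hi.2.1, hd, hj.1.2.1.ne'⟩)

lemma Ix_sqf {G : Set ℕ} {Q : ℕ} (hQ : 2 ≤ Q) {i : ℕ × ℕ} (hi : i ∈ Ix G Q (Q ^ 8)) : Squarefree (i.1 * i.2) := by
  have h1 := Ix_coprime hQ hi hi
  rw [mem_Ix] at hi
  rw [Nat.squarefree_mul h1]
  exact ⟨hi.2.1.prime.squarefree, hi.2.2.2.1⟩

lemma Ix_pf {G : Set ℕ} {Q : ℕ} {i : ℕ × ℕ} (hi : i ∈ Ix G Q (Q ^ 8)) :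
    (i.1 * i.2).primeFactors = insert i.1 i.2.primeFactors := by
  rw [mem_Ix] at hi
  rw [Nat.primeFactors_mul hi.1.1.1.ne' hi.1.2.1.ne', hi.2.1.primeFactors, insert_eq]

lemma Ix_mem {G : Set ℕ} {Q : ℕ} {i : ℕ × ℕ} (hi : i ∈ Ix G Q (Q ^ 8)) :
    ∀ ℓ ∈ (i.1 * i.2).primeFactors, ℓ ∈ G := by
  rw [Ix_pf hi]
  rw [mem_Ix] at hi
  intro ℓ hℓ
  rw [mem_insert] at hℓ
  rcases hℓ with rfl | h
  · exact hi.2.2.1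
  · exact hi.2.2.2.2.1 ℓ h

lemma tt_eq (b : ℕ → ℤ → ℤ → ℝ) {G : Set ℕ} {Q : ℕ} (hQ : 2 ≤ Q) {i : ℕ × ℕ} (hi : i ∈ Ix G Q (Q ^ 8)) (x y : ℤ) :
    tt b i x y = ∏ ℓ ∈ (i.1 * i.2).primeFactors, b ℓ x y := by
  rw [Ix_pf hi, prod_insert (Ix_notMem hQ hi hi), tt]

lemma lcm_dvd_fact {G : Set ℕ} {Q N : ℕ} (hN : (Q ^ 8).factorial ∣ N) {i j : ℕ × ℕ} (hi : i ∈ Ix G Q (Q ^ 8)) (hj : j ∈ Ix G Q (Q ^ 8)) :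
    ∏ ℓ ∈ (i.1 * i.2).primeFactors ∪ (j.1 * j.2).primeFactors, ℓ ∣ N := by
  refine dvd_trans ?_ hN
  have key : ∀ k ∈ Ix G Q (Q ^ 8), ∀ ℓ ∈ (k.1 * k.2).primeFactors, ℓ ∣ (Q ^ 8).factorial := by
    intro k hk ℓ hℓ
    rw [mem_Ix] at hk
    have hp := Nat.prime_of_mem_primeFactors hℓ
    have := Nat.le_of_dvd (Nat.mul_pos hk.1.1.1 hk.1.2.1) (Nat.dvd_of_mem_primeFactors hℓ)
    exact Nat.dvd_factorial hp.pos (this.trans hk.2.2.2.2.2.2)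
  apply Finset.prod_primes_dvd
  · intro ℓ hℓ
    rw [mem_union] at hℓ
    rcases hℓ with h | h <;> exact (Nat.prime_of_mem_primeFactors h).prime
  · intro ℓ hℓ
    rw [mem_union] at hℓ
    rcases hℓ with h | h
    · exact key i hi ℓ h
    · exact key j hj ℓ h

section
variable {G : Set ℕ} {K0 : ℝ} {Sq : ℤ → ℤ → Prop} {b : ℕ → ℤ → ℤ → ℝ}

/-- conductor of the nontrivial part -/
def dd (i j : ℕ × ℕ) : ℕ := ∏ ℓ ∈ ((i.1 * i.2).primeFactors ∪ (j.1 * j.2).primeFactors) \ ((i.1 * i.2).primeFactors ∩ (j.1 * j.2).primeFactors), ℓ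

def ll (i j : ℕ × ℕ) : ℕ := ∏ ℓ ∈ (i.1 * i.2).primeFactors ∪ (j.1 * j.2).primeFactors, ℓ

lemma dd_pos (i j : ℕ × ℕ) : 0 < dd i j := by
  apply Nat.pos_of_ne_zero
  apply prod_ne_zero'
  intro ℓ hℓ
  have h := (mem_sdiff.1 hℓ).1
  rw [mem_union] at h
  rcases h with h | h <;> exact Nat.prime_of_mem_primeFactors h

lemma ll_le {Q : ℕ} (hQ : 2 ≤ Q) {i j : ℕ × ℕ} (hi : i ∈ Ix G Q (Q ^ 8)) (hj : j ∈ Ix G Q (Q ^ 8)) :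
    ll i j ≤ (i.1 * i.2) * (j.1 * j.2) := by
  have h := (pf_facts _ _ (Ix_sqf hQ hi) (Ix_sqf hQ hj)).2.1
  rw [← h]
  apply Nat.le_mul_of_pos_right
  exact Nat.gcd_pos_of_pos_left _ (Nat.pos_of_ne_zero (Ix_sqf hQ hi).ne_zero)

lemma ll_le_P {Q : ℕ} (hQ : 2 ≤ Q) {i j : ℕ × ℕ} (hi : i ∈ Ix G Q (Q ^ 8)) (hj : j ∈ Ix G Q (Q ^ 8)) :
    ll i j ≤ Q ^ 16 := by
  refine (ll_le hQ hi hj).trans ?_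
  rw [mem_Ix] at hi hj
  calc _ ≤ Q ^ 8 * Q ^ 8 := Nat.mul_le_mul hi.2.2.2.2.2.2 hj.2.2.2.2.2.2
    _ = _ := by ring

lemma ll_diag {Q : ℕ} (hQ : 2 ≤ Q) {i j : ℕ × ℕ} (hi : i ∈ Ix G Q (Q ^ 8)) (hj : j ∈ Ix G Q (Q ^ 8)) (hij : i.1 = j.1) :
    ll i j ≤ Q ^ 9 := by
  have h := (pf_facts _ _ (Ix_sqf hQ hi) (Ix_sqf hQ hj)).2.1
  rw [mem_Ix] at hi hj
  rw [← hij, Nat.gcd_mul_left] at h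
  have hg : 0 < i.1 * Nat.gcd i.2 j.2 := Nat.mul_pos hi.1.1.1 (Nat.gcd_pos_of_pos_left _ hi.1.2.1)
  have h2 : ll i j * i.1 ≤ (Q ^ 9) * i.1 := by
    calc ll i j * i.1 ≤ ll i j * (i.1 * Nat.gcd i.2 j.2) := by
          gcongr
          exact Nat.le_mul_of_pos_right _ (Nat.gcd_pos_of_pos_left _ hi.1.2.1)
      _ = i.1 * i.2 * (i.1 * j.2) := by rw [ll, ← hij]; exact h
      _ = (i.1 * i.2 * j.2) * i.1 := by ring
      _ ≤ (Q ^ 8 * Q) * i.1 := by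
          gcongr
          · exact hi.2.2.2.2.2.2
          · exact hj.1.2.2
      _ = _ := by ring
  exact le_of_mul_le_mul_right h2 hi.1.1.1

lemma dd_diag {Q : ℕ} (hQ : 2 ≤ Q) {i j : ℕ × ℕ} (hi : i ∈ Ix G Q (Q ^ 8)) (hj : j ∈ Ix G Q (Q ^ 8)) (hij : i.1 = j.1) :
    dd i j * Nat.gcd i.2 j.2 ^ 2 = i.2 * j.2 := by
  have h := (pf_facts _ _ (Ix_sqf hQ hi) (Ix_sqf hQ hj)).2.2
  rw [mem_Ix] at hi hj
  change dd i j * _ = _ at h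
  rw [← hij, Nat.gcd_mul_left] at h
  have hp := hi.1.1.1
  have : (i.1 ^ 2) * (dd i j * Nat.gcd i.2 j.2 ^ 2) = i.1 ^ 2 * (i.2 * j.2) := by
    rw [show (i.1 ^ 2) * (dd i j * Nat.gcd i.2 j.2 ^ 2) = dd i j * (i.1 * Nat.gcd i.2 j.2) ^ 2 by ring, h]; ring
  exact Nat.eq_of_mul_eq_mul_left (by positivity) this

lemma dd_inv {Q : ℕ} (hQ : 2 ≤ Q) {i j : ℕ × ℕ} (hi : i ∈ Ix G Q (Q ^ 8)) (hj : j ∈ Ix G Q (Q ^ 8)) (hij : i.1 = j.1) :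
    (1 : ℝ) / dd i j = ((Nat.gcd i.2 j.2 : ℕ) : ℝ) ^ 2 / (i.2 * j.2) := by
  have h := dd_diag hQ hi hj hij
  have h' : (dd i j : ℝ) * ((Nat.gcd i.2 j.2 : ℕ) : ℝ) ^ 2 = i.2 * j.2 := by exact_mod_cast h
  have hd : (dd i j : ℝ) ≠ 0 := by exact_mod_cast (dd_pos i j).ne'
  rw [mem_Ix] at hi
  have hg : ((Nat.gcd i.2 j.2 : ℕ) : ℝ) ≠ 0 := by exact_mod_cast (Nat.gcd_pos_of_pos_left _ hi.1.2.1).ne'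
  rw [← h']
  field_simp

lemma dd_off {Q : ℕ} (hQ : 2 ≤ Q) {i j : ℕ × ℕ} (hi : i ∈ Ix G Q (Q ^ 8)) (hj : j ∈ Ix G Q (Q ^ 8)) (hij : i.1 ≠ j.1) :
    i.1 * j.1 ∣ dd i j := by
  have hi1 := (mem_Ix.1 hi).2.1
  have hj1 := (mem_Ix.1 hj).2.1
  have h1 := Ix_notMem hQ hi hj
  have h2 := Ix_notMem hQ hj hi
  have hsub : ({i.1, j.1} : Finset ℕ) ⊆ ((i.1 * i.2).primeFactors ∪ (j.1 * j.2).primeFactors) \ ((i.1 * i.2).primeFactors ∩ (j.1 * j.2).primeFactors) := by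
    rw [Ix_pf hi, Ix_pf hj]
    intro ℓ hℓ
    rw [mem_insert, mem_singleton] at hℓ
    rcases hℓ with rfl | rfl <;> simp [h1, h2, hij, hij.symm]
  have := prod_dvd_prod_of_subset _ _ (fun ℓ : ℕ => ℓ) hsub
  rwa [prod_pair hij] at this

lemma LocFam.tt_row (hF : LocFam G K0 Sq b) {N U Q : ℕ} (hN : N ≠ 0) (hU : U ≠ 0) (hUN : 8 * U ∣ N) (hQ : 2 ≤ Q)
    (hfN : (Q ^ 8).factorial ∣ N) {i j : ℕ × ℕ} (hi : i ∈ Ix G Q (Q ^ 8)) (hj : j ∈ Ix G Q (Q ^ 8)) (hlt : ll i j < 8 * U) (y : ℤ) :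
    |∑ x ∈ range N, wt N (N / (8 * U)) x * (tt b i x y * tt b j x y)| ≤ 8 * U * (if (dd i j : ℤ) ∣ y then 1 else 0) := by
  have h := hF.row_bound N U hN hU hUN ((i.1 * i.2).primeFactors ∪ (j.1 * j.2).primeFactors)
    (((i.1 * i.2).primeFactors ∪ (j.1 * j.2).primeFactors) \ ((i.1 * i.2).primeFactors ∩ (j.1 * j.2).primeFactors))
    (fun ℓ hℓ => by
      rw [mem_union] at hℓ
      rcases hℓ with h | h
      · exact Ix_mem hi ℓ h
      · exact Ix_mem hj ℓ h) sdiff_subset (lcm_dvd_fact hfN hi hj) hlt y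
  rw [← Real.norm_eq_abs, ← Complex.norm_real]
  push_cast
  refine le_trans (le_of_eq ?_) h
  congr 1
  refine sum_congr rfl fun x _ => ?_
  rw [← prod_cc, tt_eq b hQ hi, tt_eq b hQ hj]
  push_cast
  ring

lemma LocFam.tt_off (hF : LocFam G K0 Sq b) (hK0 : 0 ≤ K0) {N U V Q : ℕ} (hN : N ≠ 0) (hU : U ≠ 0) (hV : V ≠ 0) (hUN : 8 * U ∣ N) (hVN : 8 * V ∣ N) (hQ : 2 ≤ Q)
    (hfN : (Q ^ 8).factorial ∣ N) {i j : ℕ × ℕ} (hi : i ∈ Ix G Q (Q ^ 8)) (hj : j ∈ Ix G Q (Q ^ 8)) (hij : i.1 ≠ j.1)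
    (hVp : V ≤ i.1 * j.1) :
    |∑ y ∈ range N, wt N (N / (8 * V)) y * ∑ x ∈ range N, wt N (N / (8 * U)) x * (tt b i x y * tt b j x y)| ≤
      128 * K0 ^ 2 * ((Q:ℝ) ^ 16 + U) * √((Nat.gcd i.2 j.2 : ℕ) : ℝ) := by
  have hi' := mem_Ix.1 hi
  have hj' := mem_Ix.1 hj
  set S := i.2.primeFactors ∪ j.2.primeFactors with hS
  have hSG : ∀ ℓ ∈ S, ℓ ∈ G := by
    intro ℓ hℓ
    rw [hS, mem_union] at hℓ
    rcases hℓ with h | h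
    · exact hi'.2.2.2.2.1 ℓ h
    · exact hj'.2.2.2.2.1 ℓ h
  have hSp : ∀ ℓ ∈ S, ℓ.Prime := fun ℓ hℓ => hF.prime ℓ (hSG ℓ hℓ)
  set q := ∏ ℓ ∈ S, ℓ with hq
  have hq0 : q ≠ 0 := prod_ne_zero' hSp
  have hiS : i.1 ∉ S := by
    rw [hS, mem_union, not_or]; exact ⟨Ix_notMem hQ hi hi, Ix_notMem hQ hi hj⟩
  have hjS : j.1 ∉ S := by
    rw [hS, mem_union, not_or]; exact ⟨Ix_notMem hQ hj hi, Ix_notMem hQ hj hj⟩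
  have hunion : (i.1 * i.2).primeFactors ∪ (j.1 * j.2).primeFactors = insert i.1 (insert j.1 S) := by
    rw [Ix_pf hi, Ix_pf hj, hS]
    ext ℓ; simp only [mem_union, mem_insert]; tauto
  have hll : ll i j = i.1 * (j.1 * q) := by
    rw [ll, hunion, prod_insert, prod_insert hjS]
    rw [mem_insert, not_or]; exact ⟨hij, hiS⟩
  have hco2 : Nat.Coprime j.1 q := coprime_prod hSp hj'.2.1 hjS
  have hco1 : Nat.Coprime i.1 (j.1 * q) :=
    Nat.Coprime.mul_right ((Nat.coprime_primes hi'.2.1 hj'.2.1).2 hij) (coprime_prod hSp hi'.2.1 hiS)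
  have hpf := pf_facts i.2 j.2 hi'.2.2.2.1 hj'.2.2.2.1
  have h := offdiag K0 hK0 N i.1 j.1 q U V hN hU hV (by rw [← hll]; exact lcm_dvd_fact hfN hi hj) hUN hVN hi'.1.1.1 hj'.1.1.1
    (Nat.pos_of_ne_zero hq0) hco1 hco2 hVp (fun x y => (b i.1 x y : ℂ)) (fun x y => (b j.1 x y : ℂ))
    (pr (cc b (S \ (i.2.primeFactors ∩ j.2.primeFactors))) S) (hF.per _ hi'.2.2.1) (hF.per _ hj'.2.2.1)
    (pr_per _ _ fun ℓ hℓ => hF.cc_per _ (hSG ℓ hℓ)) (hF.hat _ hi'.2.2.1) (hF.hat _ hj'.2.2.1)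
    ((Nat.gcd i.2 j.2 : ℕ) / (q : ℝ)) (by positivity) (fun h => by
      have := hF.LN_cc _ _ hSG h
      rw [hpf.1] at this
      exact this)
  rw [mul_div_cancel₀ _ (by exact_mod_cast hq0 : (q:ℝ) ≠ 0), ← hll] at h
  rw [← Real.norm_eq_abs, ← Complex.norm_real]
  push_cast
  refine le_trans (le_of_eq ?_) (h.trans ?_)
  · congr 1
    refine sum_congr rfl fun y _ => ?_
    congr 1
    refine sum_congr rfl fun x _ => ?_
    rw [← prod_cc, tt, tt]
    push_cast
    ring
  · gcongr
    exact_mod_cast ll_le_P hQ hi hj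

end

end
end SqSieve
end

section
namespace SqSieve

noncomputable section
open Finset

lemma E_expand {κ : Type*} (K : Finset κ) (I : Finset (ℕ × ℕ)) (w : κ → ℝ) (t : ℕ × ℕ → κ → ℝ) :
    ∑ k ∈ K, w k * (∑ i ∈ I, Real.log i.1 * t i k) ^ 2 =
      ∑ i ∈ I, ∑ j ∈ I, Real.log i.1 * Real.log j.1 * ∑ k ∈ K, w k * (t i k * t j k) := by
  have h : ∀ k, w k * (∑ i ∈ I, Real.log i.1 * t i k) ^ 2 =
      ∑ i ∈ I, ∑ j ∈ I, Real.log i.1 * Real.log j.1 * (w k * (t i k * t j k)) := by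
    intro k
    rw [sq, sum_mul_sum, mul_sum]
    refine sum_congr rfl fun i _ => ?_
    rw [mul_sum]
    exact sum_congr rfl fun j _ => by ring
  simp_rw [h]
  rw [sum_comm]
  refine sum_congr rfl fun i _ => ?_
  rw [sum_comm]
  exact sum_congr rfl fun j _ => by rw [mul_sum]

lemma inj_x (N U : ℕ) (hN : 2 * U < N) (f : ℤ → ℝ) (h0 : ∀ x, 0 ≤ f x) (hp : ∀ x, f (x + N) = f x) :
    ∑ x ∈ Icc (-(U:ℤ)) U, f x ≤ ∑ x ∈ range N, f x := by
  have hN0 : (0:ℤ) < N := by omega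
  have hper : ∀ x k : ℤ, f (x + N * k) = f x := by
    intro x k
    have := Per.mul_int (m := N) (G := fun x => (f x : ℂ)) (fun x => by simp only [hp]) x k
    exact_mod_cast this
  have hred : ∀ x : ℤ, f ((x % N).toNat : ℤ) = f x := by
    intro x
    rw [Int.toNat_of_nonneg (Int.emod_nonneg _ hN0.ne')]
    conv_rhs => rw [← Int.emod_add_mul_ediv x N]
    rw [hper]
  calc _ = ∑ x ∈ Icc (-(U:ℤ)) U, f ((x % N).toNat : ℤ) := sum_congr rfl fun x _ => (hred x).symm
    _ = ∑ n ∈ (Icc (-(U:ℤ)) U).image (fun x : ℤ => (x % (N:ℤ)).toNat), f n := by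
        rw [sum_image (f := fun n : ℕ => f n)]
        intro x hx y hy hxy
        simp only [coe_Icc, Set.mem_Icc] at hx hy
        have e : x % N = y % N := by
          have h1 := Int.emod_nonneg x hN0.ne'
          have h2 := Int.emod_nonneg y hN0.ne'
          simp only at hxy
          omega
        have hd : (N:ℤ) ∣ x - y := Int.ModEq.dvd (show y % N = x % N from e.symm)
        have := Int.eq_zero_of_abs_lt_dvd hd (by rw [abs_lt]; constructor <;> omega)
        omega
    _ ≤ _ := by
        refine sum_le_sum_of_subset_of_nonneg ?_ fun n _ _ => h0 n
        intro n hn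
        rw [mem_image] at hn
        obtain ⟨x, _, rfl⟩ := hn
        rw [mem_range]
        have h1 := Int.emod_nonneg x hN0.ne'
        have h2 := Int.emod_lt_of_pos x hN0
        omega

/-- average of the indicator of divisibility -/
lemma wt_dvd (N V d : ℕ) (hN : N ≠ 0) (hV : V ≠ 0) (hdN : d ∣ N) (hVN : 8 * V ∣ N) (hd0 : 0 < d) (hd : d < 8 * V) :
    ∑ y ∈ range N, wt N (N / (8 * V)) y * (if (d:ℤ) ∣ (y:ℤ) then 1 else 0) ≤ 8 * V * (1 / d) := by
  have h := wsum_mean N d V hN hV hdN hVN hd (fun y => if (d:ℤ) ∣ y then 1 else 0) (fun y => by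
    simp only [dvd_add_self_right])
  have e : avg d (fun y => if (d:ℤ) ∣ y then 1 else 0) = 1 / d := by
    rw [avg]
    congr 1
    rw [sum_eq_single 0]
    · simp
    · intro y hy hy0
      rw [if_neg]
      intro hc
      have := Nat.le_of_dvd (by omega) (Int.natCast_dvd_natCast.1 hc)
      rw [mem_range] at hy; omega
    · intro hc; exact absurd (mem_range.2 hd0) hc
  rw [e] at h
  have h2 : ‖(1 / d : ℂ)‖ = 1 / d := by simp
  rw [h2] at h
  refine le_trans ?_ h
  have e2 : (∑ y ∈ range N, (wt N (N / (8 * V)) y : ℂ) * (if (d:ℤ) ∣ (y:ℤ) then 1 else 0)) =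
      ((∑ y ∈ range N, wt N (N / (8 * V)) y * (if (d:ℤ) ∣ (y:ℤ) then 1 else 0) : ℝ) : ℂ) := by
    push_cast
    refine sum_congr rfl fun y _ => ?_
    split_ifs <;> simp
  rw [e2, Complex.norm_real]
  exact Real.le_norm_self _

lemma count_dvd (V d : ℕ) (hd : 0 < d) :
    ∑ y ∈ (Icc (-(V:ℤ)) V).filter (fun y => y ≠ 0), (if (d:ℤ) ∣ y then (1:ℝ) else 0) ≤ 2 * V * (1 / d) := by
  rw [← sum_filter, sum_const, nsmul_eq_mul, mul_one]
  have hsub : ((Icc (-(V:ℤ)) V).filter (fun y => y ≠ 0)).filter (fun y => (d:ℤ) ∣ y) ⊆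
      ((Icc (-((V/d:ℕ):ℤ)) (V/d:ℕ)).erase 0).image (fun k => (d:ℤ) * k) := by
    intro y hy
    rw [mem_filter, mem_filter, mem_Icc] at hy
    obtain ⟨⟨⟨h1, h2⟩, h3⟩, k, rfl⟩ := hy
    rw [mem_image]
    refine ⟨k, ?_, rfl⟩
    have hd' : (0:ℤ) < d := by exact_mod_cast hd
    rw [mem_erase, mem_Icc]
    refine ⟨fun h => h3 (by rw [h]; ring), ?_, ?_⟩
    · have : -k ≤ (V:ℤ) / d := by rw [Int.le_ediv_iff_mul_le hd']; linarith
      push_cast; linarith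
    · push_cast; rw [Int.le_ediv_iff_mul_le hd']; linarith
  have hc := (card_le_card hsub).trans card_image_le
  rw [card_erase_of_mem (by rw [mem_Icc]; have := Int.natCast_nonneg (V / d); constructor <;> linarith), Int.card_Icc] at hc
  have hc2 : (((Icc (-(V:ℤ)) V).filter (fun y => y ≠ 0)).filter (fun y => (d:ℤ) ∣ y)).card ≤ 2 * (V / d) := by omega
  have h5 : ((V / d : ℕ) : ℝ) ≤ V / d := Nat.cast_div_le
  calc _ ≤ ((2 * (V / d) : ℕ) : ℝ) := by exact_mod_cast hc2
    _ = 2 * ((V / d : ℕ) : ℝ) := by push_cast; ring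
    _ ≤ 2 * (V / d) := by gcongr
    _ = _ := by ring

def Psi (b : ℕ → ℤ → ℤ → ℝ) (I : Finset (ℕ × ℕ)) (x y : ℤ) : ℝ := ∑ i ∈ I, Real.log i.1 * tt b i x y

section
variable {G : Set ℕ} {K0 : ℝ} {Sq : ℤ → ℤ → Prop} {b : ℕ → ℤ → ℤ → ℝ}

lemma LocFam.b_per (hF : LocFam G K0 Sq b) {N Q : ℕ} (hfN : (Q ^ 8).factorial ∣ N) {i : ℕ × ℕ} (hi : i ∈ Ix G Q (Q ^ 8))
    {ℓ : ℕ} (hℓ : ℓ ∈ (i.1 * i.2).primeFactors) (x y : ℤ) : b ℓ (x + N) y = b ℓ x y ∧ b ℓ x (y + N) = b ℓ x y := by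
  have hG := Ix_mem hi ℓ hℓ
  rw [mem_Ix] at hi
  have h1 := Nat.le_of_dvd (Nat.mul_pos hi.1.1.1 hi.1.2.1) (Nat.dvd_of_mem_primeFactors hℓ)
  have h2 : ℓ ∣ N := (Nat.dvd_factorial (Nat.prime_of_mem_primeFactors hℓ).pos (h1.trans hi.2.2.2.2.2.2)).trans hfN
  have h3 := (hF.per ℓ hG).of_dvd h2
  have h4 := h3.1 y x
  have h5 := h3.2 x y
  simp only at h4 h5
  exact ⟨by exact_mod_cast h4, by exact_mod_cast h5⟩

lemma LocFam.Psi_per (hF : LocFam G K0 Sq b) {N Q : ℕ} (hQ : 2 ≤ Q) (hfN : (Q ^ 8).factorial ∣ N) (x y : ℤ) :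
    Psi b (Ix G Q (Q ^ 8)) (x + N) y = Psi b (Ix G Q (Q ^ 8)) x y ∧ Psi b (Ix G Q (Q ^ 8)) x (y + N) = Psi b (Ix G Q (Q ^ 8)) x y := by
  constructor
  · refine sum_congr rfl fun i hi => ?_
    rw [tt_eq b hQ hi, tt_eq b hQ hi]
    congr 1
    exact prod_congr rfl fun ℓ hℓ => (hF.b_per hfN hi hℓ x y).1
  · refine sum_congr rfl fun i hi => ?_
    rw [tt_eq b hQ hi, tt_eq b hQ hi]
    congr 1
    exact prod_congr rfl fun ℓ hℓ => (hF.b_per hfN hi hℓ x y).2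

lemma LocFam.upper2 (hF : LocFam G K0 Sq b) (hK0 : 0 ≤ K0) {N U V Q : ℕ} (hN : N ≠ 0) (hU : U ≠ 0) (hV : V ≠ 0) (hUN : 8 * U ∣ N) (hVN : 8 * V ∣ N) (hQ : 2 ≤ Q)
    (hfN : (Q ^ 8).factorial ∣ N) (h9 : Q ^ 9 < 8 * U) (h2 : Q ^ 2 < 8 * V) (h14 : 16 * V ≤ Q ^ 14) :
    ∑ y ∈ range N, wt N (N / (8 * V)) y * ∑ x ∈ range N, wt N (N / (8 * U)) x * Psi b (Ix G Q (Q ^ 8)) x y ^ 2 ≤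
    (64 * (64 * U * V) * Q ^ 8 + 4 * zc * (128 * K0 ^ 2 * ((Q:ℝ) ^ 16 + U)) * Q ^ 16) * (1 + Real.log ((Q:ℝ) ^ 8)) ^ 2 := by
  have hQ0 : 0 < Q := by omega
  have hu := upper_sum G Q (Q ^ 8) (Nat.le_self_pow (by norm_num) Q) hQ0
    (fun i j => ∑ y ∈ range N, wt N (N / (8 * V)) y * ∑ x ∈ range N, wt N (N / (8 * U)) x * (tt b i x y * tt b j x y))
    (64 * U * V) (128 * K0 ^ 2 * ((Q:ℝ) ^ 16 + U)) (by positivity) (by positivity) ?_ ?_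
  · refine le_trans (le_of_eq ?_) (hu.trans (le_of_eq ?_))
    · have := E_expand (range N ×ˢ range N) (Ix G Q (Q ^ 8)) (fun k => wt N (N / (8 * V)) k.1 * wt N (N / (8 * U)) k.2)
        (fun i k => tt b i k.2 k.1)
      simp only [sum_product, mul_assoc, ← mul_sum] at this ⊢
      exact this
    · push_cast; ring
  · intro i hi j hj hij
    have hl := ll_diag hQ hi hj hij
    have hdl : dd i j ∣ ll i j := prod_dvd_prod_of_subset _ _ _ sdiff_subset
    have hdQ : dd i j ≤ Q ^ 2 := by
      have h1 := dd_diag hQ hi hj hij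
      rw [mem_Ix] at hi hj
      calc dd i j ≤ dd i j * Nat.gcd i.2 j.2 ^ 2 := Nat.le_mul_of_pos_right _ (pow_pos (Nat.gcd_pos_of_pos_left _ hi.1.2.1) 2)
        _ = i.2 * j.2 := h1
        _ ≤ Q * Q := Nat.mul_le_mul hi.1.2.2 hj.1.2.2
        _ = _ := by ring
    rw [← dd_inv hQ hi hj hij]
    calc _ ≤ ∑ y ∈ range N, wt N (N / (8 * V)) y * (8 * U * (if (dd i j : ℤ) ∣ (y:ℤ) then 1 else 0)) := by
          refine sum_le_sum fun y _ => ?_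
          have := hF.tt_row hN hU hUN hQ hfN hi hj (by omega) y
          have h0 := wt_nonneg N (N / (8 * V)) y
          gcongr
          exact (le_abs_self _).trans this
      _ = 8 * U * ∑ y ∈ range N, wt N (N / (8 * V)) y * (if (dd i j : ℤ) ∣ (y:ℤ) then 1 else 0) := by
          rw [mul_sum]; refine sum_congr rfl fun y _ => by ring
      _ ≤ 8 * U * (8 * V * (1 / dd i j)) := by
          gcongr
          exact wt_dvd N V (dd i j) hN hV (hdl.trans (lcm_dvd_fact hfN hi hj)) hVN (dd_pos i j) (by omega)
      _ = _ := by ring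
  · intro i hi j hj hij
    refine (le_abs_self _).trans (hF.tt_off hK0 hN hU hV hUN hVN hQ hfN hi hj hij ?_)
    have h1 := Ix_large hi
    have h2 := Ix_large hj
    have : Q ^ 14 ≤ 16 * (i.1 * j.1) := by
      calc Q ^ 14 = Q ^ 7 * Q ^ 7 := by ring
        _ ≤ (4 * i.1) * (4 * j.1) := Nat.mul_le_mul h1.le h2.le
        _ = _ := by ring
    omega

lemma LocFam.upper1 (hF : LocFam G K0 Sq b) {N U V Q : ℕ} (hN : N ≠ 0) (hU : U ≠ 0) (hUN : 8 * U ∣ N) (hQ : 2 ≤ Q)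
    (hfN : (Q ^ 8).factorial ∣ N) (h16 : Q ^ 16 < 8 * U) (h14 : 16 * V < Q ^ 14) :
    ∑ y ∈ (Icc (-(V:ℤ)) V).filter (fun y => y ≠ 0), ∑ x ∈ range N, wt N (N / (8 * U)) x * Psi b (Ix G Q (Q ^ 8)) x y ^ 2 ≤
    (64 * (64 * U * V) * Q ^ 8) * (1 + Real.log ((Q:ℝ) ^ 8)) ^ 2 := by
  have hQ0 : 0 < Q := by omega
  have hu := upper_sum G Q (Q ^ 8) (Nat.le_self_pow (by norm_num) Q) hQ0
    (fun i j => ∑ y ∈ (Icc (-(V:ℤ)) V).filter (fun y => y ≠ 0), ∑ x ∈ range N, wt N (N / (8 * U)) x * (tt b i x y * tt b j x y))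
    (64 * U * V) 0 (by positivity) le_rfl ?_ ?_
  · refine le_trans (le_of_eq ?_) (hu.trans (le_of_eq ?_))
    · have := E_expand ((Icc (-(V:ℤ)) V).filter (fun y => y ≠ 0) ×ˢ range N) (Ix G Q (Q ^ 8)) (fun k => wt N (N / (8 * U)) k.2)
        (fun i k => tt b i k.2 k.1)
      simp only [sum_product] at this ⊢
      exact this
    · push_cast; ring
  · intro i hi j hj hij
    have hl := ll_le_P hQ hi hj
    rw [← dd_inv hQ hi hj hij]
    calc _ ≤ ∑ y ∈ (Icc (-(V:ℤ)) V).filter (fun y => y ≠ 0), (8 * U * (if (dd i j : ℤ) ∣ (y:ℤ) then (1:ℝ) else 0)) := by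
          refine sum_le_sum fun y _ => ?_
          exact (le_abs_self _).trans (hF.tt_row hN hU hUN hQ hfN hi hj (by omega) y)
      _ = 8 * U * ∑ y ∈ (Icc (-(V:ℤ)) V).filter (fun y => y ≠ 0), (if (dd i j : ℤ) ∣ (y:ℤ) then (1:ℝ) else 0) := by
          rw [mul_sum]
      _ ≤ 8 * U * (2 * V * (1 / dd i j)) := by
          gcongr
          exact count_dvd V (dd i j) (dd_pos i j)
      _ ≤ 8 * U * (8 * V * (1 / dd i j)) := by gcongr; norm_num
      _ = _ := by ring
  · intro i hi j hj hij
    have hl := ll_le_P hQ hi hj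
    rw [zero_mul]
    refine sum_nonpos fun y hy => ?_
    refine (le_abs_self _).trans ((hF.tt_row hN hU hUN hQ hfN hi hj (by omega) y).trans (le_of_eq ?_))
    rw [if_neg, mul_zero]
    intro hd
    rw [mem_filter, mem_Icc] at hy
    have h1 := Ix_large hi
    have h2 := Ix_large hj
    have h3 : Q ^ 14 ≤ 16 * (i.1 * j.1) := by
      calc Q ^ 14 = Q ^ 7 * Q ^ 7 := by ring
        _ ≤ (4 * i.1) * (4 * j.1) := Nat.mul_le_mul h1.le h2.le
        _ = _ := by ring
    have h4 : i.1 * j.1 ∣ y.natAbs := (dd_off hQ hi hj hij).trans (Int.natCast_dvd.1 hd)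
    have := Nat.le_of_dvd (by omega) h4
    omega

lemma LocFam.sieve2 (hF : LocFam G K0 Sq b) (hK0 : 0 ≤ K0) {U V Q : ℕ} (hU : U ≠ 0) (hV : V ≠ 0) (hQ : 2 ≤ Q)
    (h9 : Q ^ 9 < 8 * U) (h2 : Q ^ 2 < 8 * V) (h14 : 16 * V ≤ Q ^ 14) (A : Finset (ℤ × ℤ))
    (hA : ∀ a ∈ A, |a.1| ≤ U ∧ |a.2| ≤ V) (L : ℝ) (hL0 : 0 ≤ L) (hL : ∀ a ∈ A, L ≤ Psi b (Ix G Q (Q ^ 8)) a.1 a.2) :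
    A.card * L ^ 2 ≤ 4 *
    ((64 * (64 * U * V) * Q ^ 8 + 4 * zc * (128 * K0 ^ 2 * ((Q:ℝ) ^ 16 + U)) * Q ^ 16) * (1 + Real.log ((Q:ℝ) ^ 8)) ^ 2) := by
  set N := 8 * U * V * (Q ^ 8).factorial with hNdef
  have hN : N ≠ 0 := by rw [hNdef]; positivity
  have hUN : 8 * U ∣ N := ⟨V * (Q ^ 8).factorial, by rw [hNdef]; ring⟩
  have hVN : 8 * V ∣ N := ⟨U * (Q ^ 8).factorial, by rw [hNdef]; ring⟩
  have hfN : (Q ^ 8).factorial ∣ N := ⟨8 * U * V, by rw [hNdef]; ring⟩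
  have hup := hF.upper2 hK0 hN hU hV hUN hVN hQ hfN h9 h2 h14
  have hU8 := Nat.le_of_dvd (Nat.pos_of_ne_zero hN) hUN
  have hV8 := Nat.le_of_dvd (Nat.pos_of_ne_zero hN) hVN
  have wlow : ∀ (M : ℕ) (hM : M ≠ 0) (hMN : 8 * M ∣ N) (x : ℤ), |x| ≤ M → 1 / 2 ≤ wt N (N / (8 * M)) x := by
    intro M hM hMN x hx
    apply wt_lower
    · exact Nat.div_pos (Nat.le_of_dvd (Nat.pos_of_ne_zero hN) hMN) (by omega)
    · obtain ⟨k, hk⟩ := hMN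
      rw [hk, Nat.mul_div_cancel_left _ (by omega)]
      push_cast
      nlinarith [abs_nonneg x]
  have hper := hF.Psi_per hQ hfN
  set I := Ix G Q (Q ^ 8)
  have key : ∑ a ∈ A, wt N (N / (8 * V)) a.2 * (wt N (N / (8 * U)) a.1 * Psi b I a.1 a.2 ^ 2) ≤
      ∑ y ∈ range N, wt N (N / (8 * V)) y * ∑ x ∈ range N, wt N (N / (8 * U)) x * Psi b I x y ^ 2 := by
    have hw := wt_nonneg N
    have hsub : A ⊆ Icc (-(U:ℤ)) U ×ˢ Icc (-(V:ℤ)) V := by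
      intro a ha
      have := hA a ha
      rw [mem_product, mem_Icc, mem_Icc]
      exact ⟨_root_.abs_le.1 this.1, _root_.abs_le.1 this.2⟩
    calc _ ≤ ∑ a ∈ Icc (-(U:ℤ)) U ×ˢ Icc (-(V:ℤ)) V, wt N (N / (8 * V)) a.2 * (wt N (N / (8 * U)) a.1 * Psi b I a.1 a.2 ^ 2) :=
          sum_le_sum_of_subset_of_nonneg hsub fun a _ _ => mul_nonneg (hw _ _) (mul_nonneg (hw _ _) (sq_nonneg _))
      _ = ∑ y ∈ Icc (-(V:ℤ)) V, wt N (N / (8 * V)) y * ∑ x ∈ Icc (-(U:ℤ)) U, wt N (N / (8 * U)) x * Psi b I x y ^ 2 := by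
          rw [sum_product_right]
          exact sum_congr rfl fun y _ => by rw [mul_sum]
      _ ≤ ∑ y ∈ Icc (-(V:ℤ)) V, wt N (N / (8 * V)) y * ∑ x ∈ range N, wt N (N / (8 * U)) x * Psi b I x y ^ 2 := by
          refine sum_le_sum fun y _ => mul_le_mul_of_nonneg_left ?_ (hw _ _)
          exact inj_x N U (by omega) (fun x => wt N (N / (8 * U)) x * Psi b I x y ^ 2) (fun x => mul_nonneg (hw _ _) (sq_nonneg _))
            (fun x => by simp only [wt_per, (hper x y).1])
      _ ≤ _ := by
          refine inj_x N V (by omega) (fun y => wt N (N / (8 * V)) y * ∑ x ∈ range N, wt N (N / (8 * U)) x * Psi b I x y ^ 2)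
            (fun y => mul_nonneg (hw _ _) (sum_nonneg fun x _ => mul_nonneg (hw _ _) (sq_nonneg _))) (fun y => ?_)
          simp only [wt_per]
          congr 1
          exact sum_congr rfl fun x _ => by rw [(hper x y).2]
  have hlow : A.card * (L ^ 2 / 4) ≤ ∑ a ∈ A, wt N (N / (8 * V)) a.2 * (wt N (N / (8 * U)) a.1 * Psi b I a.1 a.2 ^ 2) := by
    rw [← nsmul_eq_mul]
    refine card_nsmul_le_sum _ _ _ fun a ha => ?_
    have h1 := wlow V hV hVN a.2 (hA a ha).2
    have h2 := wlow U hU hUN a.1 (hA a ha).1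
    have h3 := hL a ha
    calc L ^ 2 / 4 = (1 / 2) * ((1 / 2) * L ^ 2) := by ring
      _ ≤ _ := by gcongr
  linarith

lemma LocFam.sieve1 (hF : LocFam G K0 Sq b) {U V Q : ℕ} (hU : U ≠ 0) (hQ : 2 ≤ Q)
    (h16 : Q ^ 16 < 8 * U) (h14 : 16 * V < Q ^ 14) (A : Finset (ℤ × ℤ))
    (hA : ∀ a ∈ A, |a.1| ≤ U ∧ |a.2| ≤ V) (hA0 : ∀ a ∈ A, a.2 ≠ 0)
    (L : ℝ) (hL0 : 0 ≤ L) (hL : ∀ a ∈ A, L ≤ Psi b (Ix G Q (Q ^ 8)) a.1 a.2) :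
    A.card * L ^ 2 ≤ 4 *
    ((64 * (64 * U * V) * Q ^ 8) * (1 + Real.log ((Q:ℝ) ^ 8)) ^ 2) := by
  set N := 8 * U * (Q ^ 8).factorial with hNdef
  have hN : N ≠ 0 := by rw [hNdef]; positivity
  have hUN : 8 * U ∣ N := ⟨(Q ^ 8).factorial, by rw [hNdef]⟩
  have hfN : (Q ^ 8).factorial ∣ N := ⟨8 * U, by rw [hNdef]; ring⟩
  have hup := hF.upper1 hN hU hUN hQ hfN h16 h14
  have hU8 := Nat.le_of_dvd (Nat.pos_of_ne_zero hN) hUN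
  have wlow : ∀ (x : ℤ), |x| ≤ U → 1 / 2 ≤ wt N (N / (8 * U)) x := by
    intro x hx
    apply wt_lower
    · exact Nat.div_pos hU8 (by omega)
    · obtain ⟨k, hk⟩ := hUN
      rw [hk, Nat.mul_div_cancel_left _ (by omega)]
      push_cast
      nlinarith [abs_nonneg x]
  have hper := hF.Psi_per hQ hfN
  set I := Ix G Q (Q ^ 8)
  have key : ∑ a ∈ A, (wt N (N / (8 * U)) a.1 * Psi b I a.1 a.2 ^ 2) ≤
      ∑ y ∈ (Icc (-(V:ℤ)) V).filter (fun y => y ≠ 0), ∑ x ∈ range N, wt N (N / (8 * U)) x * Psi b I x y ^ 2 := by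
    have hw := wt_nonneg N
    have hsub : A ⊆ Icc (-(U:ℤ)) U ×ˢ (Icc (-(V:ℤ)) V).filter (fun y => y ≠ 0) := by
      intro a ha
      have := hA a ha
      rw [mem_product, mem_filter, mem_Icc, mem_Icc]
      exact ⟨_root_.abs_le.1 this.1, _root_.abs_le.1 this.2, hA0 a ha⟩
    calc _ ≤ ∑ a ∈ Icc (-(U:ℤ)) U ×ˢ (Icc (-(V:ℤ)) V).filter (fun y => y ≠ 0), (wt N (N / (8 * U)) a.1 * Psi b I a.1 a.2 ^ 2) :=
          sum_le_sum_of_subset_of_nonneg hsub fun a _ _ => (mul_nonneg (hw _ _) (sq_nonneg _))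
      _ = ∑ y ∈ (Icc (-(V:ℤ)) V).filter (fun y => y ≠ 0), ∑ x ∈ Icc (-(U:ℤ)) U, wt N (N / (8 * U)) x * Psi b I x y ^ 2 := by
          rw [sum_product_right]
      _ ≤ _ := by
          refine sum_le_sum fun y _ => ?_
          exact inj_x N U (by omega) (fun x => wt N (N / (8 * U)) x * Psi b I x y ^ 2) (fun x => mul_nonneg (hw _ _) (sq_nonneg _))
            (fun x => by simp only [wt_per, (hper x y).1])
  have hlow : A.card * (L ^ 2 / 4) ≤ ∑ a ∈ A, (wt N (N / (8 * U)) a.1 * Psi b I a.1 a.2 ^ 2) := by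
    rw [← nsmul_eq_mul]
    refine card_nsmul_le_sum _ _ _ fun a ha => ?_
    have h2 := wlow a.1 (hA a ha).1
    have h3 := hL a ha
    calc L ^ 2 / 4 ≤ (1 / 2) * L ^ 2 := by nlinarith [sq_nonneg L]
      _ ≤ _ := by gcongr
  linarith
end

end
end SqSieve
end

section
namespace SqSieve

noncomputable section
open Finset

lemma pick_Q (X : ℝ) (hX : 1 ≤ X) : ∃ Q : ℕ, 1 ≤ Q ∧ (Q:ℝ) ^ 8 ≤ X ∧ X ≤ 256 * (Q:ℝ) ^ 8 := by
  have hX0 : 0 ≤ X := by linarith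
  set z := X ^ ((1:ℝ) / 8) with hz
  have hz8 : z ^ 8 = X := by
    rw [hz, ← Real.rpow_natCast, ← Real.rpow_mul hX0]; norm_num
  have hz1 : 1 ≤ z := Real.one_le_rpow hX (by norm_num)
  have hz0 : 0 ≤ z := by linarith
  have hQ1 : 1 ≤ ⌊z⌋₊ := Nat.le_floor (by simpa using hz1)
  refine ⟨⌊z⌋₊, hQ1, ?_, ?_⟩
  · rw [← hz8]
    have := Nat.floor_le hz0
    gcongr
  · have h1 : z ≤ 2 * (⌊z⌋₊ : ℝ) := by
      have := (Nat.lt_floor_add_one z).le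
      have h2 : (1:ℝ) ≤ ⌊z⌋₊ := by exact_mod_cast hQ1
      linarith
    calc X = z ^ 8 := hz8.symm
      _ ≤ (2 * (⌊z⌋₊ : ℝ)) ^ 8 := by gcongr
      _ = _ := by ring

lemma finish (n c q T l u m R R' W : ℝ) (hc : 0 < c) (hq : 0 < q) (hT : 0 < T) (hl : 1 ≤ l) (hu0 : 0 ≤ u) (hm0 : 0 ≤ m)
    (H : n * (c * q * l / T) ^ 2 ≤ 4 * ((4096 * u * q + m * q ^ 2) * (1 + 8 * l) ^ 2))
    (hu : u ≤ R * q * W ^ 2) (hm : m ≤ R' * W ^ 2) : n ≤ 324 / c ^ 2 * (4096 * R + R') * W ^ 2 * T ^ 2 := by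
  have h1 : 4 * ((4096 * u * q + m * q ^ 2) * (1 + 8 * l) ^ 2) ≤ 4 * ((4096 * (R * q * W ^ 2) * q + (R' * W ^ 2) * q ^ 2) * (9 * l) ^ 2) := by
    have h0 : 0 ≤ 4096 * u * q + m * q ^ 2 := by positivity
    have h2 : 4096 * u * q + m * q ^ 2 ≤ 4096 * (R * q * W ^ 2) * q + (R' * W ^ 2) * q ^ 2 := by gcongr
    have h3 : (1 + 8 * l) ^ 2 ≤ (9 * l) ^ 2 := by gcongr; linarith
    have : 0 ≤ 4096 * (R * q * W ^ 2) * q + (R' * W ^ 2) * q ^ 2 := h0.trans h2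
    gcongr
  have h2 := H.trans h1
  have e : (c * q * l / T) ^ 2 = c ^ 2 * q ^ 2 * l ^ 2 / T ^ 2 := by ring
  have hpos : 0 < c ^ 2 * q ^ 2 * l ^ 2 / T ^ 2 := by positivity
  rw [e, ← le_div_iff₀ hpos] at h2
  refine h2.trans (le_of_eq ?_)
  field_simp
  ring

lemma trivial_count (U V : ℝ) (hU : 1 ≤ U) (hV : 1 ≤ V) (A : Finset (ℤ × ℤ)) (hA : ∀ a ∈ A, (|a.1| : ℝ) ≤ U ∧ (|a.2| : ℝ) ≤ V) :
    (A.card : ℝ) ≤ 9 * (U * V) := by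
  have hsub : A ⊆ Icc (-(⌊U⌋₊:ℤ)) ⌊U⌋₊ ×ˢ Icc (-(⌊V⌋₊:ℤ)) ⌊V⌋₊ := by
    intro a ha
    obtain ⟨h1, h2⟩ := hA a ha
    have key : ∀ (x : ℤ) (M : ℝ), (|x| : ℝ) ≤ M → |x| ≤ (⌊M⌋₊ : ℤ) := by
      intro x M h
      have : x.natAbs ≤ ⌊M⌋₊ := Nat.le_floor (by rw [Nat.cast_natAbs]; push_cast; exact h)
      rw [Int.abs_eq_natAbs]; exact_mod_cast this
    rw [mem_product, mem_Icc, mem_Icc]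
    exact ⟨abs_le.1 (key _ _ h1), abs_le.1 (key _ _ h2)⟩
  have hc := card_le_card hsub
  rw [card_product, Int.card_Icc, Int.card_Icc] at hc
  have e : ∀ n : ℕ, ((n:ℤ) + 1 - -(n:ℤ)).toNat = 2 * n + 1 := by intro n; omega
  rw [e, e] at hc
  have hfu := Nat.floor_le (show 0 ≤ U by linarith)
  have hfv := Nat.floor_le (show 0 ≤ V by linarith)
  calc (A.card : ℝ) ≤ (2 * (⌊U⌋₊:ℝ) + 1) * (2 * (⌊V⌋₊:ℝ) + 1) := by exact_mod_cast hc
    _ ≤ (3 * U) * (3 * V) := by gcongr <;> linarith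
    _ = _ := by ring

lemma ceil_facts (U : ℝ) (hU : 1 ≤ U) : ⌈U⌉₊ ≠ 0 ∧ U ≤ (⌈U⌉₊:ℝ) ∧ (⌈U⌉₊:ℝ) ≤ 2 * U := by
  have h1 := Nat.le_ceil U
  have h2 := Nat.ceil_lt_add_one (show 0 ≤ U by linarith)
  refine ⟨?_, h1, by linarith⟩
  have := Nat.ceil_pos.2 (show 0 < U by linarith)
  omega

lemma abs_ceil (x : ℤ) (U : ℝ) (h : (|x| : ℝ) ≤ U) : |x| ≤ (⌈U⌉₊ : ℤ) := by
  have : (|x| : ℝ) ≤ (⌈U⌉₊:ℝ) := h.trans (Nat.le_ceil U)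
  exact_mod_cast this

set_option maxHeartbeats 2000000 in
theorem sieve_main (K0 K1 : ℝ) (hK0 : 0 ≤ K0) (hK1 : 0 ≤ K1) : ∃ z0 : ℕ, ∃ C : ℝ, 0 < C ∧
    ∀ N0 : ℕ, N0 ≠ 0 → ∀ T : ℝ, Real.log 2 ≤ T → Real.log N0 ≤ K1 * T → ∀ (Sq : ℤ → ℤ → Prop) (b : ℕ → ℤ → ℤ → ℝ),
    LocFam (GG z0 N0) K0 Sq b → ∀ U V : ℝ, 1 ≤ V → V ≤ U → ∀ A : Finset (ℤ × ℤ),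
    (∀ a ∈ A, (|a.1| : ℝ) ≤ U ∧ (|a.2| : ℝ) ≤ V ∧ a.2 ≠ 0 ∧ Sq a.1 a.2) →
    (A.card : ℝ) ≤ C * (U * V) ^ ((2:ℝ) / 3) * T ^ 2 := by
  obtain ⟨z0, c, hc, C1, hC1, Q0, hQ0, hlow⟩ := lower_sum K0 K1 hK0 hK1
  have hlog2 : 0 < Real.log 2 := Real.log_pos (by norm_num)
  have hzc := zc_nonneg
  obtain ⟨Q1, hQ1, hQ1'⟩ : ∃ Q1, Q0 ≤ Q1 ∧ 512 ≤ Q1 := ⟨Q0 + 512, Nat.le_add_right _ _, Nat.le_add_left _ _⟩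
  set Ca : ℝ := 2304 * ((Q1:ℝ) ^ 8 / Real.log 2 ^ 2 + C1 ^ 2) with hCa
  set Cb : ℝ := 324 / c ^ 2 * (4096 * 1024 + 1536 * zc * K0 ^ 2) with hCb
  have hCa0 : 0 < Ca := by positivity
  have hCb0 : 0 < Cb := by positivity
  refine ⟨z0, Ca + Cb, by positivity, ?_⟩
  intro N0 hN0 T hT hNT Sq b hF U V hV hUV A hA
  have hU : 1 ≤ U := by linarith
  have hT0 : 0 < T := by linarith
  have hUV0 : 0 ≤ U * V := by positivity
  set W := (U * V) ^ ((1:ℝ) / 3) with hW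
  have hW3 : W ^ 3 = U * V := by rw [hW, ← Real.rpow_natCast, ← Real.rpow_mul hUV0]; norm_num
  have hW2 : (U * V) ^ ((2:ℝ) / 3) = W ^ 2 := by rw [hW, ← Real.rpow_natCast, ← Real.rpow_mul hUV0]; norm_num
  have hW1 : 1 ≤ W := Real.one_le_rpow (by nlinarith) (by norm_num)
  rw [hW2]
  have htriv := trivial_count U V hU hV A fun a ha => ⟨(hA a ha).1, (hA a ha).2.1⟩
  -- common small case
  have small : ∀ Q : ℕ, 1 ≤ Q → W ≤ 256 * (Q:ℝ) ^ 8 → ¬ (Q1 ≤ Q ∧ C1 * T ≤ (Q:ℝ) ^ 7) → (A.card : ℝ) ≤ (Ca + Cb) * W ^ 2 * T ^ 2 := by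
    intro Q hQ hWQ hn
    have hQr : (1:ℝ) ≤ Q := by exact_mod_cast hQ
    have h8 : (Q:ℝ) ^ 8 ≤ ((Q1:ℝ) ^ 8 / Real.log 2 ^ 2 + C1 ^ 2) * T ^ 2 := by
      by_cases h : Q1 ≤ Q
      · have h7 : (Q:ℝ) ^ 7 < C1 * T := by
          by_contra hcon; push Not at hcon; exact hn ⟨h, hcon⟩
        calc (Q:ℝ) ^ 8 ≤ (Q:ℝ) ^ 14 := pow_le_pow_right₀ hQr (by norm_num)
          _ = ((Q:ℝ) ^ 7) ^ 2 := by ring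
          _ ≤ (C1 * T) ^ 2 := by gcongr
          _ = C1 ^ 2 * T ^ 2 := by ring
          _ ≤ _ := by gcongr; exact le_add_of_nonneg_left (by positivity)
      · have h' : (Q:ℝ) ≤ Q1 := by exact_mod_cast (not_le.1 h).le
        calc (Q:ℝ) ^ 8 ≤ (Q1:ℝ) ^ 8 := by gcongr
          _ = (Q1:ℝ) ^ 8 / Real.log 2 ^ 2 * Real.log 2 ^ 2 := by field_simp
          _ ≤ (Q1:ℝ) ^ 8 / Real.log 2 ^ 2 * T ^ 2 := by gcongr
          _ ≤ _ := by gcongr; exact le_add_of_nonneg_right (by positivity)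
    calc (A.card : ℝ) ≤ 9 * (U * V) := htriv
      _ = 9 * W * W ^ 2 := by rw [← hW3]; ring
      _ ≤ 9 * (256 * (((Q1:ℝ) ^ 8 / Real.log 2 ^ 2 + C1 ^ 2) * T ^ 2)) * W ^ 2 := by gcongr; linarith
      _ = Ca * W ^ 2 * T ^ 2 := by rw [hCa]; ring
      _ ≤ _ := by gcongr; linarith
  -- lower bound for Psi
  have hPsi : ∀ Q : ℕ, Q1 ≤ Q → C1 * T ≤ (Q:ℝ) ^ 7 → ∀ a ∈ A,
      c * (Q:ℝ) ^ 8 * Real.log Q / T ≤ Psi b (Ix (GG z0 N0) Q (Q ^ 8)) a.1 a.2 := by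
    intro Q hQ hC a ha
    exact hlow N0 hN0 T hT hNT Q (hQ1.trans hQ) hC (fun ℓ => b ℓ a.1 a.2) (fun ℓ hℓ => hF.sq ℓ hℓ _ _ (hA a ha).2.2.2)
  obtain ⟨hU0, hU1, hU2⟩ := ceil_facts U hU
  obtain ⟨hV0, hV1, hV2⟩ := ceil_facts V hV
  have hUV4 : (⌈U⌉₊:ℝ) * ⌈V⌉₊ ≤ 4 * (U * V) := by
    calc (⌈U⌉₊:ℝ) * ⌈V⌉₊ ≤ (2 * U) * (2 * V) := by gcongr
      _ = _ := by ring
  have hA' : ∀ a ∈ A, |a.1| ≤ (⌈U⌉₊ : ℤ) ∧ |a.2| ≤ (⌈V⌉₊ : ℤ) := fun a ha =>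
    ⟨abs_ceil _ _ (hA a ha).1, abs_ceil _ _ (hA a ha).2.1⟩
  have hlogQ : ∀ Q : ℕ, Q1 ≤ Q → 1 ≤ Real.log Q := by
    intro Q hQ
    have h : (512:ℝ) ≤ Q := by exact_mod_cast hQ1'.trans hQ
    rw [Real.le_log_iff_exp_le (by linarith)]
    have := Real.exp_one_lt_d9
    linarith
  by_cases hreg : U ≤ V ^ 2
  · -- regime 2
    obtain ⟨Q, hQ, hQW, hWQ⟩ := pick_Q W hW1
    by_cases hbig : Q1 ≤ Q ∧ C1 * T ≤ (Q:ℝ) ^ 7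
    swap
    · exact small Q hQ hWQ hbig
    have hQr : (512:ℝ) ≤ Q := by exact_mod_cast hQ1'.trans hbig.1
    have hQr1 : (1:ℝ) ≤ Q := by linarith
    have hUW : U ≤ W ^ 2 := by
      by_contra hcon
      push Not at hcon
      have h1 : (W ^ 2) ^ 3 < U ^ 3 := by gcongr
      have h2 : (W ^ 2) ^ 3 = U ^ 2 * V ^ 2 := by rw [show (W ^ 2) ^ 3 = (W ^ 3) ^ 2 by ring, hW3]; ring
      nlinarith [pow_pos (show 0 < U by linarith) 2]
    have hQ12 : (Q:ℝ) ^ 12 ≤ U := by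
      apply le_of_sq_le_sq _ (by linarith)
      calc ((Q:ℝ) ^ 12) ^ 2 = ((Q:ℝ) ^ 8) ^ 3 := by ring
        _ ≤ W ^ 3 := by gcongr
        _ = U * V := hW3
        _ ≤ U ^ 2 := by nlinarith
    have hQ8 : (Q:ℝ) ^ 8 ≤ V := by
      by_contra hcon
      push Not at hcon
      have h1 : V ^ 3 < ((Q:ℝ) ^ 8) ^ 3 := by gcongr
      have h2 : ((Q:ℝ) ^ 8) ^ 3 ≤ W ^ 3 := by gcongr
      rw [hW3] at h2
      nlinarith
    have hV12 : V ≤ 4096 * (Q:ℝ) ^ 12 := by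
      apply le_of_sq_le_sq _ (by positivity)
      calc V ^ 2 ≤ U * V := by nlinarith
        _ = W ^ 3 := hW3.symm
        _ ≤ (256 * (Q:ℝ) ^ 8) ^ 3 := by gcongr
        _ = _ := by ring
    have hs := hF.sieve2 hK0 hU0 hV0 (le_trans (by norm_num) (hQ1'.trans hbig.1) : 2 ≤ Q) ?_ ?_ ?_ A hA' _ (by have := hlogQ Q hbig.1; positivity) (hPsi Q hbig.1 hbig.2)
    · have hf := finish (A.card : ℝ) c ((Q:ℝ) ^ 8) T (Real.log Q) ((⌈U⌉₊:ℝ) * ⌈V⌉₊) (4 * zc * (128 * K0 ^ 2 * ((Q:ℝ) ^ 16 + ⌈U⌉₊)))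
        1024 (1536 * zc * K0 ^ 2) W hc (by positivity) hT0 (hlogQ Q hbig.1) (by positivity) (by positivity) ?_ ?_ ?_
      · calc (A.card : ℝ) ≤ Cb * W ^ 2 * T ^ 2 := hf
          _ ≤ _ := by gcongr; linarith
      · refine hs.trans (le_of_eq ?_)
        rw [Real.log_pow]
        push_cast
        ring
      · calc (⌈U⌉₊:ℝ) * ⌈V⌉₊ ≤ 4 * (U * V) := hUV4
          _ = 4 * W * W ^ 2 := by rw [← hW3]; ring
          _ ≤ 4 * (256 * (Q:ℝ) ^ 8) * W ^ 2 := by gcongr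
          _ = _ := by ring
      · have h16 : (Q:ℝ) ^ 16 ≤ W ^ 2 := by
          calc (Q:ℝ) ^ 16 = ((Q:ℝ) ^ 8) ^ 2 := by ring
            _ ≤ _ := by gcongr
        calc _ ≤ 4 * zc * (128 * K0 ^ 2 * (W ^ 2 + 2 * W ^ 2)) := by gcongr; linarith
          _ = _ := by ring
    · have : (Q:ℝ) ^ 9 < 8 * (⌈U⌉₊:ℝ) := by
        have : (Q:ℝ) ^ 9 ≤ (Q:ℝ) ^ 12 := pow_le_pow_right₀ hQr1 (by norm_num)
        linarith
      exact_mod_cast this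
    · have : (Q:ℝ) ^ 2 < 8 * (⌈V⌉₊:ℝ) := by
        have : (Q:ℝ) ^ 2 ≤ (Q:ℝ) ^ 8 := pow_le_pow_right₀ hQr1 (by norm_num)
        linarith
      exact_mod_cast this
    · have : 16 * (⌈V⌉₊:ℝ) ≤ (Q:ℝ) ^ 14 := by
        calc 16 * (⌈V⌉₊:ℝ) ≤ 16 * (2 * (4096 * (Q:ℝ) ^ 12)) := by gcongr; linarith
          _ ≤ 512 ^ 2 * (Q:ℝ) ^ 12 := by nlinarith [pow_pos (show 0 < (Q:ℝ) by linarith) 12]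
          _ ≤ (Q:ℝ) ^ 2 * (Q:ℝ) ^ 12 := by gcongr
          _ = _ := by ring
      exact_mod_cast this
  · -- regime 1
    push Not at hreg
    set s := √U with hs
    have hs2 : s ^ 2 = U := Real.sq_sqrt (by linarith)
    have hs1 : 1 ≤ s := by rw [hs, Real.one_le_sqrt]; exact hU
    have hVs : V ≤ s := by apply Real.le_sqrt_of_sq_le; exact hreg.le
    have hWs : W ≤ s := by
      by_contra hcon
      push Not at hcon
      have h1 : s ^ 3 < W ^ 3 := by gcongr
      rw [hW3, ← hs2] at h1
      nlinarith [pow_pos (show 0 < s by linarith) 2]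
    obtain ⟨Q, hQ, hQW, hWQ⟩ := pick_Q s hs1
    by_cases hbig : Q1 ≤ Q ∧ C1 * T ≤ (Q:ℝ) ^ 7
    swap
    · exact small Q hQ (hWs.trans hWQ) hbig
    have hQr : (512:ℝ) ≤ Q := by exact_mod_cast hQ1'.trans hbig.1
    have hsv : s * V ≤ W ^ 2 := by
      by_contra hcon
      push Not at hcon
      have h1 : (W ^ 2) ^ 3 < (s * V) ^ 3 := by gcongr
      have h2 : (W ^ 2) ^ 3 = s ^ 4 * V ^ 2 := by rw [show (W ^ 2) ^ 3 = (W ^ 3) ^ 2 by ring, hW3, ← hs2]; ring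
      rw [h2, show (s * V) ^ 3 = s ^ 3 * V ^ 2 * V by ring, show s ^ 4 * V ^ 2 = s ^ 3 * V ^ 2 * s by ring] at h1
      have : s ^ 3 * V ^ 2 * V ≤ s ^ 3 * V ^ 2 * s := by gcongr
      linarith
    have hsi := hF.sieve1 (V := ⌈V⌉₊) hU0 (le_trans (by norm_num) (hQ1'.trans hbig.1) : 2 ≤ Q) ?_ ?_ A hA' (fun a ha => (hA a ha).2.2.1) _ (by have := hlogQ Q hbig.1; positivity) (hPsi Q hbig.1 hbig.2)
    · have hf := finish (A.card : ℝ) c ((Q:ℝ) ^ 8) T (Real.log Q) ((⌈U⌉₊:ℝ) * ⌈V⌉₊) 0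
        1024 (1536 * zc * K0 ^ 2) W hc (by positivity) hT0 (hlogQ Q hbig.1) (by positivity) le_rfl ?_ ?_ (by positivity)
      · calc (A.card : ℝ) ≤ Cb * W ^ 2 * T ^ 2 := hf
          _ ≤ _ := by gcongr; linarith
      · refine hsi.trans (le_of_eq ?_)
        rw [Real.log_pow]
        push_cast
        ring
      · calc (⌈U⌉₊:ℝ) * ⌈V⌉₊ ≤ 4 * (U * V) := hUV4
          _ = 4 * s * (s * V) := by rw [← hs2]; ring
          _ ≤ 4 * (256 * (Q:ℝ) ^ 8) * W ^ 2 := by gcongr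
          _ = _ := by ring
    · have : (Q:ℝ) ^ 16 < 8 * (⌈U⌉₊:ℝ) := by
        have : (Q:ℝ) ^ 16 ≤ U := by
          calc (Q:ℝ) ^ 16 = ((Q:ℝ) ^ 8) ^ 2 := by ring
            _ ≤ s ^ 2 := by gcongr
            _ = U := hs2
        linarith
      exact_mod_cast this
    · have : 16 * (⌈V⌉₊:ℝ) < (Q:ℝ) ^ 14 := by
        have hp : 0 < (Q:ℝ) ^ 8 := by positivity
        calc 16 * (⌈V⌉₊:ℝ) ≤ 16 * (2 * (256 * (Q:ℝ) ^ 8)) := by gcongr; linarith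
          _ < 512 ^ 6 * (Q:ℝ) ^ 8 := by nlinarith
          _ ≤ (Q:ℝ) ^ 6 * (Q:ℝ) ^ 8 := by gcongr
          _ = _ := by ring
      exact_mod_cast this

end
end SqSieve
end

section
namespace SqSieve

noncomputable section
open Finset

lemma sum_range_zmod {M : Type*} [AddCommMonoid M] (p : ℕ) [NeZero p] (g : ZMod p → M) :
    ∑ x ∈ range p, g (((x : ℕ) : ℤ) : ZMod p) = ∑ x : ZMod p, g x := by
  symm
  refine Finset.sum_bij (fun a _ => a.val) ?_ ?_ ?_ ?_
  · intro a _; exact mem_range.2 (ZMod.val_lt a)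
  · intro a _ b _ h; exact ZMod.val_injective p h
  · intro b hb
    exact ⟨(b : ZMod p), mem_univ _, ZMod.val_cast_of_lt (mem_range.1 hb)⟩
  · intro a _
    congr 1
    simp

lemma ee_eq (p : ℕ) [NeZero p] (a : ℤ) : ee p a = ZMod.stdAddChar (a : ZMod p) := by
  rw [ZMod.stdAddChar_coe]; rfl

/-- The binary form attached to a polynomial. -/
def Fv {R : Type*} [CommRing R] (D : ℕ) (f : Polynomial R) (x y : R) : R :=
  ∑ i ∈ range (D + 1), f.coeff i * x ^ i * y ^ (D - i)

lemma Fv_scale {R : Type*} [CommRing R] (D : ℕ) (f : Polynomial R) (hf : f.natDegree ≤ D) (t y : R) :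
    Fv D f (t * y) y = y ^ D * f.eval t := by
  rw [Fv, Polynomial.eval_eq_sum_range' (Nat.lt_succ_of_le hf), mul_sum]
  refine sum_congr rfl fun i hi => ?_
  have h : i ≤ D := Nat.lt_succ_iff.1 (mem_range.1 hi)
  calc f.coeff i * (t * y) ^ i * y ^ (D - i) = f.coeff i * t ^ i * (y ^ i * y ^ (D - i)) := by rw [mul_pow]; ring
    _ = _ := by rw [← pow_add, Nat.add_sub_cancel' h]; ring

lemma Fv_map {R S : Type*} [CommRing R] [CommRing S] (φ : R →+* S) (D : ℕ) (f : Polynomial R) (x y : R) :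
    Fv D (f.map φ) (φ x) (φ y) = φ (Fv D f x y) := by
  simp [Fv]

open Classical in
/-- The local weights. -/
def bb (D : ℕ) (f : Polynomial ℤ) (p : ℕ) (x y : ℤ) : ℝ :=
  if hp : p.Prime then
    haveI : Fact p.Prime := ⟨hp⟩
    bloc D (Fv D (f.map (Int.castRingHom (ZMod p)))) (x : ZMod p) (y : ZMod p)
  else 0

lemma bb_eq (D : ℕ) (f : Polynomial ℤ) (p : ℕ) [hp : Fact p.Prime] (x y : ℤ) :
    bb D f p x y = bloc D (Fv D (f.map (Int.castRingHom (ZMod p)))) (x : ZMod p) (y : ZMod p) := by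
  rw [bb, dif_pos hp.out]

lemma bb_row (D : ℕ) (f : Polynomial ℤ) (p : ℕ) [hp : Fact p.Prime] (h y : ℤ) :
    rowv p (fun x y => (bb D f p x y : ℂ)) h y =
      (∑ x : ZMod p, (bloc D (Fv D (f.map (Int.castRingHom (ZMod p)))) x (y : ZMod p) : ℂ) * ZMod.stdAddChar (x * (h : ZMod p))) / p := by
  rw [rowv, avg, ← sum_range_zmod]
  congr 1
  refine sum_congr rfl fun x _ => ?_
  rw [bb_eq, ee_eq]
  congr 2
  push_cast; ring

lemma locFam_bb (D : ℕ) (hD : Odd D) (f : Polynomial ℤ) (hd : f.natDegree ≤ D) (G : Set ℕ)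
    (hG : ∀ p ∈ G, p.Prime ∧ p ≠ 2 ∧ Squarefree (f.map (Int.castRingHom (ZMod p))) ∧
      2 ≤ (f.map (Int.castRingHom (ZMod p))).natDegree) :
    LocFam G (2 * (24 * D + 1069)) (fun x y => IsSquare (Fv D f x y)) (bb D f) := by
  have hd' : ∀ p : ℕ, (f.map (Int.castRingHom (ZMod p))).natDegree ≤ D := fun p =>
    (Polynomial.natDegree_map_le).trans hd
  refine ⟨fun p hp => (hG p hp).1, ?_, ?_, ?_, ?_, ?_, ?_⟩
  · intro p hp
    obtain ⟨hpp, hp2, hsq, hdeg⟩ := hG p hp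
    haveI : Fact p.Prime := ⟨hpp⟩
    refine ⟨fun y x => ?_, fun x y => ?_⟩ <;> simp [bb_eq]
  · intro p hp x y
    obtain ⟨hpp, hp2, hsq, hdeg⟩ := hG p hp
    haveI : Fact p.Prime := ⟨hpp⟩
    rw [bb_eq]
    exact bloc_abs D hD hp2 _ (hd' p) hsq hdeg _ (Fv_scale D _ (hd' p)) _ _
  · intro p hp x y hs
    obtain ⟨hpp, hp2, hsq, hdeg⟩ := hG p hp
    haveI : Fact p.Prime := ⟨hpp⟩
    rw [bb_eq]
    have h := bloc_sq D hD hp2 _ (hd' p) hsq hdeg _ (Fv_scale D _ (hd' p)) (x : ZMod p) (y : ZMod p) ?_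
    · refine le_trans (le_of_eq ?_) h
      rw [kap]; ring
    · have := Fv_map (Int.castRingHom (ZMod p)) D f x y
      rw [eq_intCast, eq_intCast] at this
      rw [this]
      exact hs.map _
  · intro p hp y hy
    obtain ⟨hpp, hp2, hsq, hdeg⟩ := hG p hp
    haveI : Fact p.Prime := ⟨hpp⟩
    have h := bloc_mean D (Fv D (f.map (Int.castRingHom (ZMod p)))) (y : ZMod p)
      (by rwa [Ne, ZMod.intCast_zmod_eq_zero_iff_dvd])
    rw [← sum_range_zmod] at h
    rw [avg]
    have e : ∑ x ∈ range p, (bb D f p x y : ℂ) = ((∑ x ∈ range p, bloc D (Fv D (f.map (Int.castRingHom (ZMod p)))) (((x : ℕ) : ℤ) : ZMod p) (y : ZMod p) : ℝ) : ℂ) := by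
      rw [Complex.ofReal_sum]
      exact sum_congr rfl fun x _ => by rw [bb_eq]
    rw [e, h]; simp
  · intro p hp h
    obtain ⟨hpp, hp2, hsq, hdeg⟩ := hG p hp
    haveI : Fact p.Prime := ⟨hpp⟩
    have hp0 : 0 < (p:ℝ) := by exact_mod_cast hpp.pos
    have hL := bloc_LN D hD _ (hd' p) hsq _ (Fv_scale D _ (hd' p)) (h : ZMod p)
    rw [← sum_range_zmod] at hL
    rw [LNv]
    have e : ∑ y ∈ range p, ‖rowv p (fun x y => (bb D f p x y : ℂ)) h y‖ ^ 2 ≤ (p:ℝ) ^ 2 / p ^ 2 := by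
      rw [le_div_iff₀ (by positivity), sum_mul]
      refine le_trans (le_of_eq (sum_congr rfl fun y _ => ?_)) hL
      rw [bb_row, norm_div, Complex.norm_natCast, div_pow, div_mul_cancel₀ _ (by positivity)]
    rw [div_self (by positivity)] at e
    gcongr
  · intro p hp h k
    obtain ⟨hpp, hp2, hsq, hdeg⟩ := hG p hp
    haveI : Fact p.Prime := ⟨hpp⟩
    have hp0 : 0 < (p:ℝ) := by exact_mod_cast hpp.pos
    have hL := bloc_hat D hD hp2 _ (hd' p) hsq hdeg _ (Fv_scale D _ (hd' p)) (h : ZMod p) (k : ZMod p)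
    rw [← sum_range_zmod] at hL
    rw [hatv, avg]
    have e : ∑ y ∈ range p, rowv p (fun x y => (bb D f p x y : ℂ)) h y * ee p (k * y) =
      (∑ y ∈ range p, (∑ x : ZMod p, (bloc D (Fv D (f.map (Int.castRingHom (ZMod p)))) x (((y:ℕ):ℤ) : ZMod p) : ℂ) * ZMod.stdAddChar (x * (h : ZMod p))) * ZMod.stdAddChar ((((y:ℕ):ℤ) : ZMod p) * (k : ZMod p))) / p := by
      rw [sum_div]
      refine sum_congr rfl fun y _ => ?_
      rw [bb_row, ee_eq, div_mul_eq_mul_div]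
      congr 3
      push_cast; ring
    rw [e, norm_div, norm_div, Complex.norm_natCast]
    calc _ ≤ (24 * D + 1069) * (p:ℝ) / p / p := by gcongr
      _ = (24 * D + 1069) / p := by field_simp
      _ ≤ _ := by
        gcongr
        have : (0:ℝ) ≤ D := by positivity
        linarith

end
end SqSieve
end

section
namespace SqSieve

noncomputable section
open Finset

/-- The bad integer of a polynomial. -/
def NN (f : Polynomial ℤ) : ℕ :=
  2 * (f.resultant (Polynomial.derivative f)).natAbs * f.leadingCoeff.natAbs

lemma NN_ne_zero (f : Polynomial ℤ) (hsq : Squarefree (f.map (Int.castRingHom ℚ))) : NN f ≠ 0 := by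
  have hinj : Function.Injective (Int.castRingHom ℚ) := Int.cast_injective
  have h0 : f ≠ 0 := by
    rintro rfl
    simp at hsq
  have hsep : (f.map (Int.castRingHom ℚ)).Separable := PerfectField.separable_iff_squarefree.2 hsq
  have hr := Polynomial.resultant_ne_zero _ _ hsep
  rw [Polynomial.derivative_map, Polynomial.natDegree_map_eq_of_injective hinj,
    Polynomial.natDegree_map_eq_of_injective hinj, Polynomial.resultant_map_map] at hr
  have hr' : f.resultant (Polynomial.derivative f) ≠ 0 := fun h => hr (by rw [h]; simp)
  have hl : f.leadingCoeff ≠ 0 := by simpa using h0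
  exact mul_ne_zero (mul_ne_zero two_ne_zero (Int.natAbs_ne_zero.2 hr')) (Int.natAbs_ne_zero.2 hl)

lemma NN_good (f : Polynomial ℤ) (hdeg : 2 ≤ f.natDegree) (p : ℕ) (hp : p.Prime) (hN : ¬ p ∣ NN f) :
    p ≠ 2 ∧ Squarefree (f.map (Int.castRingHom (ZMod p))) ∧ 2 ≤ (f.map (Int.castRingHom (ZMod p))).natDegree := by
  have : Fact p.Prime := ⟨hp⟩
  have hr : ((f.resultant (Polynomial.derivative f) : ℤ) : ZMod p) ≠ 0 := by
    rw [Ne, ZMod.intCast_zmod_eq_zero_iff_dvd]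
    intro h
    exact hN (((Int.natCast_dvd.1 h).mul_left 2).mul_right _)
  have hl : ((f.leadingCoeff : ℤ) : ZMod p) ≠ 0 := by
    rw [Ne, ZMod.intCast_zmod_eq_zero_iff_dvd]
    intro h
    exact hN ((Int.natCast_dvd.1 h).mul_left _)
  refine ⟨?_, ?_, ?_⟩
  · rintro rfl
    exact hN ((Dvd.intro _ rfl).mul_right _)
  · apply Polynomial.Separable.squarefree
    obtain ⟨u, v, -, -, h⟩ := Polynomial.exists_mul_add_mul_eq_C_resultant f (Polynomial.derivative f) le_rfl le_rfl (Or.inl (by omega))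
    have h2 := congrArg (Polynomial.map (Int.castRingHom (ZMod p))) h
    rw [Polynomial.map_add, Polynomial.map_mul, Polynomial.map_mul, Polynomial.map_C, ← Polynomial.derivative_map, eq_intCast] at h2
    refine ⟨Polynomial.C ((f.resultant (Polynomial.derivative f) : ℤ) : ZMod p)⁻¹ * u.map (Int.castRingHom (ZMod p)),
      Polynomial.C ((f.resultant (Polynomial.derivative f) : ℤ) : ZMod p)⁻¹ * v.map (Int.castRingHom (ZMod p)), ?_⟩
    calc _ = Polynomial.C ((f.resultant (Polynomial.derivative f) : ℤ) : ZMod p)⁻¹ * (Polynomial.map (Int.castRingHom (ZMod p)) f * Polynomial.map (Int.castRingHom (ZMod p)) u +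
          Polynomial.derivative (Polynomial.map (Int.castRingHom (ZMod p)) f) * Polynomial.map (Int.castRingHom (ZMod p)) v) := by ring
      _ = 1 := by rw [h2, ← Polynomial.C_mul, inv_mul_cancel₀ hr, Polynomial.C_1]
  · rw [Polynomial.natDegree_map_of_leadingCoeff_ne_zero]
    · exact hdeg
    · simpa using hl

lemma NN_le (D : ℕ) (hD : 1 ≤ D) (f : Polynomial ℤ) (hd : f.natDegree ≤ D) (H : ℕ) (hH : 1 ≤ H)
    (hc : ∀ i, |f.coeff i| ≤ (H:ℤ)) : (NN f : ℤ) ≤ 2 * ((2 * D).factorial * (D * H) ^ (2 * D)) * H := by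
  have hDH : (H:ℤ) ≤ D * H := by
    have : (1:ℤ) ≤ D := by exact_mod_cast hD
    have : (0:ℤ) ≤ H := by positivity
    nlinarith
  have h1 : (1:ℤ) ≤ D * H := by
    have : (1:ℤ) ≤ H := by exact_mod_cast hH
    linarith
  have hcd : ∀ i, |(Polynomial.derivative f).coeff i| ≤ (D * H : ℤ) := by
    intro i
    rw [Polynomial.coeff_derivative]
    by_cases hi : i + 1 ≤ D
    · rw [abs_mul, mul_comm]
      have : |(i:ℤ) + 1| ≤ D := by rw [abs_of_nonneg (by positivity)]; exact_mod_cast hi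
      gcongr
      exact hc _
    · rw [Polynomial.coeff_eq_zero_of_natDegree_lt (by omega)]
      simp; positivity
  have hr : |f.resultant (Polynomial.derivative f)| ≤ ((2 * D).factorial * (D * H) ^ (2 * D) : ℤ) := by
    have hn := Polynomial.natDegree_derivative_le f
    have := Matrix.det_le (A := f.sylvester (Polynomial.derivative f) f.natDegree (Polynomial.derivative f).natDegree)
      (abv := AbsoluteValue.abs) (x := (D * H : ℤ)) (by
        intro i j
        change |_| ≤ _
        rw [Polynomial.sylvester, Matrix.of_apply]
        induction j using Fin.addCases with
        | left j =>
          rw [Fin.addCases_left]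
          split_ifs
          · exact hcd _
          · simp; positivity
        | right j =>
          rw [Fin.addCases_right]
          split_ifs
          · exact (hc _).trans hDH
          · simp; positivity)
    rw [Polynomial.resultant]
    refine le_trans this ?_
    rw [nsmul_eq_mul, Fintype.card_fin]
    have hle : f.natDegree + (Polynomial.derivative f).natDegree ≤ 2 * D := by omega
    gcongr
  rw [NN]
  push_cast
  gcongr
  exact hc _

theorem core (D : ℕ) (hD : 3 ≤ D) (hodd : Odd D) : ∃ C : ℝ, 0 < C ∧ ∀ f : Polynomial ℤ, f.natDegree ≤ D → 2 ≤ f.natDegree →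
    Squarefree (f.map (Int.castRingHom ℚ)) → ∀ H : ℕ, 1 ≤ H → (∀ i, |f.coeff i| ≤ (H:ℤ)) →
    ∀ U V : ℝ, 1 ≤ V → V ≤ U → ∀ A : Finset (ℤ × ℤ),
    (∀ a ∈ A, (|a.1| : ℝ) ≤ U ∧ (|a.2| : ℝ) ≤ V ∧ a.2 ≠ 0 ∧ IsSquare (Fv D f a.1 a.2)) →
    (A.card : ℝ) ≤ C * (U * V) ^ ((2:ℝ) / 3) * Real.log (2 * H) ^ 2 := by
  have hlog2 : 0 < Real.log 2 := Real.log_pos (by norm_num)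
  set B : ℝ := 2 * (((2 * D).factorial : ℝ) * (D:ℝ) ^ (2 * D)) with hB
  have hD1 : (1:ℝ) ≤ D := by exact_mod_cast (by omega)
  have hB1 : 1 ≤ B := by
    have h1 : (1:ℝ) ≤ ((2 * D).factorial : ℝ) := by exact_mod_cast (Nat.factorial_pos _)
    have h2 : (1:ℝ) ≤ (D:ℝ) ^ (2 * D) := one_le_pow₀ hD1
    nlinarith
  have hlB : 0 ≤ Real.log B := Real.log_nonneg hB1
  obtain ⟨z0, C, hC, hmain⟩ := sieve_main (2 * (24 * D + 1069)) (Real.log B / Real.log 2 + (2 * D + 1)) (by positivity) (by positivity)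
  refine ⟨C, hC, ?_⟩
  intro f hd hdeg hsq H hH hc U V hV hUV A hA
  have hH1 : (1:ℝ) ≤ H := by exact_mod_cast hH
  have hT : Real.log 2 ≤ Real.log (2 * H) := Real.log_le_log (by norm_num) (by linarith)
  have hT2 : Real.log H ≤ Real.log (2 * H) := Real.log_le_log (by linarith) (by linarith)
  refine hmain (NN f) (NN_ne_zero f hsq) (Real.log (2 * H)) hT ?_ _ _ (locFam_bb D hodd f hd _ ?_) U V hV hUV A hA
  · have h1 : (NN f : ℝ) ≤ B * (H:ℝ) ^ (2 * D + 1) := by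
      have := NN_le D (by omega) f hd H hH hc
      have h2 : (NN f : ℝ) ≤ 2 * ((2 * D).factorial * (D * H) ^ (2 * D)) * H := by exact_mod_cast this
      refine h2.trans (le_of_eq ?_)
      rw [hB, mul_pow]; ring
    have h0 : (0:ℝ) < NN f := by exact_mod_cast Nat.pos_of_ne_zero (NN_ne_zero f hsq)
    calc Real.log (NN f) ≤ Real.log (B * (H:ℝ) ^ (2 * D + 1)) := Real.log_le_log h0 h1
      _ = Real.log B / Real.log 2 * Real.log 2 + (2 * D + 1) * Real.log H := by
        rw [Real.log_mul (by positivity) (by positivity), Real.log_pow]; push_cast; field_simp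
      _ ≤ Real.log B / Real.log 2 * Real.log (2 * H) + (2 * D + 1) * Real.log (2 * H) := by gcongr
      _ = _ := by ring
  · rintro p ⟨hp, -, hN⟩
    exact ⟨hp, NN_good f hdeg p hp hN⟩

end
end SqSieve
end

section
namespace SqSieve

noncomputable section
open Finset

/-- dehomogenization -/
def dh {R : Type*} [CommRing R] (D : ℕ) (F : MvPolynomial (Fin 2) R) : Polynomial R :=
  ∑ i ∈ range (D + 1), Polynomial.monomial i (F.coeff (Finsupp.single 0 i + Finsupp.single 1 (D - i)))

lemma dh_coeff {R : Type*} [CommRing R] (D : ℕ) (F : MvPolynomial (Fin 2) R) (i : ℕ) :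
    (dh D F).coeff i = if i ≤ D then F.coeff (Finsupp.single 0 i + Finsupp.single 1 (D - i)) else 0 := by
  rw [dh, Polynomial.finsetSum_coeff]
  simp only [Polynomial.coeff_monomial]
  rw [Finset.sum_ite_eq']
  simp

lemma dh_natDegree {R : Type*} [CommRing R] (D : ℕ) (F : MvPolynomial (Fin 2) R) : (dh D F).natDegree ≤ D := by
  rw [Polynomial.natDegree_le_iff_coeff_eq_zero]
  intro i hi
  rw [dh_coeff, if_neg (by omega)]

lemma dh_homogenize {R : Type*} [CommRing R] (D : ℕ) (F : MvPolynomial (Fin 2) R) (hF : F.IsHomogeneous D) :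
    (dh D F).homogenize D = F := by
  ext m
  rw [Polynomial.coeff_homogenize, dh_coeff]
  split_ifs with h1 h2
  · congr 1
    ext i
    fin_cases i
    · simp
    · simp; omega
  · omega
  · by_contra h
    have := hF (Ne.symm h)
    apply h1
    rw [← this, Finsupp.weight_apply, Finsupp.sum_fintype _ _ (by simp)]
    simp

lemma eval_homogenize' {R : Type*} [CommRing R] (D : ℕ) (f : Polynomial R) (x y : R) :
    MvPolynomial.eval ![x, y] (f.homogenize D) = Fv D f x y := by
  rw [Polynomial.homogenize, Finset.Nat.sum_antidiagonal_eq_sum_range_succ_mk, MvPolynomial.eval_sum, Fv]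
  refine sum_congr rfl fun i _ => ?_
  rw [Finsupp.update_eq_add_single (by simp), MvPolynomial.eval_monomial, Finsupp.prod_add_index' (by simp) (by intros; rw [pow_add])]
  simp [mul_assoc]

lemma dh_map (D : ℕ) (F : MvPolynomial (Fin 2) ℤ) :
    (dh D F).map (Int.castRingHom ℚ) = dh D (MvPolynomial.map (Int.castRingHom ℚ) F) := by
  ext i
  rw [Polynomial.coeff_map, dh_coeff, dh_coeff, MvPolynomial.coeff_map]
  split_ifs <;> simp

lemma dh_squarefree (D : ℕ) (F : MvPolynomial (Fin 2) ℚ) (hF : F.IsHomogeneous D) (h0 : F ≠ 0)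
    (hsq : Squarefree F) : Squarefree (dh D F) ∧ D - 1 ≤ (dh D F).natDegree := by
  have hh := dh_homogenize D F hF
  have hd := dh_natDegree D F
  have hf0 : dh D F ≠ 0 := by
    intro h; rw [h] at hh; simp at hh; exact h0 hh.symm
  have key : ∀ G : MvPolynomial (Fin 2) ℚ, ∀ (x : Fin 2 → ℚ), IsUnit G → MvPolynomial.eval x G = 0 → False := by
    intro G x hG h
    have := hG.map (MvPolynomial.eval x)
    rw [h] at this
    simp at this
  constructor
  · intro g hg
    obtain ⟨q, hq⟩ := hg
    have hg0 : g ≠ 0 := by rintro rfl; simp at hq; exact hf0 hq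
    have hq0 : q ≠ 0 := by rintro rfl; simp at hq; exact hf0 hq
    have hdeg : (dh D F).natDegree = g.natDegree + g.natDegree + q.natDegree := by
      rw [hq, Polynomial.natDegree_mul (mul_ne_zero hg0 hg0) hq0, Polynomial.natDegree_mul hg0 hg0]
    obtain ⟨k, hk⟩ := Nat.exists_eq_add_of_le hd
    have e : F = g.homogenize g.natDegree * g.homogenize g.natDegree * q.homogenize (q.natDegree + k) := by
      rw [← Polynomial.homogenize_mul g g le_rfl le_rfl, ← Polynomial.homogenize_mul (g * g) q (Polynomial.natDegree_mul_le) (by omega),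
        ← hq, ← add_assoc, ← hdeg, ← hk, hh]
    have hu := hsq _ (Dvd.intro _ e.symm)
    by_contra hgu
    have hpos : g.natDegree ≠ 0 := by
      intro h
      apply hgu
      rw [Polynomial.natDegree_eq_zero] at h
      obtain ⟨c, rfl⟩ := h
      rw [Polynomial.isUnit_C, isUnit_iff_ne_zero]
      rintro rfl; simp at hg0
    refine key _ ![0, 0] hu ?_
    rw [eval_homogenize', Fv]
    refine sum_eq_zero fun i hi => ?_
    by_cases hi0 : i = 0
    · subst hi0; simp [hpos]
    · simp [hi0]
  · by_contra hcon
    push Not at hcon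
    obtain ⟨k, hk⟩ : ∃ k, D = k + (1 + 1) := ⟨D - 2, by omega⟩
    have e : F = MvPolynomial.X 1 * MvPolynomial.X 1 * (dh D F).homogenize k := by
      have h1 : (1 : Polynomial ℚ).homogenize 1 = MvPolynomial.X 1 := by simp
      rw [← h1, ← Polynomial.homogenize_mul 1 1 (by simp) (by simp), ← Polynomial.homogenize_mul (1 * 1) _ (by simp) (by omega),
        mul_one, one_mul, add_comm, ← hk, hh]
    have hu := hsq _ (Dvd.intro _ e.symm)
    exact key _ ![0, 0] hu (by simp)

lemma line_sq (c : ℕ) (hc : c ≠ 0) : ∃ c0 : ℕ, c0 ≠ 0 ∧ ∀ (k a N : ℕ), N ≠ 0 → c * a ^ (2 * k + 1) = N ^ 2 → ∃ m, a = c0 * m ^ 2 := by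
  obtain ⟨c0, e, he, hsf⟩ := Nat.sq_mul_squarefree c
  have hc0 : c0 ≠ 0 := hsf.ne_zero
  refine ⟨c0, hc0, ?_⟩
  intro k a N hN h
  have h1 : (c0 * a) * (e * a ^ k) ^ 2 = N ^ 2 := by rw [← h, ← he]; ring
  have h2 : e * a ^ k ∣ N := by
    rw [← Nat.pow_dvd_pow_iff two_ne_zero]; exact Dvd.intro_left _ h1
  obtain ⟨m, hm⟩ := h2
  have h3 : (e * a ^ k) ^ 2 ≠ 0 := by
    intro h0
    rw [h0, mul_zero] at h1
    exact hN (pow_eq_zero_iff two_ne_zero |>.1 h1.symm)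
  have h4 : c0 * a = m ^ 2 := by
    apply Nat.eq_of_mul_eq_mul_right (Nat.pos_of_ne_zero h3)
    rw [h1, hm]; ring
  have h5 : c0 ∣ m := by
    rw [← hsf.dvd_pow_iff_dvd two_ne_zero]
    exact Dvd.intro _ h4
  obtain ⟨m', rfl⟩ := h5
  refine ⟨m', ?_⟩
  apply Nat.eq_of_mul_eq_mul_left (Nat.pos_of_ne_zero hc0)
  rw [h4]; ring

lemma line_count (D : ℕ) (hodd : Odd D) (c : ℤ) (U : ℝ) (hU : 1 ≤ U) (A : Finset (ℤ × ℤ))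
    (hA : ∀ a ∈ A, (|a.1| : ℝ) ≤ U ∧ a.2 = 0 ∧ ∃ n : ℤ, n ≠ 0 ∧ c * a.1 ^ D = n ^ 2) : (A.card : ℝ) ≤ 4 * √U := by
  rcases A.eq_empty_or_nonempty with rfl | ⟨a0, ha0⟩
  · simp
  have hc : c.natAbs ≠ 0 := by
    obtain ⟨-, -, n, hn, h⟩ := hA a0 ha0
    intro h0
    rw [Int.natAbs_eq_zero] at h0
    rw [h0, zero_mul] at h
    exact hn (pow_eq_zero_iff two_ne_zero |>.1 h.symm)
  obtain ⟨c0, hc0, hline⟩ := line_sq _ hc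
  obtain ⟨k, hk⟩ := hodd
  set M := ⌊√U⌋₊ with hM
  set B := (range (M + 1)).image (fun m : ℕ => (((c0 * m ^ 2 : ℕ) : ℤ), (0:ℤ))) with hB
  set B' := (range (M + 1)).image (fun m : ℕ => (-((c0 * m ^ 2 : ℕ) : ℤ), (0:ℤ))) with hB'
  have hsub : A ⊆ B ∪ B' := by
    intro a ha
    obtain ⟨hu, h2, n, hn, h⟩ := hA a ha
    have hnat : c.natAbs * a.1.natAbs ^ (2 * k + 1) = n.natAbs ^ 2 := by
      rw [← Int.natAbs_pow, ← Int.natAbs_mul, ← hk, h, Int.natAbs_pow]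
    obtain ⟨m, hm⟩ := hline k _ _ (Int.natAbs_ne_zero.2 hn) hnat
    have hmM : m < M + 1 := by
      rw [Nat.lt_succ_iff]
      apply Nat.le_floor
      apply Real.le_sqrt_of_sq_le
      have : m ^ 2 ≤ a.1.natAbs := by rw [hm]; exact Nat.le_mul_of_pos_left _ (Nat.pos_of_ne_zero hc0)
      calc ((m:ℝ)) ^ 2 ≤ (a.1.natAbs : ℝ) := by exact_mod_cast this
        _ = |(a.1 : ℝ)| := by rw [Nat.cast_natAbs]; push_cast; rfl
        _ ≤ U := hu
    rw [mem_union]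
    rcases Int.natAbs_eq a.1 with h | h
    · left; rw [hB, mem_image]
      exact ⟨m, mem_range.2 hmM, Prod.ext (by rw [← hm]; exact h.symm) h2.symm⟩
    · right; rw [hB', mem_image]
      exact ⟨m, mem_range.2 hmM, Prod.ext (by rw [← hm]; exact h.symm) h2.symm⟩
  have h1 : A.card ≤ (M + 1) + (M + 1) := by
    refine (card_le_card hsub).trans ((card_union_le _ _).trans (add_le_add ?_ ?_)) <;>
      exact (card_image_le).trans (by simp)
  have h2 : (A.card : ℝ) ≤ (M + 1) + (M + 1) := by exact_mod_cast h1
  have h3 : (M:ℝ) ≤ √U := Nat.floor_le (Real.sqrt_nonneg _)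
  have h4 : 1 ≤ √U := by rw [Real.one_le_sqrt]; exact hU
  linarith

/-- the counted set -/
def SS (F : MvPolynomial (Fin 2) ℤ) (U V : ℝ) : Set (ℤ × ℤ) :=
  {p : ℤ × ℤ | (|p.1| : ℝ) ≤ U ∧ (|p.2| : ℝ) ≤ V ∧ ∃ n : ℤ, n ≠ 0 ∧ MvPolynomial.eval ![p.1, p.2] F = n ^ 2}

lemma SS_finite (F : MvPolynomial (Fin 2) ℤ) (U V : ℝ) : (SS F U V).Finite := by
  have hfin : ∀ M : ℝ, {x : ℤ | (|x| : ℝ) ≤ M}.Finite := by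
    intro M
    apply (Set.finite_Icc (-(⌈M⌉₊:ℤ)) ⌈M⌉₊).subset
    intro x hx
    exact abs_le.1 (abs_ceil x M hx)
  exact ((hfin U).prod (hfin V)).subset fun p hp => ⟨hp.1, hp.2.1⟩

theorem half (D : ℕ) (hD : 3 ≤ D) (hodd : Odd D) : ∃ C : ℝ, 0 < C ∧ ∀ F : MvPolynomial (Fin 2) ℤ, F ≠ 0 → F.IsHomogeneous D →
      Squarefree (MvPolynomial.map (Int.castRingHom ℚ) F) → ∀ H : ℕ, 1 ≤ H → (∀ d, |F.coeff d| ≤ (H:ℤ)) →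
      ∀ U V : ℝ, 1 ≤ V → V ≤ U → ((SS F U V).ncard : ℝ) ≤ C * (U * V) ^ ((2:ℝ) / 3) * Real.log (2 * H) ^ 2 := by
  obtain ⟨C, hC, hcore⟩ := core D hD hodd
  have hlog2 : 0 < Real.log 2 := Real.log_pos (by norm_num)
  refine ⟨C + 4 / Real.log 2 ^ 2, by positivity, ?_⟩
  intro F h0 hF hsq H hH hc U V hV hUV
  have hU : 1 ≤ U := hV.trans hUV
  have hmap0 : MvPolynomial.map (Int.castRingHom ℚ) F ≠ 0 := hsq.ne_zero
  obtain ⟨hs1, hs2⟩ := dh_squarefree D _ (hF.map _) hmap0 hsq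
  rw [← dh_map] at hs1 hs2
  rw [Polynomial.natDegree_map_eq_of_injective (Int.cast_injective : Function.Injective (Int.castRingHom ℚ))] at hs2
  have hev : ∀ x y : ℤ, MvPolynomial.eval ![x, y] F = Fv D (dh D F) x y := by
    intro x y
    conv_lhs => rw [← dh_homogenize D F hF]
    exact eval_homogenize' _ _ _ _
  have hfin := SS_finite F U V
  classical
  rw [Set.ncard_eq_toFinset_card _ hfin]
  set A := hfin.toFinset with hA
  have hmem : ∀ a ∈ A, a ∈ SS F U V := fun a ha => hfin.mem_toFinset.1 ha
  have hH1 : (1:ℝ) ≤ H := by exact_mod_cast hH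
  have hT : Real.log 2 ≤ Real.log (2 * H) := Real.log_le_log (by norm_num) (by linarith)
  have hA1 := hcore (dh D F) (dh_natDegree D F) (by omega) hs1 H hH (by
    intro i
    rw [dh_coeff]
    split_ifs
    · exact hc _
    · simp) U V hV hUV (A.filter fun a => a.2 ≠ 0) (by
      intro a ha
      rw [mem_filter] at ha
      obtain ⟨h1, h2, n, hn, h3⟩ := hmem a ha.1
      refine ⟨h1, h2, ha.2, n, ?_⟩
      rw [← hev, h3, sq])
  have hA0 := line_count D hodd ((dh D F).coeff D) U hU (A.filter fun a => ¬ a.2 ≠ 0) (by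
      intro a ha
      rw [mem_filter, not_not] at ha
      obtain ⟨h1, h2, n, hn, h3⟩ := hmem a ha.1
      refine ⟨h1, ha.2, n, hn, ?_⟩
      rw [hev, ha.2, Fv, sum_range_succ, sum_eq_zero] at h3
      · simpa using h3
      · intro i hi
        have : D - i ≠ 0 := by have := mem_range.1 hi; omega
        simp [this])
  have hcard := card_filter_add_card_filter_not (s := A) (fun a : ℤ × ℤ => a.2 ≠ 0)
  have hcr : (A.card : ℝ) = ((A.filter fun a => a.2 ≠ 0).card : ℝ) + ((A.filter fun a => ¬ a.2 ≠ 0).card : ℝ) := by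
    exact_mod_cast hcard.symm
  have hsq2 : 4 * √U ≤ 4 / Real.log 2 ^ 2 * (U * V) ^ ((2:ℝ) / 3) * Real.log (2 * H) ^ 2 := by
    have h1 : √U ≤ (U * V) ^ ((2:ℝ) / 3) := by
      rw [Real.sqrt_eq_rpow]
      calc U ^ ((1:ℝ) / 2) ≤ U ^ ((2:ℝ) / 3) := Real.rpow_le_rpow_of_exponent_le hU (by norm_num)
        _ ≤ _ := Real.rpow_le_rpow (by linarith) (by nlinarith) (by norm_num)
    calc 4 * √U ≤ 4 * (U * V) ^ ((2:ℝ) / 3) := by gcongr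
      _ = 4 / Real.log 2 ^ 2 * (U * V) ^ ((2:ℝ) / 3) * Real.log 2 ^ 2 := by field_simp
      _ ≤ _ := by gcongr
  rw [hcr]
  calc _ ≤ C * (U * V) ^ ((2:ℝ) / 3) * Real.log (2 * H) ^ 2 + 4 / Real.log 2 ^ 2 * (U * V) ^ ((2:ℝ) / 3) * Real.log (2 * H) ^ 2 :=
        add_le_add hA1 (hA0.trans hsq2)
    _ = _ := by ring

lemma coeff_le_polyNorm (F : MvPolynomial (Fin 2) ℤ) (d : Fin 2 →₀ ℕ) : |F.coeff d| ≤ (polyNorm F : ℤ) := by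
  by_cases h : d ∈ F.support
  · have := Finset.le_sup (f := fun d => (F.coeff d).natAbs) h
    rw [Int.abs_eq_natAbs]
    exact_mod_cast this
  · rw [MvPolynomial.notMem_support_iff] at h
    rw [h]; simp

lemma one_le_polyNorm (F : MvPolynomial (Fin 2) ℤ) (h : F ≠ 0) : 1 ≤ polyNorm F := by
  obtain ⟨d, hd⟩ := MvPolynomial.ne_zero_iff.1 h
  have h1 := coeff_le_polyNorm F d
  have := abs_pos.2 hd
  exact_mod_cast (by linarith : (0:ℤ) + 1 ≤ polyNorm F)

theorem full (D : ℕ) (hD : 3 ≤ D) (hodd : Odd D) :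
    ∃ C : ℝ, 0 < C ∧ ∀ F : MvPolynomial (Fin 2) ℤ, F ≠ 0 → F.IsHomogeneous D →
      Squarefree (MvPolynomial.map (Int.castRingHom ℚ) F) →
      ∀ U V : ℝ, 1 ≤ U → 1 ≤ V →
        (((SS F U V)).ncard : ℝ) ≤ C * (U * V) ^ ((2 : ℝ) / 3) * Real.log (2 * polyNorm F) ^ 2 := by
  obtain ⟨C, hC, hhalf⟩ := half D hD hodd
  refine ⟨C, hC, ?_⟩
  intro F h0 hF hsq U V hU hV
  rcases le_total V U with h | h
  · exact hhalf F h0 hF hsq _ (one_le_polyNorm F h0) (coeff_le_polyNorm F) U V hV h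
  set e : Fin 2 ≃ Fin 2 := Equiv.swap 0 1 with he
  set F' := MvPolynomial.rename e F with hF'
  have hinj := MvPolynomial.rename_injective (R := ℤ) e e.injective
  have h0' : F' ≠ 0 := fun hz => h0 (hinj (by rw [map_zero]; exact hz))
  have hsq' : Squarefree (MvPolynomial.map (Int.castRingHom ℚ) F') := by
    rw [hF', MvPolynomial.map_rename]
    intro x hx
    set E := MvPolynomial.renameEquiv ℚ e
    have h1 : E.symm x * E.symm x ∣ MvPolynomial.map (Int.castRingHom ℚ) F := by
      rw [← map_mul]
      have h2 := map_dvd E.symm hx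
      have h3 : E.symm (MvPolynomial.rename e (MvPolynomial.map (Int.castRingHom ℚ) F)) = MvPolynomial.map (Int.castRingHom ℚ) F :=
        E.symm_apply_apply _
      rwa [h3] at h2
    have h2 := (hsq _ h1).map E
    rwa [E.apply_symm_apply] at h2
  have hc' : ∀ d, |F'.coeff d| ≤ (polyNorm F : ℤ) := by
    intro d
    have : d = (d.mapDomain e.symm).mapDomain e := by
      rw [← Finsupp.mapDomain_comp]; simp
    rw [this, hF', MvPolynomial.coeff_rename_mapDomain _ e.injective]
    exact coeff_le_polyNorm F _
  have hmain := hhalf F' h0' (hF.rename_isHomogeneous) hsq' _ (one_le_polyNorm F h0) hc' V U hU h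
  rw [mul_comm U V]
  refine le_trans ?_ hmain
  have himg : (Prod.swap '' SS F U V) ⊆ SS F' V U := by
    rintro _ ⟨⟨x, y⟩, ⟨h1, h2, n, hn, h3⟩, rfl⟩
    refine ⟨h2, h1, n, hn, ?_⟩
    rw [hF', MvPolynomial.eval_rename, ← h3]
    congr 2
    ext i
    fin_cases i <;> simp [he]
  have h1 := Set.ncard_le_ncard himg (SS_finite F' V U)
  rw [Set.ncard_image_of_injective _ Prod.swap_injective] at h1
  exact_mod_cast h1

end
end SqSieve
end

open MvPolynomial

/-- Let `D ≥ 3` be odd. There is a constant `C(D)` such that for every nonzero binary form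
`F ∈ ℤ[X, Y]` of degree `D` with no repeated factor (i.e. squarefree over `ℚ`) and all real
`U, V ≥ 1`, the number of integer pairs `(x, y)` with `|x| ≤ U`, `|y| ≤ V` for which `F(x, y)`
is a nonzero square satisfies `μ(U, V) ≤ C(D) (UV)^{2/3} (log 2‖F‖)²`. -/
theorem square_sieve_binary_form' (D : ℕ) (hD : 3 ≤ D) (hodd : Odd D) :
    ∃ C : ℝ, 0 < C ∧ ∀ F : MvPolynomial (Fin 2) ℤ, F ≠ 0 → F.IsHomogeneous D →
      Squarefree (MvPolynomial.map (Int.castRingHom ℚ) F) →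
      ∀ U V : ℝ, 1 ≤ U → 1 ≤ V →
        (({p : ℤ × ℤ | (|p.1| : ℝ) ≤ U ∧ (|p.2| : ℝ) ≤ V ∧
            ∃ n : ℤ, n ≠ 0 ∧ MvPolynomial.eval ![p.1, p.2] F = n ^ 2}).ncard : ℝ) ≤
          C * (U * V) ^ ((2 : ℝ) / 3) * Real.log (2 * polyNorm F) ^ 2 := by
  exact SqSieve.full D hD hodd
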